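/- Let d ≥ 1, β₀ ≥ 0 and h₀ ∈ ℝ, and suppose that some Gibbs measure for the nearest-neighbour Ising model on ℤ^d at (β₀,h₀) is weak mixing. Then the pressure is analytic in both variables near (β₀,h₀): there exist an open set U ⊆ ℝ² containing (β₀,h₀) and a real-analytic function F : U → ℝ such that for every (β,h) ∈ U, (2N)^{−d} log Z_{N,β,h} converges to F(β,h) as N → ∞. -/

import Mathlib

open MeasureTheory Filter

namespace IsingP

abbrev Site (d : ℕ) := Fin d → ℤ
abbrev Config (d : ℕ) := Site d → Bool

noncomputable def spin (b : Bool) : ℝ := if b then 1 else -1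

def nbrs {d : ℕ} (i : Site d) : Finset (Site d) :=
  Finset.univ.image
    (fun q : Fin d × Bool => fun k => if k = q.1 then i k + (if q.2 then 1 else -1) else i k)

noncomputable def hamElem {d : ℕ} (β h : ℝ) (Λ : Finset (Site d)) (η ω : Config d) : ℝ :=
  β * (2⁻¹ * ∑ i ∈ Λ, ∑ j ∈ nbrs i ∩ Λ, spin (η i) * spin (η j))
    + β * ∑ i ∈ Λ, ∑ j ∈ nbrs i \ Λ, spin (η i) * spin (ω j)
    + h * ∑ i ∈ Λ, spin (η i)

def patch {d : ℕ} (Λ : Finset (Site d)) (η : {x // x ∈ Λ} → Bool) (ω : Config d) : Config d :=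
  fun i => if hi : i ∈ Λ then η ⟨i, hi⟩ else ω i

noncomputable def localDensity {d : ℕ} (β h : ℝ) (Λ : Finset (Site d))
    (f : Config d → ℝ) (ω : Config d) : ℝ :=
  (∑ η : {x // x ∈ Λ} → Bool, f (patch Λ η ω) * Real.exp (hamElem β h Λ (patch Λ η ω) ω)) /
    (∑ η : {x // x ∈ Λ} → Bool, Real.exp (hamElem β h Λ (patch Λ η ω) ω))

def IsGibbs (d : ℕ) (β h : ℝ) (μ : Measure (Config d)) : Prop :=
  IsProbabilityMeasure μ ∧
    ∀ (Λ : Finset (Site d)) (f : Config d → ℝ), Measurable f → (∃ M, ∀ σ, |f σ| ≤ M) →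
      ∫ σ, f σ ∂μ = ∫ ω, localDensity β h Λ f ω ∂μ

def cylEvents {d : ℕ} (Δ : Set (Site d)) : MeasurableSpace (Config d) :=
  MeasurableSpace.comap (fun σ (i : Δ) => σ i.val) inferInstance

noncomputable def dist1 {d : ℕ} (a b : Site d) : ℝ := ((∑ k, |a k - b k| : ℤ) : ℝ)

def WeakMixing (d : ℕ) (μ : Measure (Config d)) : Prop :=
  ∃ C : ℝ, 0 ≤ C ∧ ∃ c : ℝ, 0 < c ∧
    ∀ (Δ Δ' : Set (Site d)) (A B : Set (Config d)),
      MeasurableSet[cylEvents Δ] A → MeasurableSet[cylEvents Δ'] B → 0 < μ B →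
      ENNReal.ofReal |(μ (A ∩ B) / μ B).toReal - (μ A).toReal| ≤
        ENNReal.ofReal C *
          ∑' (i : Δ) (j : Δ'), ENNReal.ofReal (Real.exp (-c * dist1 i.val j.val))

end IsingP

namespace IsingP

noncomputable def torusEnergy (d N : ℕ) [NeZero (2 * N)] (β h : ℝ)
    (σ : (Fin d → ZMod (2 * N)) → Bool) : ℝ :=
  β * ∑ i : Fin d → ZMod (2 * N), ∑ k : Fin d,
      spin (σ i) * spin (σ (fun l => i l + if l = k then 1 else 0))
    + h * ∑ i : Fin d → ZMod (2 * N), spin (σ i)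

noncomputable def torusZ (d : ℕ) (β h : ℝ) (N : ℕ) : ℝ :=
  if hN : 0 < N then
    haveI : NeZero (2 * N) := ⟨by omega⟩
    ∑ σ : (Fin d → ZMod (2 * N)) → Bool, Real.exp (torusEnergy d N β h σ)
  else 0

end IsingP

section
namespace IsingA

section ProdSum
variable {I Θ R : Type*} [Fintype I] [DecidableEq I] [Fintype Θ]

/-- Expectation with respect to a (possibly complex) product weight. -/
def Ex [CommRing R] (w : I → Θ → R) (F : (I → Θ) → R) : R :=
  ∑ U, (∏ i, w i (U i)) * F U

theorem Ex_one [CommRing R] (w : I → Θ → R) (hw : ∀ i, ∑ θ, w i θ = 1) :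
    Ex w (fun _ => 1) = 1 := by
  unfold Ex
  simp only [mul_one]
  have := Finset.prod_univ_sum (fun _ : I => (Finset.univ : Finset Θ)) (fun i θ => w i θ)
  rw [Fintype.piFinset_univ] at this
  rw [← this]
  simp [hw]

/-- swapping two configurations off `P` -/
def swapEquiv (P : Finset I) : ((I → Θ) × (I → Θ)) ≃ ((I → Θ) × (I → Θ)) where
  toFun x := (P.piecewise x.1 x.2, P.piecewise x.2 x.1)
  invFun x := (P.piecewise x.1 x.2, P.piecewise x.2 x.1)
  left_inv x := by
    ext i <;> by_cases h : i ∈ P <;> simp [Finset.piecewise, h]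
  right_inv x := by
    ext i <;> by_cases h : i ∈ P <;> simp [Finset.piecewise, h]

theorem Ex_mul [CommRing R] (w : I → Θ → R) (hw : ∀ i, ∑ θ, w i θ = 1) (P : Finset I)
    (F G : (I → Θ) → R) (hF : DependsOn F (P : Set I)) (hG : DependsOn G ((P : Set I)ᶜ)) :
    Ex w (fun U => F U * G U) = Ex w F * Ex w G := by
  have h1 : Ex w (fun U => F U * G U) = Ex w (fun U => F U * G U) * Ex w (fun _ => 1) := by
    rw [Ex_one w hw, mul_one]
  rw [h1]
  unfold Ex
  rw [Finset.sum_mul_sum, Finset.sum_mul_sum, ← Finset.sum_product', ← Finset.sum_product']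
  simp only [Finset.univ_product_univ]
  symm
  refine Fintype.sum_equiv (swapEquiv P) _ _ ?_
  rintro ⟨U, V⟩
  have hF' : F (P.piecewise U V) = F U := hF (fun i hi => by
    simp [Finset.piecewise, Finset.mem_coe.mp hi])
  have hG' : G (P.piecewise U V) = G V := hG (fun i hi => by
    have : i ∉ P := fun h => hi (Finset.mem_coe.mpr h)
    simp [Finset.piecewise, this])
  simp only [swapEquiv, Equiv.coe_fn_mk, hF', hG']
  have : (∏ i, w i (U i)) * ∏ i, w i (V i) =
      (∏ i, w i (P.piecewise U V i)) * ∏ i, w i (P.piecewise V U i) := by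
    rw [← Finset.prod_mul_distrib, ← Finset.prod_mul_distrib]
    refine Finset.prod_congr rfl fun i _ => ?_
    by_cases h : i ∈ P <;> simp [Finset.piecewise, h, mul_comm]
  calc _ = ((∏ i, w i (U i)) * ∏ i, w i (V i)) * (F U * G V) := by ring
    _ = _ := by rw [this]; ring

theorem Ex_congr_weights [CommRing R] (w w' : I → Θ → R) (hw : ∀ i, ∑ θ, w i θ = 1)
    (hw' : ∀ i, ∑ θ, w' i θ = 1) (P : Finset I) (hP : ∀ i ∈ P, w i = w' i)
    (F : (I → Θ) → R) (hF : DependsOn F (P : Set I)) :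
    Ex w F = Ex w' F := by
  have h1 : Ex w F = Ex w F * Ex w' (fun _ => 1) := by rw [Ex_one w' hw', mul_one]
  have h2 : Ex w' F = Ex w' F * Ex w (fun _ => 1) := by rw [Ex_one w hw, mul_one]
  rw [h1, h2]
  unfold Ex
  rw [Finset.sum_mul_sum, Finset.sum_mul_sum, ← Finset.sum_product', ← Finset.sum_product']
  simp only [Finset.univ_product_univ]
  refine Fintype.sum_equiv (swapEquiv P) _ _ ?_
  rintro ⟨U, V⟩
  have hF' : F (P.piecewise U V) = F U := hF (fun i hi => by
    simp [Finset.piecewise, Finset.mem_coe.mp hi])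
  simp only [swapEquiv, Equiv.coe_fn_mk, hF']
  have : (∏ i, w i (U i)) * ∏ i, w' i (V i) =
      (∏ i, w' i (P.piecewise U V i)) * ∏ i, w i (P.piecewise V U i) := by
    rw [← Finset.prod_mul_distrib, ← Finset.prod_mul_distrib]
    refine Finset.prod_congr rfl fun i _ => ?_
    by_cases h : i ∈ P
    · simp [Finset.piecewise, h, hP i h]
    · simp [Finset.piecewise, h, mul_comm]
  calc _ = ((∏ i, w i (U i)) * ∏ i, w' i (V i)) * (F U) := by ring
    _ = _ := by rw [this]; ring

theorem Ex_mono (w : I → Θ → ℝ) (hw : ∀ i θ, 0 ≤ w i θ) (F G : (I → Θ) → ℝ)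
    (h : ∀ U, F U ≤ G U) : Ex w F ≤ Ex w G :=
  Finset.sum_le_sum fun U _ =>
    mul_le_mul_of_nonneg_left (h U) (Finset.prod_nonneg fun i _ => hw i _)

theorem Ex_nonneg (w : I → Θ → ℝ) (hw : ∀ i θ, 0 ≤ w i θ) (F : (I → Θ) → ℝ)
    (h : ∀ U, 0 ≤ F U) : 0 ≤ Ex w F :=
  Finset.sum_nonneg fun U _ =>
    mul_nonneg (Finset.prod_nonneg fun i _ => hw i _) (h U)

theorem Ex_sum [CommRing R] {K : Type*} (w : I → Θ → R) (S : Finset K)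
    (F : K → (I → Θ) → R) : Ex w (fun U => ∑ k ∈ S, F k U) = ∑ k ∈ S, Ex w (F k) := by
  unfold Ex
  simp_rw [Finset.mul_sum]
  rw [Finset.sum_comm]

theorem Ex_const_mul [CommRing R] (w : I → Θ → R) (c : R)
    (F : (I → Θ) → R) : Ex w (fun U => c * F U) = c * Ex w F := by
  unfold Ex
  rw [Finset.mul_sum]
  exact Finset.sum_congr rfl fun _ _ => by ring

theorem norm_Ex_le (w : I → Θ → ℂ) (F : (I → Θ) → ℂ) :
    ‖Ex w F‖ ≤ Ex (fun i θ => ‖w i θ‖) (fun U => ‖F U‖) := by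
  unfold Ex
  refine (norm_sum_le _ _).trans (Finset.sum_le_sum fun U _ => ?_)
  rw [norm_mul, norm_prod]

theorem Ex_scale (w : I → Θ → ℝ) (s : I → ℝ) (F : (I → Θ) → ℝ) :
    Ex (fun i θ => s i * w i θ) F = (∏ i, s i) * Ex w F := by
  unfold Ex
  rw [Finset.mul_sum]
  refine Finset.sum_congr rfl fun U _ => ?_
  rw [Finset.prod_mul_distrib]; ring

/-- independence over a family of disjointly supported functions -/
theorem Ex_prod [CommRing R] {K : Type*} (w : I → Θ → R) (hw : ∀ i, ∑ θ, w i θ = 1)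
    (S : Finset K) (P : K → Finset I) (hP : ∀ a ∈ S, ∀ b ∈ S, a ≠ b → Disjoint (P a) (P b))
    (F : K → (I → Θ) → R) (hF : ∀ a ∈ S, DependsOn (F a) (P a : Set I)) :
    Ex w (fun U => ∏ a ∈ S, F a U) = ∏ a ∈ S, Ex w (F a) := by
  classical
  induction S using Finset.induction_on with
  | empty => simpa using Ex_one w hw
  | insert a S ha ih =>
    simp only [Finset.prod_insert ha]
    rw [Ex_mul w hw (P a), ih]
    · intro x hx y hy hxy
      exact hP x (Finset.mem_insert_of_mem hx) y (Finset.mem_insert_of_mem hy) hxy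
    · intro x hx
      exact hF x (Finset.mem_insert_of_mem hx)
    · exact hF a (Finset.mem_insert_self _ _)
    · intro U V hUV
      refine Finset.prod_congr rfl fun b hb => ?_
      refine hF b (Finset.mem_insert_of_mem hb) fun i hi => hUV i ?_
      have hd := hP a (Finset.mem_insert_self _ _) b (Finset.mem_insert_of_mem hb)
        (fun h => ha (h ▸ hb))
      intro hia
      exact (Finset.disjoint_left.mp hd) (Finset.mem_coe.mp hia) (Finset.mem_coe.mp hi)

theorem Ex_single_swap (v : I → Θ → ℝ) (hv0 : ∀ i θ, 0 ≤ v i θ) (hv : ∀ i, ∑ θ, v i θ = 1)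
    (i : I) (u : Θ → ℝ) (F : (I → Θ) → ℝ) (hF : ∀ U, |F U| ≤ 1) :
    |Ex v F - Ex (Function.update v i u) F| ≤ ∑ θ, |v i θ - u θ| := by
  have key : ∀ (a : Θ → ℝ) (U : I → Θ), ∏ j, (Function.update v i a) j (U j) =
      a (U i) * ∏ j ∈ Finset.univ.erase i, v j (U j) := by
    intro a U
    rw [← Finset.mul_prod_erase Finset.univ _ (Finset.mem_univ i)]
    congr 1
    · simp
    · refine Finset.prod_congr rfl fun j hj => ?_
      rw [Function.update_of_ne (Finset.ne_of_mem_erase hj)]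
  have hvv : Function.update v i (v i) = v := Function.update_eq_self i v
  have e1 : Ex v F - Ex (Function.update v i u) F =
      ∑ U, ((v i (U i) - u (U i)) * ∏ j ∈ Finset.univ.erase i, v j (U j)) * F U := by
    nth_rewrite 1 [← hvv]
    unfold Ex
    rw [← Finset.sum_sub_distrib]
    refine Finset.sum_congr rfl fun U _ => ?_
    rw [key, key]; ring
  have e2 : ∑ θ, |v i θ - u θ| =
      ∑ U : I → Θ, (|v i (U i) - u (U i)| * ∏ j ∈ Finset.univ.erase i, v j (U j)) := by
    have h := Finset.prod_univ_sum (fun _ : I => (Finset.univ : Finset Θ))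
      (fun j θ => (Function.update v i (fun θ => |v i θ - u θ|)) j θ)
    rw [Fintype.piFinset_univ] at h
    simp_rw [key] at h
    rw [← h, ← Finset.mul_prod_erase Finset.univ _ (Finset.mem_univ i)]
    rw [Finset.prod_eq_one, mul_one]
    · simp
    · intro j hj
      rw [Function.update_of_ne (Finset.ne_of_mem_erase hj)]
      exact hv j
  rw [e1, e2]
  refine (Finset.abs_sum_le_sum_abs _ _).trans (Finset.sum_le_sum fun U _ => ?_)
  have hp : 0 ≤ ∏ j ∈ Finset.univ.erase i, v j (U j) := Finset.prod_nonneg fun j _ => hv0 _ _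
  rw [abs_mul, abs_mul, abs_of_nonneg hp]
  exact mul_le_of_le_one_right (mul_nonneg (abs_nonneg _) hp) (hF U)

theorem Ex_tele (v u : I → Θ → ℝ) (hv0 : ∀ i θ, 0 ≤ v i θ) (hv : ∀ i, ∑ θ, v i θ = 1)
    (hu0 : ∀ i θ, 0 ≤ u i θ) (hu : ∀ i, ∑ θ, u i θ = 1)
    (P : Finset I) (F : (I → Θ) → ℝ) (hF : ∀ U, |F U| ≤ 1) (hd : DependsOn F (P : Set I)) :
    |Ex v F - Ex u F| ≤ ∑ i ∈ P, ∑ θ, |v i θ - u i θ| := by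
  have h1 : ∀ S : Finset I, |Ex v F - Ex (S.piecewise u v) F| ≤
      ∑ i ∈ S, ∑ θ, |v i θ - u i θ| := by
    intro S
    induction S using Finset.induction_on with
    | empty => simp
    | insert a S ha ih =>
      rw [Finset.sum_insert ha]
      have h2 := Ex_single_swap (S.piecewise u v)
        (fun i θ => by by_cases h : i ∈ S <;> simp [Finset.piecewise, h, hv0, hu0])
        (fun i => by by_cases h : i ∈ S <;> simp [Finset.piecewise, h, hv, hu]) a (u a) F hF
      have h3 : Function.update (S.piecewise u v) a (u a) = (insert a S).piecewise u v := by
        rw [Finset.piecewise_insert]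
      rw [h3] at h2
      have h4 : (S.piecewise u v) a = v a := by simp [Finset.piecewise, ha]
      rw [h4] at h2
      have := abs_sub_le (Ex v F) (Ex (S.piecewise u v) F) (Ex ((insert a S).piecewise u v) F)
      linarith
  have h2 := h1 P
  rwa [Ex_congr_weights (P.piecewise u v) u
    (fun i => by by_cases h : i ∈ P <;> simp [Finset.piecewise, h, hv, hu]) hu P
    (fun i hi => by simp [Finset.piecewise, hi]) F hd] at h2

end ProdSum
end IsingA
end

section
namespace IsingA

section Machine
set_option linter.unusedSectionVars false

/-- greedy selection of a conflict-free subset -/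
theorem greedy {Q : Type*} [DecidableEq Q] [Fintype Q] (r : Q → Q → Prop) [DecidableRel r]
    (hs : ∀ a b, r a b → r b a) (m : ℕ)
    (hm : ∀ b, (Finset.univ.filter (fun b' => r b b')).card ≤ m) (hr : ∀ a, r a a)
    (S : Finset Q) :
    ∃ S' ⊆ S, (∀ a ∈ S', ∀ b ∈ S', a ≠ b → ¬ r a b) ∧ S.card ≤ m * S'.card := by
  induction S using Finset.strongInduction with
  | H S ih =>
    rcases S.eq_empty_or_nonempty with rfl | ⟨b, hb⟩
    · exact ⟨∅, by simp, by simp, by simp⟩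
    · obtain ⟨S', hS', h1, h2⟩ := ih (S.filter (fun b' => ¬ r b b')) (by
        rw [Finset.filter_ssubset]
        exact ⟨b, hb, by simpa using hr b⟩)
      have hbS' : b ∉ S' := fun h => by
        have := hS' h
        simp at this
        exact this.2 (hr b)
      refine ⟨insert b S', ?_, ?_, ?_⟩
      · intro x hx
        rcases Finset.mem_insert.mp hx with rfl | hx
        · exact hb
        · exact (Finset.mem_filter.mp (hS' hx)).1
      · intro x hx y hy hxy
        rcases Finset.mem_insert.mp hx with rfl | hx
        · rcases Finset.mem_insert.mp hy with h | hy
          · exact absurd h.symm hxy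
          · exact (Finset.mem_filter.mp (hS' hy)).2
        · have hx2 := ‹x ∈ S'›
          rcases Finset.mem_insert.mp hy with hyb | hy
          · subst hyb
            exact fun h => (Finset.mem_filter.mp (hS' hx2)).2 (hs _ _ h)
          · exact h1 x hx2 y hy hxy
      · rw [Finset.card_insert_of_notMem hbS']
        have h3 : (S.filter (fun b' => r b b')).card ≤ m :=
          (Finset.card_le_card (Finset.filter_subset_filter _ (Finset.subset_univ S))).trans (hm b)
        have h4 := Finset.card_filter_add_card_filter_not (s := S) (fun b' => r b b')
        rw [mul_add, mul_one]
        omega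

variable {V Q I Θ : Type*} [Fintype V] [Fintype Q] [DecidableEq Q] [Fintype I] [DecidableEq I]
  [Fintype Θ] [DecidableEq V]

/-- `f` has a decomposition into local functions with weighted norm at most `R` -/
def Dec (cell : V → Q) (f : (V → Bool) → ℂ) (R : ℝ) : Prop :=
  ∃ (g : Finset Q → (V → Bool) → ℂ) (c : Finset Q → ℝ),
    (∀ A, DependsOn (g A) {v | cell v ∈ A}) ∧ (∀ A η, ‖g A η‖ ≤ c A) ∧
    (∀ η, f η = ∑ A, g A η) ∧ ∑ A, c A * 2 ^ A.card ≤ R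

theorem Dec_single (cell : V → Q) (f : (V → Bool) → ℂ) (A : Finset Q) (c : ℝ) (hc : 0 ≤ c)
    (hf : DependsOn f {v | cell v ∈ A}) (hb : ∀ η, ‖f η‖ ≤ c) : Dec cell f (c * 2 ^ A.card) := by
  refine ⟨fun B η => if B = A then f η else 0, fun B => if B = A then c else 0, ?_, ?_, ?_, ?_⟩
  · intro B
    by_cases h : B = A
    · subst h; simpa using hf
    · intro x y _; simp [h]
  · intro B η
    by_cases h : B = A <;> simp [h, hb]
  · intro η; simp
  · simp

theorem Dec_mono (cell : V → Q) (f : (V → Bool) → ℂ) {R R' : ℝ} (h : R ≤ R') (hf : Dec cell f R) :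
    Dec cell f R' := by
  obtain ⟨g, c, h1, h2, h3, h4⟩ := hf
  exact ⟨g, c, h1, h2, h3, h4.trans h⟩

theorem Dec_sum {K : Type*} (cell : V → Q) (S : Finset K) (f : K → (V → Bool) → ℂ) (R : K → ℝ)
    (hf : ∀ k ∈ S, Dec cell (f k) (R k)) : Dec cell (fun η => ∑ k ∈ S, f k η) (∑ k ∈ S, R k) := by
  classical
  induction S using Finset.induction_on with
  | empty =>
    refine ⟨fun _ _ => 0, fun _ => 0, ?_, ?_, ?_, ?_⟩
    · intro A x y _; rfl
    · simp
    · simp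
    · simp
  | insert a S ha ih =>
    obtain ⟨g, c, h1, h2, h3, h4⟩ := ih (fun k hk => hf k (Finset.mem_insert_of_mem hk))
    obtain ⟨g', c', h1', h2', h3', h4'⟩ := hf a (Finset.mem_insert_self _ _)
    refine ⟨fun A η => g' A η + g A η, fun A => c' A + c A, ?_, ?_, ?_, ?_⟩
    · intro A x y hxy
      simp only [h1 A hxy, h1' A hxy]
    · intro A η
      exact (norm_add_le _ _).trans (add_le_add (h2' A η) (h2 A η))
    · intro η
      have h3η : ∑ k ∈ S, f k η = ∑ A, g A η := h3 η
      show ∑ k ∈ insert a S, f k η = ∑ A, (g' A η + g A η)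
      rw [Finset.sum_insert ha, h3η, h3' η, Finset.sum_add_distrib]
    · rw [Finset.sum_insert ha]
      simp only [add_mul, Finset.sum_add_distrib]
      exact add_le_add h4' h4

theorem Dec_bound (cell : V → Q) (f : (V → Bool) → ℂ) {R : ℝ} (hf : Dec cell f R) (η : V → Bool) :
    ‖f η‖ ≤ R := by
  obtain ⟨g, c, h1, h2, h3, h4⟩ := hf
  rw [h3]
  refine (norm_sum_le _ _).trans (le_trans (Finset.sum_le_sum fun A _ => ?_) h4)
  have h5 : 0 ≤ c A := (norm_nonneg _).trans (h2 A η)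
  exact (h2 A η).trans (le_mul_of_one_le_right h5 (one_le_pow₀ (by norm_num)))

/-- the data of a local monotone random map -/
structure LocalMap (V Q I Θ : Type*) [Fintype V] [Fintype Q] [DecidableEq Q] [Fintype I] where
  cell : V → Q
  pc : I → Q
  Φ : (I → Θ) → (V → Bool) → (V → Bool)
  N : Q → Finset Q
  mono : ∀ U, Monotone (Φ U)
  self : ∀ b, b ∈ N b
  loc : ∀ b U U' η η', (∀ p, pc p ∈ N b → U p = U' p) → (∀ v, cell v ∈ N b → η v = η' v) →
    ∀ v, cell v = b → Φ U η v = Φ U' η' v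
  m : ℕ
  m' : ℕ
  κ : ℕ
  hm : ∀ b, (N b).card ≤ m
  hm' : ∀ b, (Finset.univ.filter (fun b' => ¬ Disjoint (N b) (N b'))).card ≤ m'
  hκ : ∀ b, (Finset.univ.filter (fun p => pc p ∈ N b)).card ≤ κ

namespace LocalMap

variable (X : LocalMap V Q I Θ)

/-- the cell `b` is not determined -/
def Dev (U : I → Θ) (b : Q) : Prop :=
  ∃ v, X.cell v = b ∧ X.Φ U (fun _ => true) v ≠ X.Φ U (fun _ => false) v

open Classical in
/-- indicator of `Dev` -/
noncomputable def dev (b : Q) (U : I → Θ) : ℝ := if X.Dev U b then 1 else 0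

/-- the transfer operator -/
def K (ν : Θ → ℂ) (f : (V → Bool) → ℂ) (η : V → Bool) : ℂ :=
  Ex (fun _ : I => ν) (fun U => f (X.Φ U η))

/-- positions relevant to `b` -/
def P (b : Q) : Finset I := Finset.univ.filter (fun p => X.pc p ∈ X.N b)

theorem Dev_congr (b : Q) (U U' : I → Θ) (h : ∀ p ∈ X.P b, U p = U' p) :
    X.Dev U b ↔ X.Dev U' b := by
  have h' : ∀ η v, X.cell v = b → X.Φ U η v = X.Φ U' η v := fun η v hv =>
    X.loc b U U' η η (fun p hp => h p (by simp [P, hp])) (fun _ _ => rfl) v hv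
  unfold Dev
  constructor
  · rintro ⟨v, hv, hne⟩
    exact ⟨v, hv, by rwa [← h' _ v hv, ← h' _ v hv]⟩
  · rintro ⟨v, hv, hne⟩
    exact ⟨v, hv, by rwa [h' _ v hv, h' _ v hv]⟩

theorem dev_dep (b : Q) : DependsOn (X.dev b) (X.P b : Set I) := by
  intro U U' h
  classical
  unfold dev
  exact if_congr (X.Dev_congr b U U' (fun p hp => h p hp)) rfl rfl

theorem not_Dev (b : Q) (U : I → Θ) (h : ¬ X.Dev U b) (η η' : V → Bool) (v : V)
    (hv : X.cell v = b) : X.Φ U η v = X.Φ U η' v := by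
  have h1 : X.Φ U (fun _ => true) v = X.Φ U (fun _ => false) v := by
    by_contra h2
    exact h ⟨v, hv, h2⟩
  have h3 : ∀ ζ, X.Φ U ζ v = X.Φ U (fun _ => true) v := fun ζ =>
    le_antisymm (X.mono U (fun i => Bool.le_true _) v)
      (h1 ▸ X.mono U (fun i => Bool.false_le _) v)
  rw [h3 η, h3 η']

/-- union of neighbourhoods -/
def NS (S : Finset Q) : Finset Q := S.biUnion X.N

open Classical in
/-- bad cells in `A` -/
noncomputable def badIn (A : Finset Q) (U : I → Θ) : Finset Q := A.filter (fun b => X.Dev U b)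

theorem mem_badIn (A : Finset Q) (U : I → Θ) (b : Q) : b ∈ X.badIn A U ↔ b ∈ A ∧ X.Dev U b := by
  classical
  unfold badIn
  rw [Finset.mem_filter]

/-- the piece of `K f` with undetermined set `S` -/
noncomputable def G (ν : Θ → ℂ) (f : (V → Bool) → ℂ) (A S : Finset Q) (η : V → Bool) : ℂ :=
  Ex (fun _ : I => ν) (fun U => if X.badIn A U = S then f (X.Φ U η) else 0)

theorem K_eq_sum (ν : Θ → ℂ) (f : (V → Bool) → ℂ) (A : Finset Q) (η : V → Bool) :
    X.K ν f η = ∑ S ∈ A.powerset, X.G ν f A S η := by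
  unfold K G
  rw [← Ex_sum]
  congr 1
  ext U
  rw [Finset.sum_ite_eq, if_pos]
  exact Finset.mem_powerset.mpr (fun b hb => ((X.mem_badIn A U b).mp hb).1)

theorem G_dep (ν : Θ → ℂ) (f : (V → Bool) → ℂ) (A S : Finset Q)
    (hf : DependsOn f {v | X.cell v ∈ A}) :
    DependsOn (X.G ν f A S) {v | X.cell v ∈ X.NS S} := by
  intro η η' h
  unfold G
  congr 1
  ext U
  split_ifs with hU
  · refine hf fun v hv => ?_
    by_cases hd : X.Dev U (X.cell v)
    · have hS : X.cell v ∈ S := by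
        rw [← hU]; exact (X.mem_badIn A U _).mpr ⟨hv, hd⟩
      refine X.loc (X.cell v) U U η η' (fun _ _ => rfl) (fun w hw => h w ?_) v rfl
      exact Finset.mem_biUnion.mpr ⟨_, hS, hw⟩
    · exact X.not_Dev _ U hd _ _ v rfl
  · rfl

theorem G_bound [Inhabited Θ] (ν : Θ → ℂ) (ν0 : Θ → ℝ) (e ε q : ℝ) (hν : ∑ θ, ν θ = 1)
    (hν0 : ∀ θ, 0 ≤ ν0 θ) (hν1 : ∑ θ, ν0 θ = 1) (he : ∑ θ, ‖ν θ - (ν0 θ : ℂ)‖ ≤ e)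
    (hD : ∀ b, Ex (fun _ : I => ν0) (X.dev b) ≤ ε) (hq0 : 0 ≤ q) (hq1 : q ≤ 1)
    (hεq : ε + 2 * e * X.κ ≤ q ^ X.m')
    (f : (V → Bool) → ℂ) (c : ℝ) (hc : 0 ≤ c) (hfc : ∀ η, ‖f η‖ ≤ c) (A S : Finset Q)
    (hSA : S ⊆ A) (hf : DependsOn f {v | X.cell v ∈ A}) (η : V → Bool) :
    ‖X.G ν f A S η‖ ≤ c * ((1 + e) ^ X.κ) ^ A.card * q ^ S.card := by
  classical
  have he0 : 0 ≤ e := (Finset.sum_nonneg fun _ _ => norm_nonneg _).trans he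
  -- relevant positions
  set PA : Finset I := A.biUnion X.P with hPA
  set pt : Θ → ℂ := fun θ => if θ = default then 1 else 0 with hpt
  have hptsum : ∑ θ, pt θ = 1 := by simp [hpt]
  set ν' : I → Θ → ℂ := fun i => if i ∈ PA then ν else pt with hν'
  have hdep : DependsOn (fun U => if X.badIn A U = S then f (X.Φ U η) else 0) (PA : Set I) := by
    intro U U' h
    have hb : X.badIn A U = X.badIn A U' := by
      ext b
      rw [X.mem_badIn, X.mem_badIn]
      refine and_congr_right fun hb => X.Dev_congr b U U' fun p hp => h p ?_
      exact Finset.mem_coe.mpr (Finset.mem_biUnion.mpr ⟨b, hb, hp⟩)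
    have hfe : f (X.Φ U η) = f (X.Φ U' η) := hf fun v hv =>
      X.loc (X.cell v) U U' η η (fun p hp => h p (Finset.mem_coe.mpr (Finset.mem_biUnion.mpr
        ⟨X.cell v, hv, by simp [P, hp]⟩))) (fun _ _ => rfl) v rfl
    simp only [hb, hfe]
  have h1 : X.G ν f A S η = Ex ν' (fun U => if X.badIn A U = S then f (X.Φ U η) else 0) := by
    unfold G
    refine Ex_congr_weights _ _ (fun _ => hν) (fun i => ?_) PA (fun i hi => ?_) _ hdep
    · by_cases hi : i ∈ PA
      · simp [hν', hi, hν]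
      · simp only [hν', hi, if_false, hptsum]
    · simp [hν', hi]
  -- normalised weights
  set s : ℝ := ∑ θ, ‖ν θ‖ with hs
  have hs1 : 1 ≤ s := by
    have : ‖∑ θ, ν θ‖ ≤ s := norm_sum_le _ _
    rwa [hν, norm_one] at this
  have hdiff : ∑ θ, |‖ν θ‖ - ν0 θ| ≤ e := by
    refine le_trans (Finset.sum_le_sum fun θ _ => ?_) he
    have h2 := abs_norm_sub_norm_le (ν θ) (ν0 θ : ℂ)
    rwa [Complex.norm_real, Real.norm_of_nonneg (hν0 θ)] at h2
  have hse : s ≤ 1 + e := by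
    have h2 : s - 1 = ∑ θ, (‖ν θ‖ - ν0 θ) := by rw [Finset.sum_sub_distrib, hν1]
    have h3 : ∑ θ, (‖ν θ‖ - ν0 θ) ≤ ∑ θ, |‖ν θ‖ - ν0 θ| :=
      Finset.sum_le_sum fun _ _ => le_abs_self _
    linarith
  have hs0 : 0 < s := by linarith
  set a : Θ → ℝ := fun θ => ‖ν θ‖ / s with ha
  have ha0 : ∀ θ, 0 ≤ a θ := fun θ => by positivity
  have ha1 : ∑ θ, a θ = 1 := by
    simp only [ha]; rw [← Finset.sum_div, ← hs, div_self hs0.ne']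
  have had : ∑ θ, |a θ - ν0 θ| ≤ 2 * e := by
    have h2 : ∀ θ, |a θ - ν0 θ| ≤ (‖ν θ‖ - a θ) + |‖ν θ‖ - ν0 θ| := by
      intro θ
      have h3 : a θ ≤ ‖ν θ‖ := div_le_self (norm_nonneg _) hs1
      have h4 := abs_sub_le (a θ) ‖ν θ‖ (ν0 θ)
      have h4' : |a θ - ‖ν θ‖| = ‖ν θ‖ - a θ := by
        rw [abs_sub_comm, abs_of_nonneg (sub_nonneg.mpr h3)]
      rw [h4'] at h4
      exact h4
    have h5 := Finset.sum_le_sum (s := Finset.univ) (fun θ _ => h2 θ)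
    rw [Finset.sum_add_distrib, Finset.sum_sub_distrib, ha1, ← hs] at h5
    linarith
  set ptR : Θ → ℝ := fun θ => if θ = default then 1 else 0 with hptR
  set a' : I → Θ → ℝ := fun i => if i ∈ PA then a else ptR with ha'
  have ha'0 : ∀ i θ, 0 ≤ a' i θ := by
    intro i θ
    simp only [ha']
    split_ifs
    · exact ha0 θ
    · simp only [hptR]; split_ifs <;> norm_num
  have ha'1 : ∀ i, ∑ θ, a' i θ = 1 := by
    intro i
    simp only [ha']
    split_ifs
    · exact ha1
    · simp [hptR]
  have h2 : ‖X.G ν f A S η‖ ≤ (∏ i, (if i ∈ PA then s else 1)) *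
      Ex a' (fun U => ‖(if X.badIn A U = S then f (X.Φ U η) else 0)‖) := by
    rw [h1]
    refine (norm_Ex_le _ _).trans (le_of_eq ?_)
    rw [← Ex_scale]
    congr 1
    ext i θ
    simp only [hν', ha', ha, hpt, hptR]
    by_cases hi : i ∈ PA
    · simp only [hi, if_true]
      field_simp
    · simp only [hi, if_false, one_mul]
      split_ifs <;> simp
  obtain ⟨S', hS', hind, hcard⟩ := greedy (fun b b' => ¬ Disjoint (X.N b) (X.N b'))
    (fun a b h => by rwa [disjoint_comm]) X.m' X.hm'
    (fun b h => by
      have := Finset.disjoint_left.mp h (X.self b)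
      exact this (X.self b)) S
  have h3 : Ex a' (fun U => ‖(if X.badIn A U = S then f (X.Φ U η) else 0)‖) ≤
      c * Ex a' (fun U => ∏ b ∈ S', X.dev b U) := by
    rw [← Ex_const_mul]
    refine Ex_mono a' ha'0 _ _ fun U => ?_
    have hpn : 0 ≤ ∏ b ∈ S', X.dev b U := Finset.prod_nonneg fun b _ => by
      unfold dev; split_ifs <;> norm_num
    split_ifs with hU
    · have : ∏ b ∈ S', X.dev b U = 1 := Finset.prod_eq_one fun b hb => by
        have h4 : b ∈ X.badIn A U := hU ▸ hS' hb
        have h5 := ((X.mem_badIn A U b).mp h4).2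
        simp [dev, h5]
      rw [this, mul_one]; exact hfc _
    · rw [norm_zero]; positivity
  have h4 : Ex a' (fun U => ∏ b ∈ S', X.dev b U) = ∏ b ∈ S', Ex a' (X.dev b) := by
    refine Ex_prod a' ha'1 S' X.P ?_ _ (fun b _ => X.dev_dep b)
    intro b hb b' hb' hne
    have h5 := hind b hb b' hb' hne
    rw [not_not] at h5
    rw [Finset.disjoint_left]
    intro p hp hp'
    simp only [P, Finset.mem_filter, Finset.mem_univ, true_and] at hp hp'
    exact Finset.disjoint_left.mp h5 hp hp'
  have h5 : ∀ b ∈ S', Ex a' (X.dev b) ≤ q ^ X.m' := by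
    intro b hb
    refine le_trans ?_ hεq
    have h6 : Ex a' (X.dev b) = Ex (fun _ => a) (X.dev b) := by
      refine Ex_congr_weights _ _ ha'1 (fun _ => ha1) (X.P b) (fun i hi => ?_) _ (X.dev_dep b)
      have : i ∈ PA := Finset.mem_biUnion.mpr ⟨b, hSA (hS' hb), hi⟩
      simp [ha', this]
    have h7 := Ex_tele (fun _ : I => a) (fun _ => ν0) (fun _ => ha0) (fun _ => ha1)
      (fun _ => hν0) (fun _ => hν1) (X.P b) (X.dev b)
      (fun U => by unfold dev; split_ifs <;> simp) (X.dev_dep b)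
    have h8 : ∑ i ∈ X.P b, ∑ θ, |a θ - ν0 θ| ≤ 2 * e * X.κ := by
      rw [Finset.sum_const, nsmul_eq_mul]
      have h9 : ((X.P b).card : ℝ) ≤ X.κ := by exact_mod_cast X.hκ b
      have h10 : 0 ≤ ∑ θ, |a θ - ν0 θ| := Finset.sum_nonneg fun _ _ => abs_nonneg _
      calc _ ≤ (X.κ : ℝ) * (2 * e) := by gcongr
        _ = _ := by ring
    have h11 := (abs_le.mp h7).2
    have h12 := hD b
    rw [h6]
    linarith
  have h6 : ∏ b ∈ S', Ex a' (X.dev b) ≤ q ^ S.card := by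
    calc ∏ b ∈ S', Ex a' (X.dev b) ≤ ∏ b ∈ S', q ^ X.m' :=
          Finset.prod_le_prod (fun b _ => Ex_nonneg a' ha'0 _ fun U => by
            unfold dev; split_ifs <;> norm_num) h5
      _ = q ^ (X.m' * S'.card) := by rw [Finset.prod_const, ← pow_mul]
      _ ≤ q ^ S.card := pow_le_pow_of_le_one hq0 hq1 hcard
  have h7 : (∏ i, (if i ∈ PA then s else 1)) ≤ ((1 + e) ^ X.κ) ^ A.card := by
    rw [Finset.prod_ite_mem, Finset.univ_inter, Finset.prod_const, ← pow_mul]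
    have h8 : PA.card ≤ X.κ * A.card := by
      rw [mul_comm]
      exact Finset.card_biUnion_le_card_mul _ _ _ fun b _ => X.hκ b
    calc s ^ PA.card ≤ (1 + e) ^ PA.card := by gcongr
      _ ≤ _ := pow_le_pow_right₀ (by linarith) h8
  have hprod0 : 0 ≤ ∏ i, (if i ∈ PA then s else 1) := Finset.prod_nonneg fun i _ => by
    split_ifs <;> linarith
  calc ‖X.G ν f A S η‖ ≤ _ := h2
    _ ≤ ((1 + e) ^ X.κ) ^ A.card * (c * q ^ S.card) := by
      refine mul_le_mul h7 (h3.trans ?_) ?_ (by positivity)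
      · rw [h4]; gcongr
      · exact Ex_nonneg a' ha'0 _ fun U => norm_nonneg _
    _ = _ := by ring

theorem K_Dec [Inhabited Θ] (ν : Θ → ℂ) (ν0 : Θ → ℝ) (e ε q : ℝ) (hν : ∑ θ, ν θ = 1)
    (hν0 : ∀ θ, 0 ≤ ν0 θ) (hν1 : ∑ θ, ν0 θ = 1) (he : ∑ θ, ‖ν θ - (ν0 θ : ℂ)‖ ≤ e)
    (hD : ∀ b, Ex (fun _ : I => ν0) (X.dev b) ≤ ε) (hq0 : 0 ≤ q) (hq1 : q ≤ 1)
    (hεq : ε + 2 * e * X.κ ≤ q ^ X.m') (hqm : q * 2 ^ X.m ≤ 1 / 2)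
    (heκ : (1 + e) ^ X.κ ≤ 4 / 3)
    (f : (V → Bool) → ℂ) (R : ℝ) (hf : Dec X.cell f R) : Dec X.cell (X.K ν f) R := by
  classical
  have he0 : 0 ≤ e := (Finset.sum_nonneg fun _ _ => norm_nonneg _).trans he
  obtain ⟨g, c, h1, h2, h3, h4⟩ := hf
  have hc : ∀ A, 0 ≤ c A := fun A => (norm_nonneg _).trans (h2 A (fun _ => true))
  have hK : X.K ν f = fun η => ∑ A, ∑ S ∈ A.powerset, X.G ν (g A) A S η := by
    ext η
    have : X.K ν f η = ∑ A, X.K ν (g A) η := by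
      unfold K
      simp_rw [h3]
      rw [Ex_sum]
    rw [this]
    exact Finset.sum_congr rfl fun A _ => X.K_eq_sum ν (g A) A η
  rw [hK]
  refine Dec_mono X.cell _ h4 (Dec_sum X.cell Finset.univ _ (fun A => c A * 2 ^ A.card) ?_)
  intro A _
  have hb : ∑ S ∈ A.powerset, (c A * ((1 + e) ^ X.κ) ^ A.card * q ^ S.card) * 2 ^ (X.NS S).card
      ≤ c A * 2 ^ A.card := by
    calc _ ≤ ∑ S ∈ A.powerset, (c A * (4 / 3) ^ A.card) * ((1 / 2) ^ S.card * 1 ^ (A.card - S.card)) := by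
          refine Finset.sum_le_sum fun S _ => ?_
          have h5 : (X.NS S).card ≤ X.m * S.card := by
            rw [mul_comm]
            exact Finset.card_biUnion_le_card_mul _ _ _ fun b _ => X.hm b
          have h6 : (2 : ℝ) ^ (X.NS S).card ≤ 2 ^ (X.m * S.card) :=
            pow_le_pow_right₀ (by norm_num) h5
          have h7 : q ^ S.card * 2 ^ (X.m * S.card) ≤ (1 / 2) ^ S.card := by
            rw [pow_mul, ← mul_pow]
            exact pow_le_pow_left₀ (by positivity) hqm _
          have h8 : ((1 + e) ^ X.κ) ^ A.card ≤ (4 / 3) ^ A.card :=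
            pow_le_pow_left₀ (by positivity) heκ _
          have h9 := hc A
          calc _ ≤ c A * (4 / 3) ^ A.card * (q ^ S.card * 2 ^ (X.m * S.card)) := by
                rw [mul_assoc (c A * _)]
                gcongr
            _ ≤ c A * (4 / 3) ^ A.card * ((1 / 2) ^ S.card) := by gcongr
            _ = _ := by simp
      _ = c A * 2 ^ A.card := by
          rw [← Finset.mul_sum, Finset.sum_pow_mul_eq_add_pow, mul_assoc, ← mul_pow]
          norm_num
  refine Dec_mono X.cell _ hb (Dec_sum X.cell A.powerset _ _ ?_)
  intro S hS
  have h9 := hc A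
  exact Dec_single X.cell _ (X.NS S) _ (by positivity) (X.G_dep ν (g A) A S (h1 A))
    (fun η => X.G_bound ν ν0 e ε q hν hν0 hν1 he hD hq0 hq1 hεq (g A) (c A) (hc A) (h2 A) A S
      (Finset.mem_powerset.mp hS) (h1 A) η)

end LocalMap
end Machine
end IsingA
end

section
namespace IsingA

section Dyn
set_option linter.unusedSectionVars false
variable {V κ R : Type*} [DecidableEq V] [Fintype κ] (nb : V → κ → V)

/-- number of plus neighbours -/
def cnt (σ : V → Bool) (x : V) : ℕ := (Finset.univ.filter (fun q => σ (nb x q) = true)).card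

theorem cnt_le (σ : V → Bool) (x : V) : cnt nb σ x ≤ Fintype.card κ :=
  (Finset.card_filter_le _ _).trans (le_of_eq Finset.card_univ)

theorem cnt_mono {σ τ : V → Bool} (h : σ ≤ τ) (x : V) : cnt nb σ x ≤ cnt nb τ x := by
  refine Finset.card_le_card fun q hq => ?_
  simp only [Finset.mem_filter, Finset.mem_univ, true_and] at hq ⊢
  have := h (nb x q)
  rw [hq] at this
  exact le_antisymm (Bool.le_true _) this

theorem cnt_congr {σ τ : V → Bool} (x : V) (h : ∀ q, σ (nb x q) = τ (nb x q)) :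
    cnt nb σ x = cnt nb τ x := by
  unfold cnt
  simp only [h]

theorem cnt_update (hnb : ∀ x q, nb x q ≠ x) (σ : V → Bool) (x : V) (b : Bool) :
    cnt nb (Function.update σ x b) x = cnt nb σ x :=
  cnt_congr nb x fun q => Function.update_of_ne (hnb x q) _ _

theorem update_le_update {σ τ : V → Bool} (h : σ ≤ τ) (x : V) {a b : Bool} (hab : a ≤ b) :
    Function.update σ x a ≤ Function.update τ x b := by
  intro v
  by_cases hv : v = x
  · subst hv; simpa using hab
  · simpa [Function.update_of_ne hv] using h v

/-- threshold update -/
def upd (x : V) (θ : ℕ) (η : V → Bool) : V → Bool :=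
  Function.update η x (decide (θ ≤ cnt nb η x))

theorem upd_mono (x : V) (θ : ℕ) : Monotone (upd nb x θ) := by
  intro σ τ h
  refine update_le_update h x ?_
  have := cnt_mono nb h x
  by_cases h1 : θ ≤ cnt nb σ x
  · simp [h1, h1.trans this]
  · simp [h1]

/-- cumulative weights -/
def cum [CommRing R] (D : ℕ) (p : ℕ → R) : ℕ → R
  | 0 => 0
  | (k + 1) => if k ≤ D then p k else 1

/-- threshold weights -/
def wt [CommRing R] (D : ℕ) (p : ℕ → R) (θ : Fin (D + 2)) : R := cum D p (θ + 1) - cum D p θ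

theorem sum_wt_le [CommRing R] (D : ℕ) (p : ℕ → R) (k : ℕ) (hk : k ≤ D + 1) :
    ∑ θ : Fin (D + 2), (if (θ : ℕ) ≤ k then wt D p θ else 0) = cum D p (k + 1) := by
  unfold wt
  rw [Fin.sum_univ_eq_sum_range (fun i => if i ≤ k then cum D p (i + 1) - cum D p i else 0),
    ← Finset.sum_filter]
  have : (Finset.range (D + 2)).filter (fun i => i ≤ k) = Finset.range (k + 1) := by
    ext i; simp only [Finset.mem_filter, Finset.mem_range]; omega
  rw [this, Finset.sum_range_sub]
  simp [cum]

theorem sum_wt [CommRing R] (D : ℕ) (p : ℕ → R) : ∑ θ : Fin (D + 2), wt D p θ = 1 := by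
  have := sum_wt_le D p (D + 1) le_rfl
  simp only [cum] at this
  rw [if_neg (by omega)] at this
  rw [← this]
  refine Finset.sum_congr rfl fun θ _ => ?_
  rw [if_pos (by omega)]

/-- heat-bath single-site operator -/
def ks [CommRing R] (p : ℕ → R) (x : V) (f : (V → Bool) → R) (η : V → Bool) : R :=
  p (cnt nb η x) * f (Function.update η x true) +
    (1 - p (cnt nb η x)) * f (Function.update η x false)

theorem sum_wt_upd [CommRing R] (p : ℕ → R) (x : V) (f : (V → Bool) → R) (η : V → Bool) :
    ∑ θ : Fin (Fintype.card κ + 2), wt (Fintype.card κ) p θ * f (upd nb x θ η) =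
      ks nb p x f η := by
  have hk := cnt_le nb η x
  have h1 : ∀ θ : Fin (Fintype.card κ + 2), wt (Fintype.card κ) p θ * f (upd nb x θ η) =
      (if (θ : ℕ) ≤ cnt nb η x then wt (Fintype.card κ) p θ else 0) *
        (f (Function.update η x true) - f (Function.update η x false)) +
      wt (Fintype.card κ) p θ * f (Function.update η x false) := by
    intro θ
    unfold upd
    by_cases h : (θ : ℕ) ≤ cnt nb η x
    · simp only [h, decide_true, if_true]; ring
    · simp only [h, decide_false, if_false]; ring
  rw [Finset.sum_congr rfl fun θ _ => h1 θ, Finset.sum_add_distrib, ← Finset.sum_mul,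
    ← Finset.sum_mul, sum_wt, sum_wt_le _ _ _ (by omega)]
  simp only [cum, hk, if_true, ks]
  ring

/-- word operator -/
def Tw [CommRing R] (p : ℕ → R) (w : List V) (f : (V → Bool) → R) : (V → Bool) → R :=
  w.foldr (fun x g => ks nb p x g) f

theorem Tw_nil [CommRing R] (p : ℕ → R) (f : (V → Bool) → R) : Tw nb p [] f = f := rfl
theorem Tw_cons [CommRing R] (p : ℕ → R) (x : V) (w : List V) (f : (V → Bool) → R) :
    Tw nb p (x :: w) f = ks nb p x (Tw nb p w f) := rfl
theorem Tw_append [CommRing R] (p : ℕ → R) (w w' : List V) (f : (V → Bool) → R) :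
    Tw nb p (w ++ w') f = Tw nb p w (Tw nb p w' f) := by
  unfold Tw; rw [List.foldr_append]

variable {I : Type*} [Fintype I] [DecidableEq I]

/-- run a list of updates -/
def run (s : I → V) (l : List I) {n : ℕ} (U : I → Fin n) (η : V → Bool) : V → Bool :=
  l.foldl (fun η p => upd nb (s p) (U p) η) η

theorem run_mono (s : I → V) (l : List I) {n : ℕ} (U : I → Fin n) : Monotone (run nb s l U) := by
  induction l with
  | nil => exact monotone_id
  | cons p l ih => exact fun σ τ h => ih (upd_mono nb _ _ h)

theorem run_append (s : I → V) (l l' : List I) {n : ℕ} (U : I → Fin n) (η : V → Bool) :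
    run nb s (l ++ l') U η = run nb s l' U (run nb s l U η) := by
  unfold run; rw [List.foldl_append]

theorem run_congr (s : I → V) (l : List I) {n : ℕ} (U U' : I → Fin n) (h : ∀ p ∈ l, U p = U' p)
    (η : V → Bool) : run nb s l U η = run nb s l U' η := by
  induction l generalizing η with
  | nil => rfl
  | cons p l ih =>
    have h1 : run nb s (p :: l) U η = run nb s l U (upd nb (s p) (U p) η) := rfl
    have h2 : run nb s (p :: l) U' η = run nb s l U' (upd nb (s p) (U' p) η) := rfl
    rw [h1, h2, h p (by simp), ih fun q hq => h q (by simp [hq])]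

theorem Ex_coord [CommRing R] {Θ : Type*} [Fintype Θ] [DecidableEq Θ] (w : I → Θ → R)
    (hw : ∀ i, ∑ θ, w i θ = 1) (p : I) (θ : Θ) :
    Ex w (fun U => if U p = θ then 1 else 0) = w p θ := by
  have h := Finset.prod_univ_sum (fun _ : I => (Finset.univ : Finset Θ))
    (fun j t => w j t * (if j = p then (if t = θ then 1 else 0) else 1))
  rw [Fintype.piFinset_univ] at h
  unfold Ex
  have h2 : ∀ U : I → Θ, (∏ i, w i (U i)) * (if U p = θ then 1 else 0) =
      ∏ j, (w j (U j) * (if j = p then (if U j = θ then 1 else 0) else 1)) := by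
    intro U
    rw [Finset.prod_mul_distrib, Finset.prod_ite_eq' Finset.univ p]
    simp
  rw [Finset.sum_congr rfl fun U _ => h2 U, ← h,
    ← Finset.mul_prod_erase Finset.univ _ (Finset.mem_univ p), Finset.prod_eq_one]
  · simp
  · intro j hj
    simp [Finset.ne_of_mem_erase hj, hw]

theorem Ex_cond [CommRing R] {Θ : Type*} [Fintype Θ] [DecidableEq Θ] (w : I → Θ → R)
    (hw : ∀ i, ∑ θ, w i θ = 1) (p : I) (F : Θ → (I → Θ) → R)
    (hF : ∀ θ, DependsOn (F θ) (({p} : Finset I) : Set I)ᶜ) :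
    Ex w (fun U => F (U p) U) = ∑ θ, w p θ * Ex w (F θ) := by
  have h1 : (fun U : I → Θ => F (U p) U) =
      fun U => ∑ θ, (if U p = θ then 1 else 0) * F θ U := by
    ext U; simp
  rw [h1, Ex_sum]
  refine Finset.sum_congr rfl fun θ _ => ?_
  rw [Ex_mul w hw {p} (fun U => if U p = θ then 1 else 0) (F θ) _ (hF θ), Ex_coord w hw]
  intro U U' h
  have : U p = U' p := h p (by simp)
  simp [this]

theorem Ex_run [CommRing R] (p : ℕ → R) (s : I → V) (l : List I) (hl : l.Nodup)
    (f : (V → Bool) → R) (η : V → Bool) :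
    Ex (fun _ : I => wt (Fintype.card κ) p) (fun U => f (run nb s l U η)) =
      Tw nb p (l.map s) f η := by
  induction l generalizing η with
  | nil =>
    have h1 := Ex_const_mul (fun _ : I => wt (Fintype.card κ) p) (f η) (fun _ => 1)
    rw [Ex_one _ (fun _ => sum_wt _ _)] at h1
    simpa [run, Tw] using h1
  | cons a l ih =>
    rw [List.nodup_cons] at hl
    have h1 := Ex_cond (fun _ : I => wt (Fintype.card κ) p) (fun _ => sum_wt _ _) a
      (fun θ U => f (run nb s l U (upd nb (s a) θ η))) (fun θ U U' h => by
        have : run nb s l U (upd nb (s a) θ η) = run nb s l U' (upd nb (s a) θ η) :=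
          run_congr nb s l U U' (fun q hq => h q (by
            simp only [Finset.coe_singleton, Set.mem_compl_iff, Set.mem_singleton_iff]
            rintro rfl; exact hl.1 hq)) _
        simp only [this])
    have h2 : (fun U => f (run nb s (a :: l) U η)) =
      fun U : I → Fin (Fintype.card κ + 2) => f (run nb s l U (upd nb (s a) (U a) η)) := rfl
    rw [h2, h1]
    simp only [ih hl.2]
    rw [List.map_cons, Tw_cons, ← sum_wt_upd]

end Dyn

section RealDyn
set_option linter.unusedSectionVars false
variable {V κ : Type*} [DecidableEq V] [Fintype κ] (nb : V → κ → V) (p : ℕ → ℝ)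

theorem wt_nonneg (D : ℕ) (p : ℕ → ℝ) (h0 : ∀ k ≤ D, 0 ≤ p k) (h1 : ∀ k ≤ D, p k ≤ 1)
    (hm : Monotone p) (θ : Fin (D + 2)) : 0 ≤ wt D p θ := by
  unfold wt
  obtain ⟨t, ht⟩ := θ
  cases t with
  | zero => simpa [cum] using h0 0 (Nat.zero_le _)
  | succ t =>
    simp only [cum]
    rw [if_pos (show t ≤ D by omega)]
    split_ifs with h
    · linarith [hm (Nat.le_succ t)]
    · linarith [h1 t (by omega)]

theorem ks_mono_on (h0 : ∀ k ≤ Fintype.card κ, 0 ≤ p k) (h1 : ∀ k ≤ Fintype.card κ, p k ≤ 1)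
    (C : Set (V → Bool)) (x : V) (hC : ∀ η ∈ C, ∀ b, Function.update η x b ∈ C)
    (f g : (V → Bool) → ℝ) (h : ∀ η ∈ C, f η ≤ g η) (η : V → Bool) (hη : η ∈ C) :
    ks nb p x f η ≤ ks nb p x g η := by
  unfold ks
  have a := h0 _ (cnt_le nb η x)
  have b := h1 _ (cnt_le nb η x)
  exact add_le_add (mul_le_mul_of_nonneg_left (h _ (hC η hη _)) a)
    (mul_le_mul_of_nonneg_left (h _ (hC η hη _)) (by linarith))

theorem Tw_mono_on (h0 : ∀ k ≤ Fintype.card κ, 0 ≤ p k) (h1 : ∀ k ≤ Fintype.card κ, p k ≤ 1)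
    (C : Set (V → Bool)) (w : List V) (hC : ∀ η ∈ C, ∀ x ∈ w, ∀ b, Function.update η x b ∈ C)
    (f g : (V → Bool) → ℝ) (h : ∀ η ∈ C, f η ≤ g η) : ∀ η ∈ C,
    Tw nb p w f η ≤ Tw nb p w g η := by
  induction w with
  | nil => exact h
  | cons x w ih =>
    exact ks_mono_on nb p h0 h1 C x (fun η hη b => hC η hη x (by simp) b) _ _
      (ih fun η hη y hy b => hC η hη y (by simp [hy]) b)

theorem Tw_affine {R : Type*} [CommRing R] (p : ℕ → R) (w : List V) (f : (V → Bool) → R) (a b : R) :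
    Tw nb p w (fun η => a * f η + b) = fun η => a * Tw nb p w f η + b := by
  induction w with
  | nil => rfl
  | cons x w ih =>
    rw [Tw_cons, ih, Tw_cons]
    ext η
    unfold ks
    ring

theorem Tw_const {R : Type*} [CommRing R] (p : ℕ → R) (w : List V) (b : R) :
    Tw nb p w (fun _ => b) = fun _ => b := by
  have := Tw_affine nb p w (fun _ => 0) 0 b
  simpa using this

theorem ks_monotone (h0 : ∀ k ≤ Fintype.card κ, 0 ≤ p k) (h1 : ∀ k ≤ Fintype.card κ, p k ≤ 1)
    (hm : Monotone p) (x : V) (f : (V → Bool) → ℝ) (hf : Monotone f) :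
    Monotone (ks nb p x f) := by
  intro σ τ h
  unfold ks
  have a := h0 _ (cnt_le nb σ x)
  have b := h1 _ (cnt_le nb τ x)
  have c := hm (cnt_mono nb h x)
  have d := hf (update_le_update h x (le_refl true))
  have e := hf (update_le_update h x (le_refl false))
  have g := hf (update_le_update (le_refl τ) x (Bool.false_le true))
  nlinarith [mul_nonneg a (sub_nonneg.mpr d), mul_nonneg (sub_nonneg.mpr (c.trans b)) (sub_nonneg.mpr e),
    mul_nonneg (sub_nonneg.mpr c) (sub_nonneg.mpr g)]

theorem Tw_monotone (h0 : ∀ k ≤ Fintype.card κ, 0 ≤ p k) (h1 : ∀ k ≤ Fintype.card κ, p k ≤ 1)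
    (hm : Monotone p) (w : List V) (f : (V → Bool) → ℝ) (hf : Monotone f) :
    Monotone (Tw nb p w f) := by
  induction w with
  | nil => exact hf
  | cons x w ih => exact ks_monotone nb p h0 h1 hm x _ ih

/-- set the sites of `w` to plus -/
def setw (w : List V) (η : V → Bool) : V → Bool := w.foldl (fun η x => Function.update η x true) η

theorem setw_apply (w : List V) (η : V → Bool) (v : V) :
    setw w η v = if v ∈ w then true else η v := by
  induction w generalizing η with
  | nil => simp [setw]
  | cons x w ih =>
    have : setw (x :: w) η = setw w (Function.update η x true) := rfl
    rw [this, ih]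
    by_cases hv : v = x
    · subst hv; simp
    · simp [hv, Function.update_of_ne hv]

theorem Tw_doeblin (δ : ℝ) (hδ : 0 ≤ δ) (h0 : ∀ k ≤ Fintype.card κ, δ ≤ p k)
    (h1 : ∀ k ≤ Fintype.card κ, p k ≤ 1)
    (C : Set (V → Bool)) (w : List V) (hC : ∀ η ∈ C, ∀ x ∈ w, ∀ b, Function.update η x b ∈ C)
    (f : (V → Bool) → ℝ) (h : ∀ η ∈ C, 0 ≤ f η) : ∀ η ∈ C,
    δ ^ w.length * f (setw w η) ≤ Tw nb p w f η := by
  induction w with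
  | nil => intro η _; simp [setw, Tw]
  | cons x w ih =>
    intro η hη
    have hC' : ∀ η ∈ C, ∀ x ∈ w, ∀ b, Function.update η x b ∈ C :=
      fun η hη y hy b => hC η hη y (by simp [hy]) b
    have hx : ∀ b, Function.update η x b ∈ C := fun b => hC η hη x (by simp) b
    have h2 := ih hC' _ (hx true)
    have h3 : ∀ η ∈ C, 0 ≤ Tw nb p w f η := by
      intro η hη
      have := Tw_mono_on nb p (fun k hk => hδ.trans (h0 k hk)) h1 C w hC' (fun _ => 0) f h η hη
      rwa [Tw_const] at this
    rw [Tw_cons]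
    unfold ks
    have a := h0 _ (cnt_le nb η x)
    have b := h1 _ (cnt_le nb η x)
    have c := h3 _ (hx true)
    have d := h3 _ (hx false)
    have e : setw (x :: w) η = setw w (Function.update η x true) := rfl
    rw [e, List.length_cons, pow_succ]
    calc _ = δ * (δ ^ w.length * f (setw w (Function.update η x true))) := by ring
      _ ≤ δ * Tw nb p w f (Function.update η x true) := mul_le_mul_of_nonneg_left h2 hδ
      _ ≤ p (cnt nb η x) * Tw nb p w f (Function.update η x true) :=
        mul_le_mul_of_nonneg_right a c
      _ ≤ _ := le_add_of_nonneg_right (mul_nonneg (by linarith) d)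

theorem Tw_contract (δ : ℝ) (hδ : 0 ≤ δ) (h0 : ∀ k ≤ Fintype.card κ, δ ≤ p k)
    (h1 : ∀ k ≤ Fintype.card κ, p k ≤ 1)
    (C : Set (V → Bool)) (w : List V) (hC : ∀ η ∈ C, ∀ x ∈ w, ∀ b, Function.update η x b ∈ C)
    (ζ : V → Bool) (hζ : ∀ η ∈ C, setw w η = ζ)
    (f : (V → Bool) → ℝ) (a b : ℝ) (h : ∀ η ∈ C, a ≤ f η ∧ f η ≤ b) (n : ℕ) :
    ∃ a' b', b' - a' = (1 - δ ^ w.length) ^ n * (b - a) ∧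
      ∀ η ∈ C, a' ≤ (Tw nb p w)^[n] f η ∧ (Tw nb p w)^[n] f η ≤ b' := by
  induction n with
  | zero => exact ⟨a, b, by simp, h⟩
  | succ n ih =>
    obtain ⟨a', b', hab, h2⟩ := ih
    set g := (Tw nb p w)^[n] f with hg
    refine ⟨a' + δ ^ w.length * (g ζ - a'), b' - δ ^ w.length * (b' - g ζ), ?_, ?_⟩
    · rw [pow_succ, mul_comm (_ ^ n), mul_assoc, ← hab]; ring
    · intro η hη
      rw [Function.iterate_succ_apply', ← hg]
      have h3 := Tw_doeblin nb p δ hδ h0 h1 C w hC (fun η => 1 * g η + (- a'))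
        (fun η hη => by linarith [(h2 η hη).1]) η hη
      have h4 := Tw_doeblin nb p δ hδ h0 h1 C w hC (fun η => (-1) * g η + b')
        (fun η hη => by linarith [(h2 η hη).2]) η hη
      rw [Tw_affine, hζ η hη] at h3 h4
      constructor
      · nlinarith
      · nlinarith

end RealDyn

section Rev
set_option linter.unusedSectionVars false
variable {V κ J : Type*} [DecidableEq V] [Fintype κ] [Fintype J] [DecidableEq J] (nb : V → κ → V)
  (p : ℕ → ℝ)

theorem pair_sum (j : J) (H : (J → Bool) → ℝ) :
    2 * ∑ η, H η = ∑ η, (H (Function.update η j true) + H (Function.update η j false)) := by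
  have h1 : ∑ η, H η = ∑ η : J → Bool, H (Function.update η j (!(η j))) := by
    have hinv : Function.Involutive (fun η : J → Bool => Function.update η j (!(η j))) := by
      intro η
      simp
    exact (Equiv.sum_comp hinv.toPerm H).symm
  rw [two_mul]
  nth_rewrite 2 [h1]
  rw [← Finset.sum_add_distrib]
  refine Finset.sum_congr rfl fun η _ => ?_
  cases h : η j
  · have : Function.update η j false = η := by rw [← h]; exact Function.update_eq_self j η
    rw [this]; simp [add_comm]
  · have : Function.update η j true = η := by rw [← h]; exact Function.update_eq_self j η
    rw [this]; simp

/-- reversible finite-volume weight -/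
structure RevW (emb : (J → Bool) → (V → Bool)) (s : J → V) (W : (J → Bool) → ℝ) : Prop where
  hnb : ∀ x q, nb x q ≠ x
  hemb : ∀ η j b, emb (Function.update η j b) = Function.update (emb η) (s j) b
  pos : ∀ η, 0 < W η
  bal : ∀ η j, W (Function.update η j true) * (1 - p (cnt nb (emb η) (s j))) =
    W (Function.update η j false) * p (cnt nb (emb η) (s j))

variable {nb p} {emb : (J → Bool) → (V → Bool)} {s : J → V} {W : (J → Bool) → ℝ}

theorem RevW.ks_emb (X : RevW nb p emb s W) (j : J) (f : (V → Bool) → ℝ) (η : J → Bool) (b : Bool) :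
    ks nb p (s j) f (emb (Function.update η j b)) =
      p (cnt nb (emb η) (s j)) * f (emb (Function.update η j true)) +
      (1 - p (cnt nb (emb η) (s j))) * f (emb (Function.update η j false)) := by
  unfold ks
  rw [X.hemb, cnt_update nb X.hnb, X.hemb, X.hemb]
  simp

theorem RevW.selfadj (X : RevW nb p emb s W) (j : J) (f g : (V → Bool) → ℝ) :
    ∑ η, W η * (g (emb η) * ks nb p (s j) f (emb η)) =
      ∑ η, W η * (ks nb p (s j) g (emb η) * f (emb η)) := by
  have h1 := pair_sum j (fun η => W η * (g (emb η) * ks nb p (s j) f (emb η)))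
  have h2 := pair_sum j (fun η => W η * (ks nb p (s j) g (emb η) * f (emb η)))
  have h3 : ∑ η, W η * (g (emb η) * ks nb p (s j) f (emb η)) * 2 =
      ∑ η, W η * (ks nb p (s j) g (emb η) * f (emb η)) * 2 := by
    rw [← Finset.sum_mul, ← Finset.sum_mul, mul_comm _ (2 : ℝ), mul_comm _ (2 : ℝ), h1, h2]
    refine Finset.sum_congr rfl fun η _ => ?_
    simp only [X.ks_emb]
    have hb := X.bal η j
    generalize p (cnt nb (emb η) (s j)) = π at *
    generalize f (emb (Function.update η j true)) = ft
    generalize f (emb (Function.update η j false)) = ff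
    generalize g (emb (Function.update η j true)) = gt
    generalize g (emb (Function.update η j false)) = gf
    generalize W (Function.update η j true) = wt at *
    generalize W (Function.update η j false) = wf at *
    linear_combination (gt * ff - gf * ft) * hb
  rw [← Finset.sum_mul, ← Finset.sum_mul] at h3
  linarith

theorem RevW.pw (X : RevW nb p emb s W) (h1 : ∀ k ≤ Fintype.card κ, p k ≤ 1) (j : J)
    (f g : (V → Bool) → ℝ)
    (hf : Monotone f) (hg : Monotone g) :
    ∑ η, W η * (g (emb η) * ks nb p (s j) f (emb η)) ≤
      ∑ η, W η * (g (emb η) * f (emb η)) := by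
  have h3 := pair_sum j (fun η => W η * (g (emb η) * ks nb p (s j) f (emb η)))
  have h4 := pair_sum j (fun η => W η * (g (emb η) * f (emb η)))
  have h5 : ∑ η, (W (Function.update η j true) * (g (emb (Function.update η j true)) *
      ks nb p (s j) f (emb (Function.update η j true))) +
      W (Function.update η j false) * (g (emb (Function.update η j false)) *
      ks nb p (s j) f (emb (Function.update η j false)))) ≤
    ∑ η, (W (Function.update η j true) * (g (emb (Function.update η j true)) *
      f (emb (Function.update η j true))) +
      W (Function.update η j false) * (g (emb (Function.update η j false)) *
      f (emb (Function.update η j false)))) := by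
    refine Finset.sum_le_sum fun η _ => ?_
    simp only [X.ks_emb]
    have hb := X.bal η j
    have hp := h1 _ (cnt_le nb (emb η) (s j))
    have hle : emb (Function.update η j false) ≤ emb (Function.update η j true) := by
      rw [X.hemb, X.hemb]
      exact update_le_update le_rfl _ (Bool.false_le _)
    have hf' := hf hle
    have hg' := hg hle
    have hw := X.pos (Function.update η j true)
    generalize p (cnt nb (emb η) (s j)) = π at *
    generalize f (emb (Function.update η j true)) = ft at *
    generalize f (emb (Function.update η j false)) = ff at *
    generalize g (emb (Function.update η j true)) = gt at *
    generalize g (emb (Function.update η j false)) = gf at *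
    generalize W (Function.update η j true) = wt at *
    generalize W (Function.update η j false) = wf at *
    have key : 0 ≤ wt * (1 - π) * ((gt - gf) * (ft - ff)) :=
      mul_nonneg (mul_nonneg hw.le (by linarith)) (mul_nonneg (by linarith) (by linarith))
    have e : wt * (gt * ft) + wf * (gf * ff) - (wt * (gt * (π * ft + (1 - π) * ff)) +
        wf * (gf * (π * ft + (1 - π) * ff))) = wt * (1 - π) * ((gt - gf) * (ft - ff)) := by
      linear_combination (ft * gf - ff * gf) * hb
    linarith
  linarith

theorem RevW.stat (X : RevW nb p emb s W) (w : List J) (f : (V → Bool) → ℝ) :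
    ∑ η, W η * Tw nb p (w.map s) f (emb η) = ∑ η, W η * f (emb η) := by
  induction w with
  | nil => rfl
  | cons j w ih =>
    rw [List.map_cons, Tw_cons]
    have h := X.selfadj j (Tw nb p (w.map s) f) (fun _ => 1)
    simp only [one_mul] at h
    rw [h, ← ih]
    refine Finset.sum_congr rfl fun η _ => ?_
    simp [ks]

theorem RevW.stat_iter (X : RevW nb p emb s W) (w : List J) (f : (V → Bool) → ℝ) (n : ℕ) :
    ∑ η, W η * (Tw nb p (w.map s))^[n] f (emb η) = ∑ η, W η * f (emb η) := by
  induction n with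
  | zero => rfl
  | succ n ih => rw [Function.iterate_succ_apply', X.stat, ih]

/-- convergence of the sweep dynamics to the finite-volume Gibbs expectation -/
theorem RevW.conv (X : RevW nb p emb s W) (δ : ℝ) (hδ : 0 ≤ δ)
    (h0 : ∀ k ≤ Fintype.card κ, δ ≤ p k) (h1 : ∀ k ≤ Fintype.card κ, p k ≤ 1)
    (w : List J) (hw : ∀ j, j ∈ w) (hoff : ∀ η η' v, v ∉ Set.range s → emb η v = emb η' v)
    (f : (V → Bool) → ℝ) (a b : ℝ) (h : ∀ η, a ≤ f η ∧ f η ≤ b) (n : ℕ) (η : J → Bool) :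
    |(Tw nb p (w.map s))^[n] f (emb η) - (∑ η, W η * f (emb η)) / ∑ η, W η| ≤
      (1 - δ ^ w.length) ^ n * (b - a) := by
  have hC : ∀ η ∈ Set.range emb, ∀ x ∈ w.map s, ∀ b, Function.update η x b ∈ Set.range emb := by
    rintro _ ⟨η, rfl⟩ x hx b
    obtain ⟨j, _, rfl⟩ := List.mem_map.mp hx
    exact ⟨Function.update η j b, X.hemb η j b⟩
  have hζ : ∀ σ ∈ Set.range emb, setw (w.map s) σ = setw (w.map s) (emb η) := by
    rintro _ ⟨η', rfl⟩
    ext v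
    rw [setw_apply, setw_apply]
    split_ifs with hv
    · rfl
    · refine hoff _ _ _ ?_
      rintro ⟨j, rfl⟩
      exact hv (List.mem_map.mpr ⟨j, hw j, rfl⟩)
  obtain ⟨a', b', hab, hT⟩ := Tw_contract nb p δ hδ h0 h1 (Set.range emb) (w.map s) hC _ hζ f a b
    (fun η _ => h η) n
  rw [List.length_map] at hab
  rw [← hab]
  have hW : 0 < ∑ η, W η := Finset.sum_pos (fun η _ => X.pos η) ⟨η, Finset.mem_univ _⟩
  have hs := X.stat_iter w f n
  have hlo : a' ≤ (∑ η, W η * f (emb η)) / ∑ η, W η := by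
    rw [le_div_iff₀ hW, ← hs, Finset.mul_sum]
    refine Finset.sum_le_sum fun η _ => ?_
    rw [mul_comm]
    exact mul_le_mul_of_nonneg_left (hT _ ⟨η, rfl⟩).1 (X.pos η).le
  have hhi : (∑ η, W η * f (emb η)) / ∑ η, W η ≤ b' := by
    rw [div_le_iff₀ hW, ← hs, Finset.mul_sum]
    refine Finset.sum_le_sum fun η _ => ?_
    rw [mul_comm b']
    exact mul_le_mul_of_nonneg_left (hT _ ⟨η, rfl⟩).2 (X.pos η).le
  have := hT _ ⟨η, rfl⟩
  rw [abs_le]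
  constructor <;> linarith

end Rev

section PW
set_option linter.unusedSectionVars false
variable {V κ : Type*} [DecidableEq V] [Fintype κ] [Fintype V] {nb : V → κ → V}
  {p : ℕ → ℝ} {W : (V → Bool) → ℝ}

theorem pw_word (X : RevW nb p (fun η : V → Bool => η) id W)
    (h0 : ∀ k ≤ Fintype.card κ, 0 ≤ p k) (h1 : ∀ k ≤ Fintype.card κ, p k ≤ 1)
    (hm : Monotone p) (w : List V) (f g : (V → Bool) → ℝ) (hf : Monotone f) (hg : Monotone g) :
    ∑ η, W η * (g η * Tw nb p w f η) ≤ ∑ η, W η * (g η * f η) := by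
  induction w with
  | nil => exact le_rfl
  | cons x w ih =>
    rw [Tw_cons]
    exact (X.pw h1 x _ g (Tw_monotone nb p h0 h1 hm w f hf) hg).trans ih

theorem selfadj_word (X : RevW nb p (fun η : V → Bool => η) id W)
    (w : List V) (f g : (V → Bool) → ℝ) :
    ∑ η, W η * (g η * Tw nb p w f η) = ∑ η, W η * (Tw nb p w.reverse g η * f η) := by
  induction w generalizing g with
  | nil => rfl
  | cons x w ih =>
    rw [Tw_cons, List.reverse_cons, Tw_append, Tw_cons, Tw_nil, ← ih]
    exact X.selfadj x _ g

theorem pw_drop (X : RevW nb p (fun η : V → Bool => η) id W)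
    (h0 : ∀ k ≤ Fintype.card κ, 0 ≤ p k) (h1 : ∀ k ≤ Fintype.card κ, p k ≤ 1)
    (hm : Monotone p) (w w' : List V) (f g : (V → Bool) → ℝ) (hf : Monotone f) (hg : Monotone g) :
    ∑ η, W η * (g η * Tw nb p (w ++ w') f η) ≤ ∑ η, W η * (g η * Tw nb p w f η) := by
  rw [Tw_append, selfadj_word X w, selfadj_word X w]
  exact pw_word X h0 h1 hm w' f _ hf (Tw_monotone nb p h0 h1 hm _ g hg)

theorem pw_top (X : RevW nb p (fun η : V → Bool => η) id W)
    (h0 : ∀ k ≤ Fintype.card κ, 0 ≤ p k) (h1 : ∀ k ≤ Fintype.card κ, p k ≤ 1)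
    (hm : Monotone p) (w w' : List V) (f : (V → Bool) → ℝ) (hf : Monotone f) :
    Tw nb p (w ++ w') f (fun _ => true) ≤ Tw nb p w f (fun _ => true) := by
  have hg : Monotone (fun η : V → Bool => if η = fun _ => true then (1 : ℝ) else 0) := by
    intro σ τ h
    by_cases hs : σ = fun _ => true
    · have : τ = fun _ => true := by
        ext v; have := h v; rw [hs] at this; exact le_antisymm (Bool.le_true _) this
      simp [hs, this]
    · simp only [hs, if_false]; split_ifs <;> norm_num
  have := pw_drop X h0 h1 hm w w' f _ hf hg
  simp only [ite_mul, one_mul, zero_mul, mul_ite, mul_zero, Finset.sum_ite_eq',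
    Finset.mem_univ, if_true] at this
  exact le_of_mul_le_mul_left this (X.pos _)

theorem pw_bot (X : RevW nb p (fun η : V → Bool => η) id W)
    (h0 : ∀ k ≤ Fintype.card κ, 0 ≤ p k) (h1 : ∀ k ≤ Fintype.card κ, p k ≤ 1)
    (hm : Monotone p) (w w' : List V) (f : (V → Bool) → ℝ) (hf : Monotone f) :
    Tw nb p w f (fun _ => false) ≤ Tw nb p (w ++ w') f (fun _ => false) := by
  have hg : Monotone (fun η : V → Bool => if η = fun _ => false then (-1 : ℝ) else 0) := by
    intro σ τ h
    by_cases hs : τ = fun _ => false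
    · have : σ = fun _ => false := by
        ext v; have := h v; rw [hs] at this; exact le_antisymm this (Bool.false_le _)
      simp [hs, this]
    · simp only [hs, if_false]; split_ifs <;> norm_num
  have := pw_drop X h0 h1 hm w w' f _ hf hg
  simp only [ite_mul, neg_mul, one_mul, zero_mul, mul_ite, mul_zero, Finset.sum_ite_eq',
    Finset.mem_univ, if_true, mul_neg, neg_le_neg_iff] at this
  exact le_of_mul_le_mul_left this (X.pos _)

/-- the total oscillation is bounded by the oscillation of one stage -/
theorem pw_stage (X : RevW nb p (fun η : V → Bool => η) id W)
    (h0 : ∀ k ≤ Fintype.card κ, 0 ≤ p k) (h1 : ∀ k ≤ Fintype.card κ, p k ≤ 1)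
    (hm : Monotone p) (w1 w2 w3 : List V) (f : (V → Bool) → ℝ) (hf : Monotone f) (a b : ℝ)
    (hab : ∀ η, a ≤ Tw nb p w2 f η ∧ Tw nb p w2 f η ≤ b) :
    Tw nb p (w1 ++ w2 ++ w3) f (fun _ => true) - Tw nb p (w1 ++ w2 ++ w3) f (fun _ => false) ≤
      b - a := by
  have e1 := pw_top X h0 h1 hm (w1 ++ w2) w3 f hf
  have e2 := pw_bot X h0 h1 hm (w1 ++ w2) w3 f hf
  rw [Tw_append nb p w1 w2] at e1 e2
  have e3 := Tw_mono_on nb p h0 h1 Set.univ w1 (by simp) (Tw nb p w2 f) (fun _ => b)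
    (fun η _ => (hab η).2) (fun _ => true) trivial
  have e4 := Tw_mono_on nb p h0 h1 Set.univ w1 (by simp) (fun _ => a) (Tw nb p w2 f)
    (fun η _ => (hab η).1) (fun _ => false) trivial
  rw [Tw_const] at e3 e4
  linarith

end PW
end IsingA
end

section
open MeasureTheory Filter
open IsingP

namespace IsingA

section Lattice
set_option linter.unusedSectionVars false

/-- neighbours on `A^d` -/
def nbr {d : ℕ} {A : Type*} [Ring A] (x : Fin d → A) (q : Fin d × Bool) : Fin d → A :=
  fun k => if k = q.1 then x k + (if q.2 then 1 else -1) else x k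

/-- heat-bath probability -/
noncomputable def sg (D : ℕ) (β h : ℝ) (k : ℕ) : ℝ :=
  1 / (1 + Real.exp (-(2 * (β * (2 * k - D) + h))))

theorem sg_pos (D : ℕ) (β h : ℝ) (k : ℕ) : 0 < sg D β h k := by unfold sg; positivity
theorem sg_lt_one (D : ℕ) (β h : ℝ) (k : ℕ) : sg D β h k < 1 := by
  unfold sg
  rw [div_lt_one (by positivity)]
  linarith [Real.exp_pos (-(2 * (β * (2 * k - D) + h)))]

theorem sg_mono (D : ℕ) (β h : ℝ) (hβ : 0 ≤ β) : Monotone (sg D β h) := by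
  intro k k' hk
  unfold sg
  have hk' : (k : ℝ) ≤ k' := by exact_mod_cast hk
  have : -(2 * (β * (2 * k' - D) + h)) ≤ -(2 * (β * (2 * k - D) + h)) := by
    nlinarith [mul_nonneg hβ (sub_nonneg.mpr hk')]
  gcongr

theorem sg_bound (D : ℕ) (β h : ℝ) : ∃ δ, 0 < δ ∧ δ ≤ 1 ∧ ∀ k ≤ D, δ ≤ sg D β h k := by
  obtain ⟨k0, _, hk0⟩ := Finset.exists_min_image (Finset.range (D + 1)) (sg D β h) ⟨0, by simp⟩
  exact ⟨sg D β h k0, sg_pos _ _ _ _, (sg_lt_one _ _ _ _).le, fun k hk => hk0 k (by simp; omega)⟩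

theorem sg_bal (D : ℕ) (β h a b : ℝ) (k : ℕ) (hab : a - b = 2 * (β * (2 * k - D) + h)) :
    Real.exp a * (1 - sg D β h k) = Real.exp b * sg D β h k := by
  unfold sg
  rw [← hab]
  have h1 : 0 < 1 + Real.exp (-(a - b)) := by positivity
  have h2 : Real.exp a * Real.exp (-(a - b)) = Real.exp b := by
    rw [← Real.exp_add]; congr 1; ring
  field_simp
  linear_combination h2

theorem spin_sum_cnt {V κ : Type*} [Fintype κ] (nb : V → κ → V) (σ : V → Bool) (x : V) :
    ∑ q, spin (σ (nb x q)) = 2 * (cnt nb σ x : ℝ) - Fintype.card κ := by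
  have h : ∀ q, spin (σ (nb x q)) = 2 * (if σ (nb x q) = true then 1 else 0) - 1 := by
    intro q; unfold spin; split_ifs <;> norm_num
  rw [Finset.sum_congr rfl fun q _ => h q, Finset.sum_sub_distrib, ← Finset.mul_sum]
  simp [cnt]

theorem nbr_inj {d : ℕ} (x : Fin d → ℤ) : Function.Injective (nbr x) := by
  rintro ⟨k, b⟩ ⟨k', b'⟩ h
  have h1 := congrFun h k
  have h2 := congrFun h k'
  by_cases hk : k = k'
  · subst hk
    simp only [nbr, if_true] at h1
    cases b <;> cases b' <;> simp at h1 ⊢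
  · simp only [nbr, hk, if_true, if_false] at h1
    cases b <;> simp at h1

theorem nbr_ne {d : ℕ} (x : Fin d → ℤ) (q) : nbr x q ≠ x := by
  intro h
  have h1 := congrFun h q.1
  simp only [nbr, if_true] at h1
  rcases q with ⟨k, b⟩
  cases b <;> simp at h1

theorem nbrs_eq {d : ℕ} (x : Site d) : nbrs x = Finset.univ.image (nbr x) := rfl

theorem sum_nbrs {d : ℕ} (x : Site d) (F : Site d → ℝ) : ∑ j ∈ nbrs x, F j = ∑ q, F (nbr x q) := by
  rw [nbrs_eq, Finset.sum_image (fun _ _ _ _ h => nbr_inj x h)]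

theorem mem_nbrs_symm {d : ℕ} {x y : Site d} (h : y ∈ nbrs x) : x ∈ nbrs y := by
  rw [nbrs_eq, Finset.mem_image] at h ⊢
  obtain ⟨⟨k, b⟩, _, rfl⟩ := h
  refine ⟨⟨k, !b⟩, Finset.mem_univ _, ?_⟩
  ext l
  by_cases hl : l = k
  · subst hl; cases b <;> simp [nbr]
  · simp [nbr, hl]

theorem quad_diff {S : Type*} [DecidableEq S] (Λ : Finset S) (c : S → S → ℝ)
    (hs : ∀ i j, c i j = c j i) (x : S) (hx : x ∈ Λ) (h0 : c x x = 0) (a a' : S → ℝ)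
    (ha : ∀ i, i ≠ x → a i = a' i) :
    ∑ i ∈ Λ, ∑ j ∈ Λ, c i j * (a i * a j) - ∑ i ∈ Λ, ∑ j ∈ Λ, c i j * (a' i * a' j) =
      2 * (a x - a' x) * ∑ j ∈ Λ, c x j * a j := by
  have key : ∀ b : S → ℝ, ∑ i ∈ Λ, ∑ j ∈ Λ, c i j * (b i * b j) =
      2 * b x * (∑ j ∈ Λ.erase x, c x j * b j) +
        ∑ i ∈ Λ.erase x, ∑ j ∈ Λ.erase x, c i j * (b i * b j) := by
    intro b
    rw [← Finset.add_sum_erase Λ _ hx, ← Finset.add_sum_erase Λ _ hx, h0]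
    have : ∀ i ∈ Λ.erase x, ∑ j ∈ Λ, c i j * (b i * b j) =
        b x * (c x i * b i) + ∑ j ∈ Λ.erase x, c i j * (b i * b j) := by
      intro i _
      rw [← Finset.add_sum_erase Λ _ hx, hs i x]; ring
    rw [Finset.sum_congr rfl this, Finset.sum_add_distrib, ← Finset.mul_sum]
    have h2 : ∑ j ∈ Λ.erase x, c x j * (b x * b j) = b x * ∑ j ∈ Λ.erase x, c x j * b j := by
      rw [Finset.mul_sum]; exact Finset.sum_congr rfl fun _ _ => by ring
    rw [h2]; ring
  rw [key a, key a', ← Finset.add_sum_erase Λ (fun j => c x j * a j) hx, h0]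
  have e1 : ∑ j ∈ Λ.erase x, c x j * a' j = ∑ j ∈ Λ.erase x, c x j * a j :=
    Finset.sum_congr rfl fun j hj => by rw [ha j (Finset.ne_of_mem_erase hj)]
  have e2 : ∑ i ∈ Λ.erase x, ∑ j ∈ Λ.erase x, c i j * (a' i * a' j) =
      ∑ i ∈ Λ.erase x, ∑ j ∈ Λ.erase x, c i j * (a i * a j) :=
    Finset.sum_congr rfl fun i hi => Finset.sum_congr rfl fun j hj => by
      rw [ha j (Finset.ne_of_mem_erase hj), ha i (Finset.ne_of_mem_erase hi)]
  rw [e1, e2]; ring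

theorem patch_update {d : ℕ} (Λ : Finset (Site d)) (η : {x // x ∈ Λ} → Bool) (ω : Config d)
    (j : {x // x ∈ Λ}) (b : Bool) :
    patch Λ (Function.update η j b) ω = Function.update (patch Λ η ω) j.1 b := by
  ext i
  by_cases hi : i = j.1
  · subst hi; simp [patch]
  · rw [Function.update_of_ne hi]
    by_cases hiΛ : i ∈ Λ
    · have : (⟨i, hiΛ⟩ : {x // x ∈ Λ}) ≠ j := fun h => hi (by rw [← h])
      simp [patch, hiΛ, Function.update_of_ne this]
    · simp [patch, hiΛ]

theorem ham_diff {d : ℕ} (β h : ℝ) (Λ : Finset (Site d)) (η ω : Config d) (x : Site d)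
    (hx : x ∈ Λ) (hη : ∀ i, i ∉ Λ → η i = ω i) :
    hamElem β h Λ (Function.update η x true) ω - hamElem β h Λ (Function.update η x false) ω =
      2 * (β * (2 * (cnt nbr η x : ℝ) - (Fintype.card (Fin d × Bool) : ℕ)) + h) := by
  set a : Site d → ℝ := fun i => spin (Function.update η x true i) with ha
  set a' : Site d → ℝ := fun i => spin (Function.update η x false i) with ha'
  have haa : ∀ i, i ≠ x → a i = a' i := fun i hi => by
    simp [ha, ha', Function.update_of_ne hi]
  have hax : a x = 1 := by simp [ha, spin]
  have hax' : a' x = -1 := by simp [ha', spin]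
  have hxn : x ∉ nbrs x := by
    rw [nbrs_eq, Finset.mem_image]
    rintro ⟨q, _, hq⟩
    exact nbr_ne x q hq
  have han : ∀ j ∈ nbrs x, a j = spin (η j) := fun j hj => by
    have : j ≠ x := fun h => hxn (h ▸ hj)
    simp [ha, Function.update_of_ne this]
  -- quadratic part
  have hq : ∀ b : Site d → ℝ, ∑ i ∈ Λ, ∑ j ∈ nbrs i ∩ Λ, b i * b j =
      ∑ i ∈ Λ, ∑ j ∈ Λ, (if j ∈ nbrs i then (1 : ℝ) else 0) * (b i * b j) := by
    intro b
    refine Finset.sum_congr rfl fun i _ => ?_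
    simp only [ite_mul, one_mul, zero_mul]
    rw [← Finset.sum_filter]
    refine Finset.sum_congr ?_ fun _ _ => rfl
    ext j; simp [and_comm]
  have hd := quad_diff Λ (fun i j => if j ∈ nbrs i then (1 : ℝ) else 0) (fun i j => by
    by_cases h1 : j ∈ nbrs i
    · simp [h1, mem_nbrs_symm h1]
    · have : i ∉ nbrs j := fun h2 => h1 (mem_nbrs_symm h2)
      simp [h1, this]) x hx (by simp [hxn]) a a' haa
  rw [← hq a, ← hq a', hax, hax'] at hd
  have e1 : ∑ j ∈ Λ, (if j ∈ nbrs x then (1 : ℝ) else 0) * a j =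
      ∑ j ∈ nbrs x ∩ Λ, spin (η j) := by
    simp only [ite_mul, one_mul, zero_mul]
    rw [← Finset.sum_filter]
    refine Finset.sum_congr ?_ fun j hj => han j ?_
    · ext j; simp [and_comm]
    · exact (Finset.mem_inter.mp hj).1
  rw [e1] at hd
  -- linear parts
  have hl : ∀ b : Site d → ℝ, ∑ i ∈ Λ, a i * b i - ∑ i ∈ Λ, a' i * b i = 2 * b x := by
    intro b
    rw [← Finset.add_sum_erase Λ _ hx, ← Finset.add_sum_erase Λ (fun i => a' i * b i) hx,
      Finset.sum_congr rfl (fun i hi => by rw [haa i (Finset.ne_of_mem_erase hi)]), hax, hax']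
    ring
  have h2 := hl (fun i => ∑ j ∈ nbrs i \ Λ, spin (ω j))
  have h3 := hl (fun _ => 1)
  simp only [mul_one, Finset.mul_sum] at h2 h3
  have e2 : ∑ j ∈ nbrs x \ Λ, 2 * spin (ω j) = 2 * ∑ j ∈ nbrs x \ Λ, spin (η j) := by
    rw [Finset.mul_sum]
    refine Finset.sum_congr rfl fun j hj => ?_
    rw [hη j (Finset.mem_sdiff.mp hj).2]
  rw [e2] at h2
  have e3 : ∑ j ∈ nbrs x ∩ Λ, spin (η j) + ∑ j ∈ nbrs x \ Λ, spin (η j) =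
      2 * (cnt nbr η x : ℝ) - (Fintype.card (Fin d × Bool) : ℕ) := by
    rw [Finset.sum_inter_add_sum_sdiff, sum_nbrs, spin_sum_cnt]
  unfold hamElem
  rw [← e3]
  linear_combination β * 2⁻¹ * hd + β * h2 + h * h3

theorem revW_box {d : ℕ} (β h : ℝ) (Λ : Finset (Site d)) (ω : Config d) :
    RevW (nbr (d := d) (A := ℤ)) (sg (Fintype.card (Fin d × Bool)) β h)
      (fun η : {x // x ∈ Λ} → Bool => patch Λ η ω) Subtype.val
      (fun η => Real.exp (hamElem β h Λ (patch Λ η ω) ω)) where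
  hnb := nbr_ne
  hemb η j b := patch_update Λ η ω j b
  pos η := Real.exp_pos _
  bal η j := by
    refine sg_bal _ _ _ _ _ _ ?_
    rw [patch_update, patch_update]
    exact ham_diff β h Λ _ ω j.1 j.2 (fun i hi => by simp [patch, hi])

/-- indicator of plus at `x` -/
noncomputable def fplus {V : Type*} (x : V) (σ : V → Bool) : ℝ := if σ x = true then 1 else 0

theorem fplus_bd {V : Type*} (x : V) (σ : V → Bool) : 0 ≤ fplus x σ ∧ fplus x σ ≤ 1 := by
  unfold fplus; split_ifs <;> norm_num

theorem fplus_mono {V : Type*} (x : V) : Monotone (fplus x) := by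
  intro σ τ h
  have := h x
  unfold fplus
  by_cases h1 : σ x = true
  · rw [h1] at this
    have h2 : τ x = true := le_antisymm (Bool.le_true _) this
    simp [h1, h2]
  · rw [if_neg h1]
    split_ifs <;> norm_num

theorem ham_congr {d : ℕ} (β h : ℝ) (Λ : Finset (Site d)) (η η' ω ω' : Config d)
    (h1 : ∀ i ∈ Λ, η i = η' i) (h2 : ∀ i ∈ Λ, ∀ j ∈ nbrs i, j ∉ Λ → ω j = ω' j) :
    hamElem β h Λ η ω = hamElem β h Λ η' ω' := by
  unfold hamElem
  congr 1
  · congr 1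
    · congr 2
      refine Finset.sum_congr rfl fun i hi => Finset.sum_congr rfl fun j hj => ?_
      rw [h1 i hi, h1 j (Finset.mem_inter.mp hj).2]
    · congr 1
      refine Finset.sum_congr rfl fun i hi => Finset.sum_congr rfl fun j hj => ?_
      rw [h1 i hi, h2 i hi j (Finset.mem_sdiff.mp hj).1 (Finset.mem_sdiff.mp hj).2]
  · congr 1
    exact Finset.sum_congr rfl fun i hi => by rw [h1 i hi]

theorem measurable_ham {d : ℕ} (β h : ℝ) (Λ : Finset (Site d)) (η : {x // x ∈ Λ} → Bool) :
    Measurable (fun ω : Config d => hamElem β h Λ (patch Λ η ω) ω) := by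
  have hs : Measurable spin := Measurable.of_discrete
  have h1 : ∀ i, Measurable (fun ω : Config d => spin (patch Λ η ω i)) := by
    intro i
    refine hs.comp ?_
    unfold patch
    by_cases hi : i ∈ Λ
    · simp only [hi, dif_pos]; exact measurable_const
    · simp only [hi, dif_neg, not_false_eq_true]; exact measurable_pi_apply i
  have h2 : ∀ i, Measurable (fun ω : Config d => spin (ω i)) := fun i =>
    hs.comp (measurable_pi_apply i)
  unfold hamElem
  refine Measurable.add (Measurable.add ?_ ?_) ?_
  · refine (Measurable.const_mul ?_ _).const_mul _
    exact Finset.measurable_sum _ fun i _ => Finset.measurable_sum _ fun j _ => (h1 i).mul (h1 j)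
  · refine Measurable.const_mul ?_ _
    exact Finset.measurable_sum _ fun i _ => Finset.measurable_sum _ fun j _ => (h1 i).mul (h2 j)
  · refine Measurable.const_mul ?_ _
    exact Finset.measurable_sum _ fun i _ => h1 i

/-- cylinder event -/
def cyl {d : ℕ} (S : Finset (Site d)) (ω : Config d) : Set (Config d) := {σ | ∀ j ∈ S, σ j = ω j}

theorem measurable_cyl {d : ℕ} (S : Finset (Site d)) (ω : Config d) : MeasurableSet (cyl S ω) := by
  have : cyl S ω = ⋂ j ∈ S, (fun σ : Config d => σ j) ⁻¹' {ω j} := by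
    ext σ; simp [cyl]
  rw [this]
  exact Finset.measurableSet_biInter _ fun j _ => measurable_pi_apply j (MeasurableSet.singleton _)

theorem cyl_pos {d : ℕ} (β h : ℝ) (μ : Measure (Config d)) (hG : IsGibbs d β h μ)
    (S : Finset (Site d)) (ω : Config d) : 0 < μ (cyl S ω) := by
  classical
  obtain ⟨hP, hG⟩ := hG
  have hm := measurable_cyl S ω
  set f : Config d → ℝ := (cyl S ω).indicator (fun _ => 1) with hf
  have hfm : Measurable f := measurable_const.indicator hm
  have h1 := hG S f hfm ⟨1, fun σ => by
    simp only [hf, Set.indicator]; split_ifs <;> simp⟩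
  rw [hf, integral_indicator_const _ hm] at h1
  by_contra h0
  have h0' : μ (cyl S ω) = 0 := by simpa using h0
  have hpos : 0 < ∫ ω', localDensity β h S f ω' ∂μ := by
    have hden : ∀ ω', 0 < ∑ η : {x // x ∈ S} → Bool, Real.exp (hamElem β h S (patch S η ω') ω') :=
      fun ω' => Finset.sum_pos (fun _ _ => Real.exp_pos _) Finset.univ_nonempty
    have hf0 : ∀ σ, 0 ≤ f σ := fun σ => Set.indicator_nonneg (fun _ _ => zero_le_one) _
    have hf1 : ∀ σ, f σ ≤ 1 := fun σ => by
      simp only [hf, Set.indicator]; split_ifs <;> simp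
    have hgpos : ∀ ω', 0 < localDensity β h S f ω' := by
      intro ω'
      refine div_pos (Finset.sum_pos' (fun η _ => mul_nonneg (hf0 _) (Real.exp_pos _).le) ?_)
        (hden ω')
      refine ⟨fun j => ω j.1, Finset.mem_univ _, ?_⟩
      have : patch S (fun j => ω j.1) ω' ∈ cyl S ω := fun j hj => by simp [patch, hj]
      simp only [hf, Set.indicator, this, if_true, one_mul]
      exact Real.exp_pos _
    have hgle : ∀ ω', localDensity β h S f ω' ≤ 1 := by
      intro ω'
      refine (div_le_one (hden ω')).mpr (Finset.sum_le_sum fun η _ => ?_)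
      exact mul_le_of_le_one_left (Real.exp_pos _).le (hf1 _)
    have hgm : Measurable (localDensity β h S f) := by
      unfold localDensity
      refine Measurable.div ?_ ?_
      · refine Finset.measurable_sum _ fun η _ => Measurable.mul (hfm.comp ?_)
          (Real.measurable_exp.comp (measurable_ham β h S η))
        refine measurable_pi_lambda _ fun i => ?_
        unfold patch
        by_cases hi : i ∈ S
        · simp only [hi, dif_pos]; exact measurable_const
        · simp only [hi, dif_neg, not_false_eq_true]; exact measurable_pi_apply i
      · exact Finset.measurable_sum _ fun η _ => Real.measurable_exp.comp (measurable_ham β h S η)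
    have hint : Integrable (localDensity β h S f) μ :=
      Integrable.of_bound hgm.aestronglyMeasurable 1 (ae_of_all _ fun ω' => by
        rw [Real.norm_of_nonneg (hgpos ω').le]; exact hgle ω')
    rw [integral_pos_iff_support_of_nonneg (fun ω' => (hgpos ω').le) hint]
    have : Function.support (localDensity β h S f) = Set.univ := by
      ext ω'; simp [(hgpos ω').ne']
    rw [this]
    simp
  rw [← hf] at h1
  rw [← h1, Measure.real, h0'] at hpos
  simp at hpos

theorem cond_eq {d : ℕ} (β h : ℝ) (μ : Measure (Config d)) (hG : IsGibbs d β h μ)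
    (B S : Finset (Site d)) (hBS : Disjoint B S) (hB : ∀ i ∈ B, ∀ j ∈ nbrs i, j ∈ B ∨ j ∈ S)
    (x : Site d) (hx : x ∈ B) (ω : Config d) :
    (μ ({σ | σ x = true} ∩ cyl S ω) / μ (cyl S ω)).toReal = localDensity β h B (fplus x) ω := by
  have hpos := cyl_pos β h μ hG S ω
  obtain ⟨hP, hG⟩ := hG
  have hm := measurable_cyl S ω
  have hA : MeasurableSet {σ : Config d | σ x = true} :=
    (measurable_pi_apply x : Measurable fun σ : Config d => σ x) (MeasurableSet.singleton true)
  set f : Config d → ℝ := ({σ | σ x = true} ∩ cyl S ω).indicator (fun _ => 1) with hf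
  have hfm : Measurable f := measurable_const.indicator (hA.inter hm)
  have h1 := hG B f hfm ⟨1, fun σ => by
    simp only [hf, Set.indicator]; split_ifs <;> simp⟩
  have h2 : ∀ ω', localDensity β h B f ω' =
      (cyl S ω).indicator (fun _ => localDensity β h B (fplus x) ω) ω' := by
    intro ω'
    have hpc : ∀ η, patch B η ω' ∈ cyl S ω ↔ ω' ∈ cyl S ω := by
      intro η
      have : ∀ j ∈ S, patch B η ω' j = ω' j := fun j hj => by
        have : j ∉ B := fun h => Finset.disjoint_left.mp hBS h hj
        simp [patch, this]
      unfold cyl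
      exact ⟨fun h j hj => by rw [← this j hj]; exact h j hj,
        fun h j hj => by rw [this j hj]; exact h j hj⟩
    by_cases hω : ω' ∈ cyl S ω
    · rw [Set.indicator_of_mem hω]
      have hH : ∀ η, hamElem β h B (patch B η ω') ω' = hamElem β h B (patch B η ω) ω := fun η =>
        ham_congr β h B _ _ _ _ (fun i hi => by simp [patch, hi])
          (fun i hi j hj hjB => hω j ((hB i hi j hj).resolve_left hjB))
      have hff : ∀ η, f (patch B η ω') = fplus x (patch B η ω) := fun η => by
        have e : patch B η ω' x = patch B η ω x := by simp [patch, hx]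
        simp only [hf, Set.indicator, Set.mem_inter_iff, Set.mem_setOf_eq, (hpc η).mpr hω,
          and_true, fplus, e]
      unfold localDensity
      simp only [hH, hff]
    · rw [Set.indicator_of_notMem hω]
      unfold localDensity
      have hff : ∀ η, f (patch B η ω') = 0 := fun η => by
        simp only [hf]
        refine Set.indicator_of_notMem (fun h => hω ((hpc η).mp h.2)) _
      simp [hff]
  rw [hf, integral_indicator_const _ (hA.inter hm), ← hf] at h1
  simp_rw [h2] at h1
  rw [integral_indicator_const _ hm] at h1
  simp only [smul_eq_mul, mul_one, Measure.real] at h1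
  rw [ENNReal.toReal_div, h1, mul_comm, mul_div_assoc, div_self, mul_one]
  exact (ENNReal.toReal_pos hpos.ne' (measure_ne_top _ _)).ne'

theorem measurable_cylEvents {d : ℕ} (S : Finset (Site d)) (ω : Config d) :
    MeasurableSet[cylEvents (S : Set (Site d))] (cyl S ω) := by
  refine ⟨{τ | ∀ j, τ j = ω j.1}, ?_, ?_⟩
  · have : {τ : ((S : Set (Site d)) : Type) → Bool | ∀ j, τ j = ω j.1} =
        ⋂ j, (fun τ => τ j) ⁻¹' {ω j.1} := by ext; simp
    rw [this]
    exact MeasurableSet.iInter fun j => measurable_pi_apply j (MeasurableSet.singleton _)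
  · ext σ; simp [cyl]

/-- uniform closeness of finite-volume expectations -/
theorem lat_bound {d : ℕ} (β h : ℝ) (μ : Measure (Config d)) (hG : IsGibbs d β h μ)
    (hWM : WeakMixing d μ) : ∃ C c : ℝ, 0 ≤ C ∧ 0 < c ∧ ∀ (x : Site d), ∃ m : ℝ,
    ∀ (B S : Finset (Site d)), Disjoint B S → (∀ i ∈ B, ∀ j ∈ nbrs i, j ∈ B ∨ j ∈ S) →
    x ∈ B → ∀ (l : ℝ), (∀ j ∈ S, l ≤ dist1 x j) → ∀ ω,
    |localDensity β h B (fplus x) ω - m| ≤ C * (S.card * Real.exp (-c * l)) := by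
  obtain ⟨C, hC, c, hc, hw⟩ := hWM
  refine ⟨C, c, hC, hc, fun x => ⟨(μ {σ | σ x = true}).toReal, fun B S hBS hB hx l hl ω => ?_⟩⟩
  have hpos := cyl_pos β h μ hG S ω
  have h1 := hw (({x} : Finset (Site d)) : Set (Site d)) (S : Set (Site d)) {σ | σ x = true}
    (cyl S ω) (by
      have := measurable_cylEvents ({x} : Finset (Site d)) (fun _ => true)
      convert this using 1
      ext σ; simp [cyl]) (measurable_cylEvents S ω) hpos
  rw [cond_eq β h μ hG B S hBS hB x hx ω] at h1
  have h2 : ∑' (i : (({x} : Finset (Site d)) : Set (Site d))) (j : (S : Set (Site d))),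
      ENNReal.ofReal (Real.exp (-c * dist1 i.val j.val)) ≤
      ENNReal.ofReal (S.card * Real.exp (-c * l)) := by
    rw [tsum_fintype]
    have h3 : ∀ i ∈ (Finset.univ : Finset (({x} : Finset (Site d)) : Set (Site d))),
        ∑' (j : (S : Set (Site d))), ENNReal.ofReal (Real.exp (-c * dist1 i.val j.val)) ≤
        ENNReal.ofReal (S.card * Real.exp (-c * l)) := by
      intro i _
      have hi : i.val = x := by simpa using i.2
      rw [hi, tsum_fintype, ← ENNReal.ofReal_sum_of_nonneg (fun _ _ => (Real.exp_pos _).le)]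
      refine ENNReal.ofReal_le_ofReal ?_
      have h4 := Finset.sum_le_card_nsmul (Finset.univ : Finset (S : Set (Site d)))
        (fun j => Real.exp (-c * dist1 x j.val)) (Real.exp (-c * l)) (fun j _ => by
          rw [Real.exp_le_exp]
          have := hl j.1 (by simp)
          nlinarith)
      simpa using h4
    refine (Finset.sum_le_card_nsmul _ _ _ h3).trans (le_of_eq ?_)
    simp
  have h5 := h1.trans (mul_le_mul_right h2 _)
  rw [← ENNReal.ofReal_mul hC] at h5
  exact (ENNReal.ofReal_le_ofReal_iff (by positivity)).mp h5

/-- sweep dynamics in a box converges uniformly to a constant -/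
theorem box_sweep {d : ℕ} (β h : ℝ) (B : Finset (Site d)) (w : List (Site d)) (hw : w.Nodup)
    (hwB : ∀ y, y ∈ w ↔ y ∈ B) (δ : ℝ) (hδ : 0 ≤ δ)
    (h0 : ∀ k ≤ Fintype.card (Fin d × Bool), δ ≤ sg (Fintype.card (Fin d × Bool)) β h k)
    (x : Site d) (n : ℕ) (ω : Config d) :
    |(Tw nbr (sg (Fintype.card (Fin d × Bool)) β h) w)^[n] (fplus x) ω -
      localDensity β h B (fplus x) ω| ≤ (1 - δ ^ B.card) ^ n := by
  have X := revW_box β h B ω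
  have e1 : (w.attach.map (fun y => (⟨y.1, (hwB y.1).mp y.2⟩ : {x // x ∈ B}))).map Subtype.val = w := by
    rw [List.map_map]
    exact List.attach_map_subtype_val w
  have h1 := X.conv δ hδ h0 (fun k _ => (sg_lt_one _ _ _ _).le)
    (w.attach.map (fun y => (⟨y.1, (hwB y.1).mp y.2⟩ : {x // x ∈ B})))
    (fun j => List.mem_map.mpr ⟨⟨j.1, (hwB _).mpr j.2⟩, List.mem_attach _ _, rfl⟩)
    (fun η η' v hv => by
      have : v ∉ B := fun h => hv ⟨⟨v, h⟩, rfl⟩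
      simp [patch, this]) (fplus x) 0 1 (fplus_bd x) n (fun j => ω j.1)
  have e2 : patch B (fun j => ω j.1) ω = ω := by
    ext i; by_cases hi : i ∈ B <;> simp [patch, hi]
  have e3 : w.length = B.card := by
    rw [← List.toFinset_card_of_nodup hw]
    congr 1
    ext y; simp [hwB]
  rw [e1, e2] at h1
  simp only [List.length_map, List.length_attach, sub_zero, mul_one, e3] at h1
  unfold localDensity
  simpa only [mul_comm] using h1

end Lattice
end IsingA
end

section
open MeasureTheory Filter
open IsingP

namespace IsingA

section Torus
set_option linter.unusedSectionVars false
variable {d n : ℕ} [NeZero n]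

/-- torus energy with general side -/
noncomputable def tE (d n : ℕ) [NeZero n] (β h : ℝ) (σ : (Fin d → ZMod n) → Bool) : ℝ :=
  β * ∑ i : Fin d → ZMod n, ∑ k : Fin d,
      spin (σ i) * spin (σ (fun l => i l + if l = k then 1 else 0))
    + h * ∑ i : Fin d → ZMod n, spin (σ i)

theorem nbr_not {A : Type*} [Ring A] (x : Fin d → A) (k : Fin d) (b : Bool) :
    nbr (nbr x (k, b)) (k, !b) = x := by
  ext l
  by_cases hl : l = k
  · subst hl; cases b <;> simp [nbr]
  · simp [nbr, hl]

theorem nbr_true {A : Type*} [Ring A] (x : Fin d → A) (k : Fin d) :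
    nbr x (k, true) = fun l => x l + if l = k then 1 else 0 := by
  ext l
  by_cases hl : l = k <;> simp [nbr, hl]

theorem nbr_iff {A : Type*} [Ring A] (x y : Fin d → A) (k : Fin d) (b : Bool) :
    nbr x (k, b) = y ↔ nbr y (k, !b) = x := by
  constructor
  · rintro rfl; exact nbr_not x k b
  · rintro rfl
    have := nbr_not y k (!b)
    rwa [Bool.not_not] at this

theorem nbr_ne_torus (hn : 2 ≤ n) (x : Fin d → ZMod n) (q) : nbr x q ≠ x := by
  haveI : Fact (1 < n) := ⟨hn⟩
  intro h
  have h1 := congrFun h q.1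
  simp only [nbr, if_true] at h1
  rcases q with ⟨k, b⟩
  cases b <;> simp at h1

theorem tE_sym (β h : ℝ) (σ : (Fin d → ZMod n) → Bool) : tE d n β h σ =
    β * (2⁻¹ * ∑ i, ∑ j, (∑ q, if nbr i q = j then (1 : ℝ) else 0) * (spin (σ i) * spin (σ j)))
      + h * ∑ i, spin (σ i) := by
  unfold tE
  congr 2
  have h1 : ∀ i : Fin d → ZMod n, ∑ j, (∑ q, if nbr i q = j then (1 : ℝ) else 0) *
      (spin (σ i) * spin (σ j)) = ∑ q, spin (σ i) * spin (σ (nbr i q)) := by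
    intro i
    simp_rw [Finset.sum_mul, ite_mul, one_mul, zero_mul]
    rw [Finset.sum_comm]
    simp
  simp_rw [h1, Fintype.sum_prod_type, Fintype.sum_bool, Finset.sum_add_distrib]
  have h2 : ∑ i : Fin d → ZMod n, ∑ k, spin (σ i) * spin (σ (nbr i (k, false))) =
      ∑ i : Fin d → ZMod n, ∑ k, spin (σ i) * spin (σ (nbr i (k, true))) := by
    rw [Finset.sum_comm]
    rw [Finset.sum_comm (f := fun (i : Fin d → ZMod n) k => spin (σ i) * spin (σ (nbr i (k, true))))]
    refine Finset.sum_congr rfl fun k _ => ?_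
    let e : (Fin d → ZMod n) ≃ (Fin d → ZMod n) :=
      ⟨fun i => nbr i (k, false), fun i => nbr i (k, true), fun i => nbr_not i k false,
        fun i => nbr_not i k true⟩
    rw [← Equiv.sum_comp e (fun i => spin (σ i) * spin (σ (nbr i (k, true))))]
    refine Finset.sum_congr rfl fun i _ => ?_
    have : nbr (nbr i (k, false)) (k, true) = i := nbr_not i k false
    simp only [e, Equiv.coe_fn_mk, this]
    ring
  rw [h2]
  simp_rw [nbr_true]
  ring

theorem tE_diff (hn : 2 ≤ n) (β h : ℝ) (η : (Fin d → ZMod n) → Bool) (x : Fin d → ZMod n) :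
    tE d n β h (Function.update η x true) - tE d n β h (Function.update η x false) =
      2 * (β * (2 * (cnt nbr η x : ℝ) - (Fintype.card (Fin d × Bool) : ℕ)) + h) := by
  set a : (Fin d → ZMod n) → ℝ := fun i => spin (Function.update η x true i) with ha
  set a' : (Fin d → ZMod n) → ℝ := fun i => spin (Function.update η x false i) with ha'
  have haa : ∀ i, i ≠ x → a i = a' i := fun i hi => by
    simp [ha, ha', Function.update_of_ne hi]
  have hax : a x = 1 := by simp [ha, spin]
  have hax' : a' x = -1 := by simp [ha', spin]
  have hd := quad_diff Finset.univ (fun i j : Fin d → ZMod n => ∑ q, if nbr i q = j then (1 : ℝ) else 0)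
    (fun i j => by
      simp_rw [Fintype.sum_prod_type, Fintype.sum_bool]
      refine Finset.sum_congr rfl fun k _ => ?_
      have e1 := nbr_iff i j k true
      have e2 := nbr_iff i j k false
      simp only [Bool.not_true, Bool.not_false] at e1 e2
      simp only [e1, e2]
      ring) x (Finset.mem_univ _) (by simp [nbr_ne_torus hn]) a a' haa
  have e1 : ∑ j, (∑ q, if nbr x q = j then (1 : ℝ) else 0) * a j =
      2 * (cnt nbr η x : ℝ) - (Fintype.card (Fin d × Bool) : ℕ) := by
    rw [← spin_sum_cnt]
    simp_rw [Finset.sum_mul, ite_mul, one_mul, zero_mul]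
    rw [Finset.sum_comm]
    simp [ha, Function.update_of_ne (nbr_ne_torus hn x _)]
  rw [e1, hax, hax'] at hd
  have h3 : ∑ i, a i - ∑ i, a' i = 2 := by
    rw [← Finset.add_sum_erase Finset.univ _ (Finset.mem_univ x),
      ← Finset.add_sum_erase Finset.univ a' (Finset.mem_univ x),
      Finset.sum_congr rfl (fun i hi => haa i (Finset.ne_of_mem_erase hi)), hax, hax']
    ring
  rw [tE_sym, tE_sym]
  linear_combination β * 2⁻¹ * hd + h * h3

theorem revW_torus (hn : 2 ≤ n) (β h : ℝ) :
    RevW (nbr (d := d) (A := ZMod n)) (sg (Fintype.card (Fin d × Bool)) β h)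
      (fun η : (Fin d → ZMod n) → Bool => η) id (fun η => Real.exp (tE d n β h η)) where
  hnb := nbr_ne_torus hn
  hemb η j b := rfl
  pos η := Real.exp_pos _
  bal η j := sg_bal _ _ _ _ _ _ (tE_diff hn β h η j)

end Torus

section Lift
set_option linter.unusedSectionVars false
variable {d n L : ℕ} [NeZero n] [NeZero L] (ρ : ZMod n →+* ZMod L)

/-- off the corridors -/
def nonC (s : Fin d → ZMod L) (x : Fin d → ZMod n) : Prop := ∀ k, ρ (x k) ≠ s k

/-- the chart of a tile -/
def chart (c : Fin d → ZMod n) (i : Site d) : Fin d → ZMod n := fun k => c k + (i k : ZMod n)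

/-- open and closed boxes -/
noncomputable def boxO (d L : ℕ) : Finset (Site d) := Fintype.piFinset fun _ => Finset.Ioo 0 (L : ℤ)
/-- open and closed boxes -/
noncomputable def boxC (d L : ℕ) : Finset (Site d) := Fintype.piFinset fun _ => Finset.Icc 0 (L : ℤ)

theorem mem_boxO (i : Site d) : i ∈ boxO d L ↔ ∀ k, 0 < i k ∧ i k < L := by
  simp [boxO, Fintype.mem_piFinset]
theorem mem_boxC (i : Site d) : i ∈ boxC d L ↔ ∀ k, 0 ≤ i k ∧ i k ≤ L := by
  simp [boxC, Fintype.mem_piFinset]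

theorem boxO_sub : boxO d L ⊆ boxC d L := fun i hi => by
  rw [mem_boxO] at hi; rw [mem_boxC]
  exact fun k => ⟨(hi k).1.le, (hi k).2.le⟩

theorem chart_nbr (c : Fin d → ZMod n) (i : Site d) (q) : chart c (nbr i q) = nbr (chart c i) q := by
  ext k
  rcases q with ⟨l, b⟩
  by_cases hk : k = l
  · subst hk; cases b <;> simp [chart, nbr] <;> ring
  · simp [chart, nbr, hk]

theorem nbr_boxC (i : Site d) (hi : i ∈ boxO d L) (q) : nbr i q ∈ boxC d L := by
  rw [mem_boxO] at hi; rw [mem_boxC]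
  intro k
  have := hi k
  rcases q with ⟨l, b⟩
  by_cases hk : k = l
  · cases b <;> simp only [nbr, hk, if_true] <;> simp <;> subst hk <;> omega
  · simp only [nbr, hk, if_false]; omega

theorem chart_nonC (s : Fin d → ZMod L) (c : Fin d → ZMod n) (hc : ∀ k, ρ (c k) = s k) (i : Site d)
    (hi : i ∈ boxC d L) : nonC ρ s (chart c i) ↔ i ∈ boxO d L := by
  rw [mem_boxC] at hi
  unfold nonC
  rw [mem_boxO]
  refine forall_congr' fun k => ?_
  have h1 : ρ (chart c i k) ≠ s k ↔ ¬ ((L : ℤ) ∣ i k) := by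
    rw [← ZMod.intCast_zmod_eq_zero_iff_dvd]
    unfold chart
    rw [map_add, hc, map_intCast]
    simp
  rw [h1]
  have := hi k
  have hL : 0 < (L : ℤ) := by exact_mod_cast Nat.pos_of_ne_zero (NeZero.ne L)
  constructor
  · intro h
    refine ⟨lt_of_le_of_ne this.1 fun h0 => h (by rw [← h0]; exact dvd_zero _),
      lt_of_le_of_ne this.2 fun h0 => h (by rw [h0])⟩
  · rintro ⟨h2, h3⟩ h4
    have := Int.le_of_dvd h2 h4
    omega

theorem chart_inj (hLn : L ≤ n) (c : Fin d → ZMod n) (i j : Site d) (hi : i ∈ boxO d L)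
    (hj : j ∈ boxC d L) (h : chart c i = chart c j) : i = j := by
  rw [mem_boxO] at hi; rw [mem_boxC] at hj
  ext k
  have h1 := congrFun h k
  unfold chart at h1
  have h2 : ((i k - j k : ℤ) : ZMod n) = 0 := by
    push_cast
    rw [sub_eq_zero]
    exact add_left_cancel h1
  rw [ZMod.intCast_zmod_eq_zero_iff_dvd] at h2
  have hik := hi k
  have hjk := hj k
  have hL' : (L : ℤ) ≤ n := by exact_mod_cast hLn
  have h3 := Int.eq_zero_of_abs_lt_dvd h2 (by rw [abs_lt]; omega)
  omega

/-- `f` on the torus is represented by `f'` on the lattice through the chart -/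
def Loc (c : Fin d → ZMod n) (L : ℕ) (f : ((Fin d → ZMod n) → Bool) → ℝ) (f' : Config d → ℝ) : Prop :=
  ∀ (η : (Fin d → ZMod n) → Bool) (ω : Config d), (∀ i ∈ boxC d L, ω i = η (chart c i)) → f η = f' ω

theorem Loc_word (hLn : L ≤ n) (p : ℕ → ℝ) (s : Fin d → ZMod L) (c : Fin d → ZMod n)
    (hc : ∀ k, ρ (c k) = s k) (w : List (Fin d → ZMod n)) (hw : w.Nodup)
    (hns : ∀ x ∈ w, nonC ρ s x) :
    ∃ w' : List (Site d), w'.Nodup ∧ (∀ y, y ∈ w' ↔ y ∈ boxO d L ∧ chart c y ∈ w) ∧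
      ∀ f f', Loc c L f f' → Loc c L (Tw nbr p w f) (Tw nbr p w' f') := by
  induction w with
  | nil => exact ⟨[], List.nodup_nil, by simp, fun f f' h => h⟩
  | cons x w ih =>
    rw [List.nodup_cons] at hw
    obtain ⟨w', h1, h2, h3⟩ := ih hw.2 (fun y hy => hns y (by simp [hy]))
    by_cases hx : ∃ y ∈ boxO d L, chart c y = x
    · obtain ⟨y, hy, rfl⟩ := hx
      refine ⟨y :: w', ?_, ?_, ?_⟩
      · rw [List.nodup_cons]
        exact ⟨fun h => hw.1 ((h2 y).mp h).2, h1⟩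
      · intro z
        simp only [List.mem_cons, h2]
        constructor
        · rintro (rfl | ⟨h4, h5⟩)
          · exact ⟨hy, Or.inl rfl⟩
          · exact ⟨h4, Or.inr h5⟩
        · rintro ⟨h4, h5 | h5⟩
          · exact Or.inl (chart_inj hLn c z y h4 (boxO_sub hy) h5)
          · exact Or.inr ⟨h4, h5⟩
      · intro f f' hf η ω hω
        have h4 := h3 f f' hf
        rw [Tw_cons, Tw_cons]
        unfold ks
        have e1 : cnt nbr η (chart c y) = cnt nbr ω y := by
          unfold cnt
          congr 1
          ext q
          simp only [Finset.mem_filter, Finset.mem_univ, true_and]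
          rw [← chart_nbr, hω _ (nbr_boxC y hy q)]
        have e2 : ∀ b, Tw nbr p w f (Function.update η (chart c y) b) =
            Tw nbr p w' f' (Function.update ω y b) := by
          intro b
          refine h4 _ _ fun i hi => ?_
          by_cases hiy : i = y
          · subst hiy; simp
          · have : chart c i ≠ chart c y := fun h =>
              hiy (chart_inj hLn c y i hy hi h.symm).symm
            rw [Function.update_of_ne hiy, Function.update_of_ne this, hω i hi]
        rw [e1, e2, e2]
    · refine ⟨w', h1, ?_, ?_⟩
      · intro z
        rw [h2]
        refine and_congr_right fun hz => ?_
        simp only [List.mem_cons]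
        constructor
        · exact Or.inr
        · rintro (h | h)
          · exact absurd ⟨z, hz, h⟩ hx
          · exact h
      · intro f f' hf η ω hω
        have h4 := h3 f f' hf
        rw [Tw_cons]
        unfold ks
        have e2 : ∀ b, Tw nbr p w f (Function.update η x b) = Tw nbr p w' f' ω := by
          intro b
          refine h4 _ _ fun i hi => ?_
          have : chart c i ≠ x := fun h => by
            have h5 := hns x (by simp)
            rw [← h] at h5
            exact hx ⟨i, (chart_nonC ρ s c hc i hi).mp h5, h⟩
          rw [Function.update_of_ne this, hω i hi]
        rw [e2, e2]; ring

/-- one stage is close to constant -/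
theorem stage_bound (hLn : L ≤ n) (β h : ℝ) (s : Fin d → ZMod L) (c : Fin d → ZMod n)
    (hc : ∀ k, ρ (c k) = s k) (w : List (Fin d → ZMod n)) (hw : w.Nodup)
    (hws : ∀ x, x ∈ w ↔ nonC ρ s x) (δ : ℝ) (hδ : 0 ≤ δ)
    (h0 : ∀ k ≤ Fintype.card (Fin d × Bool), δ ≤ sg (Fintype.card (Fin d × Bool)) β h k)
    (y : Site d) (hy : y ∈ boxO d L) (m e : ℝ)
    (hm : ∀ ω, |localDensity β h (boxO d L) (fplus y) ω - m| ≤ e) (N : ℕ)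
    (η : (Fin d → ZMod n) → Bool) :
    |(Tw nbr (sg (Fintype.card (Fin d × Bool)) β h) w)^[N] (fplus (chart c y)) η - m| ≤
      e + (1 - δ ^ (boxO d L).card) ^ N := by
  obtain ⟨w', h1, h2, h3⟩ := Loc_word ρ hLn (sg (Fintype.card (Fin d × Bool)) β h) s c hc w hw
    (fun x hx => (hws x).mp hx)
  have h4 : ∀ z, z ∈ w' ↔ z ∈ boxO d L := by
    intro z
    rw [h2]
    refine and_iff_left_of_imp fun hz => ?_
    rw [hws, chart_nonC ρ s c hc z (boxO_sub hz)]
    exact hz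
  have h5 : Loc c L (fplus (chart c y)) (fplus y) := by
    intro η ω hω
    unfold fplus
    rw [hω y (boxO_sub hy)]
  have h6 : ∀ N : ℕ, Loc c L ((Tw nbr (sg (Fintype.card (Fin d × Bool)) β h) w)^[N] (fplus (chart c y)))
      ((Tw nbr (sg (Fintype.card (Fin d × Bool)) β h) w')^[N] (fplus y)) := by
    intro N
    induction N with
    | zero => exact h5
    | succ N ih =>
      rw [Function.iterate_succ_apply', Function.iterate_succ_apply']
      exact h3 _ _ ih
  rw [h6 N η (fun i => η (chart c i)) (fun i _ => rfl)]
  have h7 := box_sweep β h (boxO d L) w' h1 h4 δ hδ h0 y N (fun i => η (chart c i))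
  have h8 := hm (fun i => η (chart c i))
  have := abs_sub_le ((Tw nbr (sg (Fintype.card (Fin d × Bool)) β h) w')^[N] (fplus y)
    (fun i => η (chart c i))) (localDensity β h (boxO d L) (fplus y) (fun i => η (chart c i))) m
  linarith

/-- the lattice estimate in the standard boxes -/
theorem box_bound (β h : ℝ) (μ : Measure (Config d)) (hG : IsGibbs d β h μ)
    (hWM : WeakMixing d μ) : ∃ C c : ℝ, 0 ≤ C ∧ 0 < c ∧ ∀ (l : ℕ), 0 < l → ∀ y : Site d,
    (∀ k, (l : ℤ) ≤ y k ∧ y k ≤ 3 * l) → ∃ m : ℝ, ∀ ω,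
    |localDensity β h (boxO d (4 * l)) (fplus y) ω - m| ≤
      C * ((4 * l + 1 : ℝ) ^ d * Real.exp (-c * l)) := by
  obtain ⟨C, c, hC, hc, hb⟩ := lat_bound β h μ hG hWM
  refine ⟨C, c, hC, hc, fun l hl y hy => ?_⟩
  haveI : NeZero (4 * l) := ⟨by omega⟩
  obtain ⟨m, hm⟩ := hb y
  refine ⟨m, fun ω => ?_⟩
  have h1 := hm (boxO d (4 * l)) (boxC d (4 * l) \ boxO d (4 * l)) Finset.disjoint_sdiff
    (fun i hi j hj => by
      rw [nbrs_eq, Finset.mem_image] at hj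
      obtain ⟨q, _, rfl⟩ := hj
      by_cases h : nbr i q ∈ boxO d (4 * l)
      · exact Or.inl h
      · exact Or.inr (Finset.mem_sdiff.mpr ⟨nbr_boxC i hi q, h⟩))
    (by rw [mem_boxO]; intro k; have := hy k; push_cast; omega) l (fun j hj => by
      rw [Finset.mem_sdiff, mem_boxC, mem_boxO] at hj
      obtain ⟨h2, h3⟩ := hj
      push Not at h3
      obtain ⟨k, hk⟩ := h3
      have h4 : (l : ℤ) ≤ |y k - j k| := by
        have h5 := h2 k
        have h6 := hy k
        push_cast at *
        rw [le_abs]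
        by_cases h7 : 0 < j k
        · have := hk h7; omega
        · omega
      unfold dist1
      have h5 : (l : ℤ) ≤ ∑ k, |y k - j k| :=
        h4.trans (Finset.single_le_sum (f := fun k => |y k - j k|) (fun _ _ => abs_nonneg _) (Finset.mem_univ k))
      exact_mod_cast h5) ω
  refine h1.trans ?_
  gcongr
  have : (boxC d (4 * l)).card = (4 * l + 1) ^ d := by
    simp [boxC, Fintype.card_piFinset]
    congr 1
  have h2 : (boxC d (4 * l) \ boxO d (4 * l)).card ≤ (4 * l + 1) ^ d := by
    rw [← this]; exact Finset.card_le_card Finset.sdiff_subset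
  exact_mod_cast h2

end Lift
end IsingA
end

section
open MeasureTheory Filter
open IsingP

namespace IsingA

section Near
set_option linter.unusedSectionVars false
variable {d n L : ℕ} [NeZero n] [NeZero L] (ρ : ZMod n →+* ZMod L)

/-- sup-distance at most `r` on the torus -/
def near (r : ℕ) (y z : Fin d → ZMod n) : Prop := ∃ i : Site d, (∀ k, |i k| ≤ r) ∧ z = chart y i

theorem near_self (r : ℕ) (y : Fin d → ZMod n) : near r y y := ⟨0, by simp, by ext; simp [chart]⟩

theorem near_trans {r r' : ℕ} {x y z : Fin d → ZMod n} (h : near r x y) (h' : near r' y z) :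
    near (r' + r) x z := by
  obtain ⟨i, hi, rfl⟩ := h
  obtain ⟨j, hj, rfl⟩ := h'
  refine ⟨i + j, fun k => ?_, ?_⟩
  · have := abs_add_le (i k) (j k)
    have := hi k
    have := hj k
    simp only [Pi.add_apply]
    push_cast
    linarith
  · ext k; simp [chart, add_assoc]

variable {I : Type*} [Fintype I] [DecidableEq I] (st : I → Fin d → ZMod n)

theorem run_agree (s : Fin d → ZMod L) (c : Fin d → ZMod n) (hc : ∀ k, ρ (c k) = s k)
    (l : List I) (hl : ∀ p ∈ l, nonC ρ s (st p)) {t : ℕ} (U U' : I → Fin t)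
    (hU : ∀ p ∈ l, (∃ i ∈ boxC d L, st p = chart c i) → U p = U' p)
    (η η' : (Fin d → ZMod n) → Bool) (hη : ∀ i ∈ boxC d L, η (chart c i) = η' (chart c i)) :
    ∀ i ∈ boxC d L, run nbr st l U η (chart c i) = run nbr st l U' η' (chart c i) := by
  induction l generalizing η η' with
  | nil => exact hη
  | cons p l ih =>
    refine ih (fun q hq => hl q (by simp [hq])) (fun q hq => hU q (by simp [hq])) _ _ ?_
    intro i hi
    simp only [upd]
    by_cases h : chart c i = st p
    · rw [← h, Function.update_self, Function.update_self]
      have h1 := hl p (by simp)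
      rw [← h, chart_nonC ρ s c hc i hi] at h1
      have h2 : cnt nbr η (chart c i) = cnt nbr η' (chart c i) := cnt_congr _ _ fun q => by
        rw [← chart_nbr]; exact hη _ (nbr_boxC i h1 q)
      rw [h2, hU p (by simp) ⟨i, hi, h.symm⟩]
    · rw [Function.update_of_ne h, Function.update_of_ne h]
      exact hη i hi

theorem exists_chart (hρ : Function.Surjective ρ) (s : Fin d → ZMod L) (y : Fin d → ZMod n) :
    ∃ (c : Fin d → ZMod n) (i : Site d), (∀ k, ρ (c k) = s k) ∧ i ∈ boxC d L ∧ y = chart c i := by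
  refine ⟨fun k => y k - ((ρ (y k) - s k).val : ℤ), fun k => ((ρ (y k) - s k).val : ℤ), ?_, ?_, ?_⟩
  · intro k; simp
  · rw [mem_boxC]; intro k
    have := ZMod.val_lt (ρ (y k) - s k)
    constructor <;> omega
  · ext k; simp [chart]

theorem run_stage (hρ : Function.Surjective ρ) (s : Fin d → ZMod L)
    (l : List I) (hl : ∀ p ∈ l, nonC ρ s (st p)) {t : ℕ} (U U' : I → Fin t)
    (η η' : (Fin d → ZMod n) → Bool) (y : Fin d → ZMod n)
    (hU : ∀ p, near L y (st p) → U p = U' p)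
    (hη : ∀ z, near L y z → η z = η' z) :
    run nbr st l U η y = run nbr st l U' η' y := by
  obtain ⟨c, i, hc, hi, rfl⟩ := exists_chart ρ hρ s y
  have hn : ∀ j ∈ boxC d L, near L (chart c i) (chart c j) := by
    intro j hj
    refine ⟨j - i, fun k => ?_, ?_⟩
    · rw [mem_boxC] at hi hj
      have := hi k; have := hj k
      simp only [Pi.sub_apply, abs_le]; omega
    · ext k; simp [chart]
  refine run_agree ρ st s c hc l hl U U' (fun p _ ⟨j, hj, h⟩ => hU p (h ▸ hn j hj)) η η'
    (fun j hj => hη _ (hn j hj)) i hi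

theorem run_stages (hρ : Function.Surjective ρ) (ss : List (List I))
    (hss : ∀ l ∈ ss, ∃ s, ∀ p ∈ l, nonC ρ s (st p)) {t : ℕ} (U U' : I → Fin t)
    (η η' : (Fin d → ZMod n) → Bool) (y : Fin d → ZMod n)
    (hU : ∀ p, near (L * ss.length) y (st p) → U p = U' p)
    (hη : ∀ z, near (L * ss.length) y z → η z = η' z) :
    run nbr st ss.flatten U η y = run nbr st ss.flatten U' η' y := by
  induction ss generalizing η η' y with
  | nil => exact hη y (near_self _ _)
  | cons l ss ih =>
    rw [List.flatten_cons, run_append, run_append]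
    have hle : ∀ z, near (L * ss.length) y z → near (L * (l :: ss).length) y z := by
      rintro z ⟨i, hi, h⟩
      refine ⟨i, fun k => (hi k).trans ?_, h⟩
      rw [List.length_cons]; push_cast; nlinarith
    refine ih (fun l hl => hss l (by simp [hl])) _ _ _ (fun p hp => hU p (hle _ hp)) ?_
    intro z hz
    obtain ⟨s, hs⟩ := hss l (by simp)
    have h2 : ∀ x, near L z x → near (L * (l :: ss).length) y x := by
      intro x hx
      have := near_trans hz hx
      rwa [List.length_cons, Nat.mul_succ, add_comm]
    exact run_stage ρ st hρ s l hs U U' η η' z (fun p hp => hU p (h2 _ hp))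
      (fun x hx => hη x (h2 _ hx))

end Near

section Cells
set_option linter.unusedSectionVars false
variable {d L M : ℕ} [NeZero (L * M)] [NeZero L] [NeZero M]

/-- the block of a site -/
def cellOf (L M : ℕ) (x : Fin d → ZMod (L * M)) : Fin d → ZMod M := fun k => (((x k).val / L : ℕ) : ZMod M)

theorem cell_int (a : ℤ) (x : ZMod (L * M)) (h : x = (a : ZMod (L * M))) :
    (((x.val / L : ℕ) : ZMod M)) = ((a / (L : ℤ) : ℤ) : ZMod M) := by
  have h1 : ((x.val : ℤ) : ZMod (L * M)) = (a : ZMod (L * M)) := by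
    rw [← h]; simp
  rw [ZMod.intCast_eq_intCast_iff] at h1
  obtain ⟨t, ht⟩ := h1.dvd
  have hL : (L : ℤ) ≠ 0 := by exact_mod_cast NeZero.ne L
  have h2 : a = x.val + L * (M * t) := by push_cast at ht; linarith
  rw [h2, Int.add_mul_ediv_left _ _ hL, ← Int.natCast_div, Int.cast_add, Int.cast_natCast]
  simp

/-- neighbouring blocks -/
noncomputable def nbB (J : ℕ) (b : Fin d → ZMod M) : Finset (Fin d → ZMod M) :=
  (Fintype.piFinset fun _ : Fin d => Finset.Icc (-(J : ℤ)) J).image (fun i k => b k + (i k : ZMod M))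

theorem mem_nbB (J : ℕ) (b b' : Fin d → ZMod M) :
    b' ∈ nbB J b ↔ ∃ i : Fin d → ℤ, (∀ k, |i k| ≤ J) ∧ b' = fun k => b k + (i k : ZMod M) := by
  unfold nbB
  simp only [Finset.mem_image, Fintype.mem_piFinset, Finset.mem_Icc, ← abs_le]
  constructor
  · rintro ⟨i, h, rfl⟩; exact ⟨i, h, rfl⟩
  · rintro ⟨i, h, rfl⟩; exact ⟨i, h, rfl⟩

theorem card_nbB (J : ℕ) (b : Fin d → ZMod M) : (nbB J b).card ≤ (2 * J + 1) ^ d := by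
  refine Finset.card_image_le.trans ?_
  rw [Fintype.card_piFinset]
  simp only [Int.card_Icc, Finset.prod_const, Finset.card_univ, Fintype.card_fin]
  apply le_of_eq
  congr 1
  omega

theorem near_cell (J : ℕ) (y z : Fin d → ZMod (L * M)) (h : near (L * J) y z) :
    cellOf L M z ∈ nbB J (cellOf L M y) := by
  obtain ⟨i, hi, rfl⟩ := h
  rw [mem_nbB]
  refine ⟨fun k => ((y k).val + i k) / (L : ℤ) - (y k).val / (L : ℤ), fun k => ?_, ?_⟩
  · have := abs_le.mp (hi k)
    push_cast at this
    have hL : (0 : ℤ) < (L : ℤ) := by exact_mod_cast Nat.pos_of_ne_zero (NeZero.ne L)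
    have h1 := Int.ediv_le_ediv hL (show ((y k).val + i k : ℤ) ≤ (y k).val + L * J by linarith)
    have h2 := Int.ediv_le_ediv hL (show ((y k).val + L * (-J) : ℤ) ≤ (y k).val + i k by linarith)
    rw [Int.add_mul_ediv_left _ _ hL.ne'] at h1 h2
    rw [abs_le]
    constructor <;> linarith
  · ext k
    unfold cellOf
    rw [cell_int ((y k).val + i k) (chart y i k) (by simp [chart]),
      cell_int ((y k).val) (y k) (by simp)]
    push_cast
    ring

theorem nbB_meet (J : ℕ) (b : Fin d → ZMod M) :
    (Finset.univ.filter (fun b' => ¬ Disjoint (nbB J b) (nbB J b'))).card ≤ (4 * J + 1) ^ d := by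
  have h : Finset.univ.filter (fun b' => ¬ Disjoint (nbB J b) (nbB J b')) ⊆ nbB (2 * J) b := by
    intro b' hb'
    rw [Finset.mem_filter, Finset.not_disjoint_iff] at hb'
    obtain ⟨-, z, h1, h2⟩ := hb'
    rw [mem_nbB] at h1 h2 ⊢
    obtain ⟨i, hi, rfl⟩ := h1
    obtain ⟨j, hj, h⟩ := h2
    refine ⟨i - j, fun k => ?_, ?_⟩
    · have := abs_le.mp (hi k); have := abs_le.mp (hj k)
      rw [Pi.sub_apply, abs_le]; push_cast; constructor <;> linarith
    · ext k
      have := congrFun h k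
      simp only [Pi.sub_apply, Int.cast_sub] at this ⊢
      linear_combination -this
  refine (Finset.card_le_card h).trans ((card_nbB _ _).trans (le_of_eq ?_))
  congr 1; ring

theorem card_cell (b : Fin d → ZMod M) :
    (Finset.univ.filter (fun x : Fin d → ZMod (L * M) => cellOf L M x = b)).card ≤ L ^ d := by
  have h1 : ((Finset.univ : Finset (Fin d → Fin L))).card = L ^ d := by simp
  rw [← h1]
  have hL : 0 < L := Nat.pos_of_ne_zero (NeZero.ne L)
  refine Finset.card_le_card_of_injOn (fun x k => ⟨(x k).val % L, Nat.mod_lt _ hL⟩)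
    (fun _ _ => Finset.mem_coe.mpr (Finset.mem_univ _)) ?_
  intro x hx y hy hxy
  simp only [Finset.coe_filter, Finset.mem_univ, true_and, Set.mem_ofPred_eq] at hx hy
  ext k
  have h2 := congrFun (hx.trans hy.symm) k
  unfold cellOf at h2
  have h3 := congrFun hxy k
  simp only [Fin.mk.injEq] at h3
  have hlt : ∀ x : ZMod (L * M), x.val / L < M := fun x =>
    Nat.div_lt_of_lt_mul (ZMod.val_lt x)
  rw [ZMod.natCast_eq_natCast_iff', Nat.mod_eq_of_lt (hlt _), Nat.mod_eq_of_lt (hlt _)] at h2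
  apply ZMod.val_injective
  rw [← Nat.div_add_mod (x k).val L, ← Nat.div_add_mod (y k).val L, h2, h3]

theorem card_near {A : Type*} [Fintype A] (J : ℕ) (b : Fin d → ZMod M) :
    (Finset.univ.filter (fun p : A × (Fin d → ZMod (L * M)) => cellOf L M p.2 ∈ nbB J b)).card ≤
      Fintype.card A * ((2 * J + 1) ^ d * L ^ d) := by
  have h : Finset.univ.filter (fun p : A × (Fin d → ZMod (L * M)) => cellOf L M p.2 ∈ nbB J b) ⊆
      (Finset.univ : Finset A) ×ˢ ((nbB J b).biUnion fun b' =>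
        Finset.univ.filter (fun x : Fin d → ZMod (L * M) => cellOf L M x = b')) := by
    intro p hp
    simp only [Finset.mem_filter, Finset.mem_univ, true_and] at hp
    simp [hp]
  refine (Finset.card_le_card h).trans ?_
  rw [Finset.card_product, Finset.card_univ]
  refine Nat.mul_le_mul_left _ ?_
  refine (Finset.card_biUnion_le_card_mul _ _ _ fun b' _ => card_cell b').trans ?_
  exact Nat.mul_le_mul_right _ (card_nbB J b)

end Cells
end IsingA
end

section
open MeasureTheory Filter
open IsingP

namespace IsingA

section Word
set_option linter.unusedSectionVars false

theorem Tw_replicate {V κ R : Type*} [DecidableEq V] [Fintype κ] (nb : V → κ → V) [CommRing R]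
    (p : ℕ → R) (w : List V) (n : ℕ) (f : (V → Bool) → R) :
    Tw nb p (List.replicate n w).flatten f = (Tw nb p w)^[n] f := by
  induction n with
  | zero => rfl
  | succ n ih =>
    rw [List.replicate_succ, List.flatten_cons, Tw_append, ih, Function.iterate_succ_apply']

variable {d L M : ℕ} [NeZero (L * M)] [NeZero L] [NeZero M]

/-- reduction mod L -/
def rho (L M : ℕ) : ZMod (L * M) →+* ZMod L := ZMod.castHom (Dvd.intro M rfl) (ZMod L)

theorem rho_surj : Function.Surjective (rho L M) := ZMod.ringHom_surjective _

variable (sh : (Fin d → Bool) → Fin d → ZMod L) (nn : ℕ)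

open Classical in
/-- sites updated in a stage -/
noncomputable def sites (M : ℕ) [NeZero (L * M)] (s : Fin d → Bool) : List (Fin d → ZMod (L * M)) :=
  (Finset.univ.filter (nonC (rho L M) (sh s))).toList

theorem mem_sites (s : Fin d → Bool) (x) : x ∈ sites sh M s ↔ nonC (rho L M) (sh s) x := by
  classical
  unfold sites; rw [Finset.mem_toList]; simp

theorem sites_nodup (s : Fin d → Bool) : (sites sh M s).Nodup := by
  classical
  unfold sites; exact Finset.nodup_toList _

/-- positions of one stage -/
noncomputable def stageL (M : ℕ) [NeZero (L * M)] (s : Fin d → Bool) :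
    List (((Fin d → Bool) × Fin nn) × (Fin d → ZMod (L * M))) :=
  ((List.finRange nn).map fun i => (sites sh M s).map fun x => ((s, i), x)).flatten

/-- all stages -/
noncomputable def stages (M : ℕ) [NeZero (L * M)] :
    List (List (((Fin d → Bool) × Fin nn) × (Fin d → ZMod (L * M)))) :=
  (Finset.univ : Finset (Fin d → Bool)).toList.map (stageL sh nn M)

theorem mem_stageL (s : Fin d → Bool) (p) (hp : p ∈ stageL sh nn M s) :
    p.1.1 = s ∧ nonC (rho L M) (sh s) p.2 := by
  unfold stageL at hp
  simp only [List.mem_flatten, List.mem_map, List.mem_finRange, true_and] at hp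
  obtain ⟨l, ⟨i, rfl⟩, h⟩ := hp
  simp only [List.mem_map] at h
  obtain ⟨x, hx, rfl⟩ := h
  exact ⟨rfl, (mem_sites sh s x).mp hx⟩

theorem stageL_nodup (s : Fin d → Bool) : (stageL sh nn M s).Nodup := by
  unfold stageL
  rw [List.nodup_flatten]
  constructor
  · intro l hl
    simp only [List.mem_map] at hl
    obtain ⟨i, -, rfl⟩ := hl
    exact (sites_nodup sh s).map (fun x y h => (Prod.ext_iff.mp h).2)
  · rw [List.pairwise_map]
    refine (List.nodup_finRange nn).imp ?_
    intro i j hij p hp hq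
    simp only [List.mem_map] at hp hq
    obtain ⟨x, _, rfl⟩ := hp
    obtain ⟨y, _, h⟩ := hq
    simp only [Prod.mk.injEq] at h
    exact hij h.1.2.symm

theorem stages_nodup : (stages sh nn M).flatten.Nodup := by
  unfold stages
  rw [List.nodup_flatten]
  constructor
  · intro l hl
    simp only [List.mem_map] at hl
    obtain ⟨s, -, rfl⟩ := hl
    exact stageL_nodup sh nn s
  · rw [List.pairwise_map]
    refine (Finset.nodup_toList _).imp ?_
    intro i j hij p hp hq
    exact hij ((mem_stageL sh nn i p hp).1.symm.trans (mem_stageL sh nn j p hq).1)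

theorem stages_length : (stages sh nn M).length = 2 ^ d := by
  simp [stages]

theorem stageL_map (s : Fin d → Bool) : (stageL sh nn M s).map Prod.snd =
    (List.replicate nn (sites sh M s)).flatten := by
  unfold stageL
  rw [List.map_flatten, List.map_map]
  congr 1
  rw [List.eq_replicate_iff]
  refine ⟨by simp, fun b hb => ?_⟩
  simp only [List.mem_map] at hb
  obtain ⟨i, -, rfl⟩ := hb
  simp [List.map_map, Function.comp_def]

/-- the sweep word -/
noncomputable def sweep (M : ℕ) [NeZero (L * M)] : List (Fin d → ZMod (L * M)) :=
  (stages sh nn M).flatten.map Prod.snd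

theorem sweep_split (s : Fin d → Bool) : ∃ w1 w3, sweep sh nn M =
    w1 ++ (List.replicate nn (sites sh M s)).flatten ++ w3 := by
  obtain ⟨l1, l2, h⟩ := List.append_of_mem
    (show s ∈ (Finset.univ : Finset (Fin d → Bool)).toList by simp)
  refine ⟨((l1.map (stageL sh nn M)).flatten.map Prod.snd),
    ((l2.map (stageL sh nn M)).flatten.map Prod.snd), ?_⟩
  unfold sweep stages
  rw [h]
  simp only [List.map_append, List.map_cons, List.flatten_append, List.flatten_cons, stageL_map,
    List.append_assoc]

theorem mem_sweep (hnn : 0 < nn) (s : Fin d → Bool) (x) (h : nonC (rho L M) (sh s) x) :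
    x ∈ sweep sh nn M := by
  obtain ⟨w1, w3, h1⟩ := sweep_split (M := M) sh nn s
  rw [h1]
  simp only [List.mem_append, List.mem_flatten, List.mem_replicate]
  exact Or.inl (Or.inr ⟨_, ⟨hnn.ne', rfl⟩, (mem_sites sh s x).mpr h⟩)

/-- the local map of the sweep -/
noncomputable def swMap : LocalMap (Fin d → ZMod (L * M)) (Fin d → ZMod M)
    (((Fin d → Bool) × Fin nn) × (Fin d → ZMod (L * M))) (Fin (Fintype.card (Fin d × Bool) + 2)) where
  cell := cellOf L M
  pc p := cellOf L M p.2
  Φ U η := run nbr Prod.snd (stages sh nn M).flatten U η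
  N := nbB (2 ^ d)
  mono U := run_mono _ _ _ _
  self b := (mem_nbB _ _ _).mpr ⟨0, by simp, by simp⟩
  loc b U U' η η' hU hη v hv := by
    subst hv
    refine run_stages (rho L M) Prod.snd rho_surj _ ?_ U U' η η' v ?_ ?_
    · intro l hl
      unfold stages at hl
      simp only [List.mem_map] at hl
      obtain ⟨s, -, rfl⟩ := hl
      exact ⟨sh s, fun p hp => (mem_stageL sh nn s p hp).2⟩
    · intro p hp
      rw [stages_length] at hp
      exact hU p (near_cell _ _ _ hp)
    · intro z hz
      rw [stages_length] at hz
      exact hη z (near_cell _ _ _ hz)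
  m := (2 * 2 ^ d + 1) ^ d
  m' := (4 * 2 ^ d + 1) ^ d
  κ := Fintype.card ((Fin d → Bool) × Fin nn) * ((2 * 2 ^ d + 1) ^ d * L ^ d)
  hm b := card_nbB _ _
  hm' b := nbB_meet _ _
  hκ b := card_near _ _

theorem swMap_K (p : ℕ → ℂ) (f : ((Fin d → ZMod (L * M)) → Bool) → ℂ) :
    (swMap sh nn (M := M)).K (wt (Fintype.card (Fin d × Bool)) p) f = Tw nbr p (sweep sh nn M) f := by
  ext η
  exact Ex_run nbr p Prod.snd _ (stages_nodup sh nn) f η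

theorem dev_le (b : Fin d → ZMod M) (U) : (swMap sh nn (M := M)).dev b U ≤
    ∑ x ∈ Finset.univ.filter (fun x : Fin d → ZMod (L * M) => cellOf L M x = b),
      (fplus x (run nbr Prod.snd (stages sh nn M).flatten U (fun _ => true)) +
        (-1) * fplus x (run nbr Prod.snd (stages sh nn M).flatten U (fun _ => false))) := by
  classical
  have hmono : ∀ x : Fin d → ZMod (L * M),
      0 ≤ fplus x (run nbr Prod.snd (stages sh nn M).flatten U (fun _ => true)) +
        (-1) * fplus x (run nbr Prod.snd (stages sh nn M).flatten U (fun _ => false)) := by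
    intro x
    have := fplus_mono x (run_mono nbr Prod.snd (stages sh nn M).flatten U
      (show (fun _ => false : (Fin d → ZMod (L * M)) → Bool) ≤ fun _ => true from fun _ => Bool.false_le _))
    linarith
  unfold LocalMap.dev
  split_ifs with h
  · obtain ⟨x, hx, hne⟩ := h
    refine le_trans ?_ (Finset.single_le_sum (fun x _ => hmono x) (show x ∈ _ by
      simp only [Finset.mem_filter, Finset.mem_univ, true_and]; exact hx))
    have h1 : run nbr Prod.snd (stages sh nn M).flatten U (fun _ => false) x ≤
      run nbr Prod.snd (stages sh nn M).flatten U (fun _ => true) x := run_mono nbr Prod.snd (stages sh nn M).flatten U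
      (show (fun _ => false : (Fin d → ZMod (L * M)) → Bool) ≤ fun _ => true from fun _ => Bool.false_le _) x
    change run nbr Prod.snd (stages sh nn M).flatten U (fun _ => true) x ≠
      run nbr Prod.snd (stages sh nn M).flatten U (fun _ => false) x at hne
    unfold fplus
    revert h1 hne
    cases run nbr Prod.snd (stages sh nn M).flatten U (fun _ => true) x <;>
    cases run nbr Prod.snd (stages sh nn M).flatten U (fun _ => false) x <;> simp
  · exact Finset.sum_nonneg fun x _ => hmono x

theorem Ex_dev_le (hn : 2 ≤ L * M) (β h : ℝ) (hβ : 0 ≤ β) (a : ℝ)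
    (ha : ∀ x : Fin d → ZMod (L * M), ∃ s m, ∀ η,
      |(Tw nbr (sg (Fintype.card (Fin d × Bool)) β h) (sites sh M s))^[nn] (fplus x) η - m| ≤ a)
    (b : Fin d → ZMod M) :
    Ex (fun _ => wt (Fintype.card (Fin d × Bool)) (sg (Fintype.card (Fin d × Bool)) β h))
      ((swMap sh nn (M := M)).dev b) ≤ L ^ d * (2 * a) := by
  set p := sg (Fintype.card (Fin d × Bool)) β h with hp
  have h0 : ∀ k ≤ Fintype.card (Fin d × Bool), 0 ≤ p k := fun k _ => (sg_pos _ _ _ _).le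
  have h1 : ∀ k ≤ Fintype.card (Fin d × Bool), p k ≤ 1 := fun k _ => (sg_lt_one _ _ _ _).le
  have hm : Monotone p := sg_mono _ _ _ hβ
  refine (Ex_mono _ (fun _ => wt_nonneg _ p h0 h1 hm) _ _ (dev_le sh nn b)).trans ?_
  rw [Ex_sum]
  have hx : ∀ x : Fin d → ZMod (L * M),
      Ex (fun _ => wt (Fintype.card (Fin d × Bool)) p) (fun U =>
      (fplus x (run nbr Prod.snd (stages sh nn M).flatten U (fun _ => true)) +
        (-1) * fplus x (run nbr Prod.snd (stages sh nn M).flatten U (fun _ => false)))) ≤ 2 * a := by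
    intro x
    have e1 : Ex (fun _ => wt (Fintype.card (Fin d × Bool)) p) (fun U =>
      (fplus x (run nbr Prod.snd (stages sh nn M).flatten U (fun _ => true)) +
        (-1) * fplus x (run nbr Prod.snd (stages sh nn M).flatten U (fun _ => false)))) =
        Tw nbr p (sweep sh nn M) (fplus x) (fun _ => true) -
        Tw nbr p (sweep sh nn M) (fplus x) (fun _ => false) := by
      unfold sweep
      rw [← Ex_run nbr p Prod.snd _ (stages_nodup sh nn) (fplus x),
        ← Ex_run nbr p Prod.snd _ (stages_nodup sh nn) (fplus x)]
      unfold Ex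
      rw [← Finset.sum_sub_distrib]
      exact Finset.sum_congr rfl fun _ _ => by ring
    rw [e1]
    obtain ⟨s, m, hs⟩ := ha x
    obtain ⟨w1, w3, hw⟩ := sweep_split (M := M) sh nn s
    rw [hw]
    have := pw_stage (revW_torus hn β h) h0 h1 hm w1 (List.replicate nn (sites sh M s)).flatten w3
      (fplus x) (fplus_mono x) (m - a) (m + a) (fun η => by
        rw [Tw_replicate]
        have := abs_le.mp (hs η)
        constructor <;> linarith)
    linarith
  obtain ⟨_, m0, hm0⟩ := ha (fun _ => 0)
  have ha0 : 0 ≤ a := (abs_nonneg _).trans (hm0 fun _ => true)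
  refine (Finset.sum_le_sum fun x _ => hx x).trans ?_
  rw [Finset.sum_const, nsmul_eq_mul]
  gcongr
  exact_mod_cast card_cell b

end Word

section Shift
set_option linter.unusedSectionVars false

/-- the shifts -/
def shf (d l : ℕ) (s : Fin d → Bool) : Fin d → ZMod (4 * l) := fun k => if s k then ((2 * l : ℕ) : ZMod (4 * l)) else 0

theorem exists_good {d l M : ℕ} (hl : 0 < l) [NeZero (4 * l * M)] [NeZero (4 * l)]
    (x : Fin d → ZMod (4 * l * M)) :
    ∃ (s : Fin d → Bool) (c : Fin d → ZMod (4 * l * M)) (y : Site d),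
      (∀ k, rho (4 * l) M (c k) = shf d l s k) ∧ (∀ k, (l : ℤ) ≤ y k ∧ y k ≤ 3 * l) ∧
      x = chart c y := by
  have h : ∀ k, ∃ (b : Bool) (c : ZMod (4 * l * M)) (y : ℤ),
      rho (4 * l) M c = (if b then ((2 * l : ℕ) : ZMod (4 * l)) else 0) ∧ (l : ℤ) ≤ y ∧ y ≤ 3 * l ∧
        x k = c + (y : ZMod (4 * l * M)) := by
    intro k
    set z := rho (4 * l) M (x k) with hz
    set r := z.val with hr
    have hzr : z = ((r : ℤ) : ZMod (4 * l)) := by rw [hr]; simp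
    have hrl : r < 4 * l := ZMod.val_lt z
    have h4 : ((4 * l : ℤ) : ZMod (4 * l)) = 0 := by
      have := ZMod.natCast_self (4 * l)
      exact_mod_cast this
    have key : ∀ y : ℤ, rho (4 * l) M (x k - (y : ZMod (4 * l * M))) = ((r - y : ℤ) : ZMod (4 * l)) := by
      intro y
      rw [map_sub, map_intCast, ← hz, hzr]; push_cast; ring
    by_cases h1 : r < l
    · refine ⟨true, x k - ((r + 2 * l : ℤ) : ZMod _), r + 2 * l, ?_, by omega, by omega, by ring⟩
      rw [key]
      have : (r - (r + 2 * l) : ℤ) = 2 * l - 4 * l := by ring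
      rw [this, Int.cast_sub, h4]
      simp
    · by_cases h2 : r ≤ 3 * l
      · refine ⟨false, x k - ((r : ℤ) : ZMod _), r, ?_, by omega, by omega, by ring⟩
        rw [key]; simp
      · refine ⟨true, x k - ((r - 2 * l : ℤ) : ZMod _), r - 2 * l, ?_, by omega, by omega, by ring⟩
        rw [key]
        have : (r - (r - 2 * l) : ℤ) = 2 * l := by ring
        rw [this]
        simp
  choose b c y h1 h2 h3 h4 using h
  exact ⟨b, c, y, h1, fun k => ⟨h2 k, h3 k⟩, funext h4⟩

theorem pick_l (d : ℕ) (C c ε : ℝ) (hc : 0 < c) (hε : 0 < ε) : ∃ l : ℕ, 0 < l ∧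
    ((4 * l : ℕ) : ℝ) ^ d * (2 * (C * ((4 * l + 1 : ℝ) ^ d * Real.exp (-c * l)))) ≤ ε := by
  have h1 := tendsto_rpow_mul_exp_neg_mul_atTop_nhds_zero (2 * d : ℕ) c hc
  have h2 := (h1.comp (tendsto_natCast_atTop_atTop (R := ℝ))).const_mul (4 ^ d * 2 * |C| * 5 ^ d)
  rw [mul_zero] at h2
  obtain ⟨l, h3, h4⟩ := ((h2.eventually (gt_mem_nhds hε)).and (eventually_gt_atTop 0)).exists
  refine ⟨l, h4, le_trans ?_ h3.le⟩
  simp only [Function.comp, Real.rpow_natCast]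
  have h5 : (4 * l + 1 : ℝ) ≤ 5 * l := by
    have : (1 : ℝ) ≤ l := by exact_mod_cast h4
    linarith
  calc ((4 * l : ℕ) : ℝ) ^ d * (2 * (C * ((4 * l + 1 : ℝ) ^ d * Real.exp (-c * l))))
      ≤ ((4 * l : ℕ) : ℝ) ^ d * (2 * (|C| * ((5 * l : ℝ) ^ d * Real.exp (-c * l)))) := by
        gcongr
        exact le_abs_self C
    _ = _ := by push_cast; rw [mul_pow, mul_pow, two_mul d, pow_add]; ring

theorem word_bound {d : ℕ} (β h : ℝ) (hβ : 0 ≤ β) (μ : Measure (Config d)) (hG : IsGibbs d β h μ)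
    (hWM : WeakMixing d μ) : ∃ L : ℕ, 2 ≤ L ∧ ∃ e : ℝ, 0 < e ∧ ∀ (M : ℕ), 0 < M →
    ∀ [NeZero (L * M)], ∃ w : List (Fin d → ZMod (L * M)), (∀ x, x ∈ w) ∧
    ∀ pC : ℕ → ℂ, ∑ θ, ‖wt (Fintype.card (Fin d × Bool)) pC θ -
      ((wt (Fintype.card (Fin d × Bool)) (sg (Fintype.card (Fin d × Bool)) β h) θ : ℝ) : ℂ)‖ ≤ e →
    ∀ (x y : Fin d → ZMod (L * M)) (f : ((Fin d → ZMod (L * M)) → Bool) → ℂ), DependsOn f {x, y} →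
      (∀ η, ‖f η‖ ≤ 1) → ∀ t η, ‖(Tw nbr pC w)^[t] f η‖ ≤ 4 := by
  obtain ⟨C, c, hC, hc, hbox⟩ := box_bound β h μ hG hWM
  set D := Fintype.card (Fin d × Bool) with hD
  set m := (2 * 2 ^ d + 1) ^ d with hm
  set m' := (4 * 2 ^ d + 1) ^ d with hm'
  set q : ℝ := (1 / 2) ^ (m + 1) with hq
  have hq0 : 0 < q := by positivity
  have hq1 : q ≤ 1 := pow_le_one₀ (by norm_num) (by norm_num)
  have hqm : q * 2 ^ m ≤ 1 / 2 := by
    rw [hq, pow_succ, mul_right_comm, ← mul_pow]; norm_num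
  set ε : ℝ := q ^ m' / 4 with hε
  have hε0 : 0 < ε := by positivity
  obtain ⟨l, hl, hlε⟩ := pick_l d C c ε hc hε0
  obtain ⟨δ, hδ0, hδ1, hδ⟩ := sg_bound D β h
  have hr1 : 1 - δ ^ (boxO d (4 * l)).card < 1 := by
    have : 0 < δ ^ (boxO d (4 * l)).card := by positivity
    linarith
  have hr0 : 0 ≤ 1 - δ ^ (boxO d (4 * l)).card := by
    have : δ ^ (boxO d (4 * l)).card ≤ 1 := pow_le_one₀ hδ0.le hδ1
    linarith
  have ht := (tendsto_pow_atTop_nhds_zero_of_lt_one hr0 hr1).const_mul (((4 * l : ℕ) : ℝ) ^ d * 2)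
  rw [mul_zero] at ht
  obtain ⟨nn, hnn, hnn0⟩ := ((ht.eventually (gt_mem_nhds hε0)).and (eventually_gt_atTop 0)).exists
  set κ := Fintype.card ((Fin d → Bool) × Fin nn) * ((2 * 2 ^ d + 1) ^ d * (4 * l) ^ d) with hκ
  obtain ⟨e, ⟨he1, he2⟩, he0⟩ : ∃ e : ℝ, ((1 + e) ^ κ < 4 / 3 ∧ 2 * e * κ < 2 * ε) ∧ 0 < e := by
    have t1 : Tendsto (fun e : ℝ => (1 + e) ^ κ) (nhdsWithin 0 (Set.Ioi 0)) (nhds ((1 + 0) ^ κ)) :=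
      (Continuous.tendsto (by fun_prop) 0).mono_left nhdsWithin_le_nhds
    have t2 : Tendsto (fun e : ℝ => 2 * e * κ) (nhdsWithin 0 (Set.Ioi 0)) (nhds (2 * 0 * κ)) :=
      (Continuous.tendsto (by fun_prop) 0).mono_left nhdsWithin_le_nhds
    exact (((t1.eventually (gt_mem_nhds (by norm_num))).and
      (t2.eventually (gt_mem_nhds (by linarith)))).and self_mem_nhdsWithin).exists
  refine ⟨4 * l, by omega, e, he0, fun M hM _ => ?_⟩
  have : NeZero (4 * l) := ⟨by omega⟩
  have : NeZero M := ⟨by omega⟩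
  have hn : 2 ≤ 4 * l * M := by nlinarith
  have hLn : 4 * l ≤ 4 * l * M := Nat.le_mul_of_pos_right _ hM
  refine ⟨sweep (shf d l) nn M, fun x => ?_, fun pC hpC x y f hf hfb => ?_⟩
  · obtain ⟨s, c, y, h1, h2, rfl⟩ := exists_good hl x
    refine mem_sweep _ _ hnn0 s _ ((chart_nonC (rho (4 * l) M) _ c h1 y ?_).mpr ?_)
    · rw [mem_boxC]; intro k; have := h2 k; push_cast; omega
    · rw [mem_boxO]; intro k; have := h2 k; push_cast; omega
  · set X := swMap (shf d l) nn (M := M) with hX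
    have hdev : ∀ b, Ex (fun _ => wt D (sg D β h)) (X.dev b) ≤ 2 * ε := by
      intro b
      refine (Ex_dev_le (shf d l) nn hn β h hβ
        (C * ((4 * l + 1 : ℝ) ^ d * Real.exp (-c * l)) + (1 - δ ^ (boxO d (4 * l)).card) ^ nn)
        (fun x => ?_) b).trans ?_
      · obtain ⟨s, c, y, h1, h2, rfl⟩ := exists_good hl x
        obtain ⟨m, hm⟩ := hbox l hl y h2
        refine ⟨s, m, fun η => stage_bound (rho (4 * l) M) hLn β h (shf d l s) c h1 _
          (sites_nodup _ s) (fun x => mem_sites _ s x) δ hδ0.le hδ y ?_ m _ hm nn η⟩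
        rw [mem_boxO]; intro k; have := h2 k; push_cast; omega
      · linarith
    have hK : ∀ (g : ((Fin d → ZMod (4 * l * M)) → Bool) → ℂ) R, Dec X.cell g R →
        Dec X.cell (Tw nbr pC (sweep (shf d l) nn M) g) R := by
      intro g R hg
      rw [← swMap_K]
      refine X.K_Dec (wt D pC) (wt D (sg D β h)) e (2 * ε) q (sum_wt D pC)
        (wt_nonneg D _ (fun k _ => (sg_pos _ _ _ _).le) (fun k _ => (sg_lt_one _ _ _ _).le)
          (sg_mono _ _ _ hβ)) (sum_wt D _) hpC hdev hq0.le hq1 ?_ hqm he1.le g R hg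
      have : X.κ = κ := rfl
      rw [this]
      have : X.m' = m' := rfl
      rw [this]
      linarith
    have h0 : Dec X.cell f 4 := by
      refine Dec_mono _ _ ?_ (Dec_single X.cell f {X.cell x, X.cell y} 1 zero_le_one ?_ hfb)
      · have : ({X.cell x, X.cell y} : Finset _).card ≤ 2 := Finset.card_le_two
        calc (1 : ℝ) * 2 ^ _ ≤ 1 * 2 ^ 2 := by gcongr; norm_num
          _ = 4 := by norm_num
      · intro η η' hηη
        refine hf fun z hz => hηη z ?_
        simp only [Set.mem_insert_iff, Set.mem_singleton_iff] at hz
        rcases hz with rfl | rfl <;> simp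
    intro t η
    have h1 : Dec X.cell ((Tw nbr pC (sweep (shf d l) nn M))^[t] f) 4 := by
      induction t with
      | zero => exact h0
      | succ t ih => rw [Function.iterate_succ_apply']; exact hK _ _ ih
    exact Dec_bound _ _ h1 η

end Shift
end IsingA
end

section
open Filter Topology

namespace IsingA

section PSec
set_option linter.unusedSectionVars false

/-- two-variable power series with bounded coefficients -/
def PS (r M : ℝ) (φ : ℝ → ℝ → ℝ) : Prop :=
  ∃ a : ℕ × ℕ → ℝ, (∀ j, |a j| * r ^ (j.1 + j.2) ≤ M) ∧
    ∀ x y, |x| < r → |y| < r → HasSum (fun j : ℕ × ℕ => a j * x ^ j.1 * y ^ j.2) (φ x y)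

theorem geo_summable (r M x y : ℝ) (hr : 0 < r) (hx : |x| < r) (hy : |y| < r) :
    Summable (fun j : ℕ × ℕ => M * ((|x| / r) ^ j.1 * (|y| / r) ^ j.2)) := by
  apply Summable.mul_left
  exact Summable.mul_of_nonneg
    (summable_geometric_of_lt_one (by positivity) (by rwa [div_lt_one hr]))
    (summable_geometric_of_lt_one (by positivity) (by rwa [div_lt_one hr]))
    (fun n => by positivity) (fun n => by positivity)

theorem term_le (r M x y : ℝ) (hr : 0 < r) (A : ℝ) (j k : ℕ) (h : |A| * r ^ (j + k) ≤ M) :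
    |A * x ^ j * y ^ k| ≤ M * ((|x| / r) ^ j * (|y| / r) ^ k) := by
  rw [abs_mul, abs_mul, abs_pow, abs_pow, div_pow, div_pow]
  have : |A| * |x| ^ j * |y| ^ k = (|A| * r ^ (j + k)) * (|x| ^ j / r ^ j * (|y| ^ k / r ^ k)) := by
    rw [pow_add]; field_simp
  rw [this]
  gcongr

theorem PS_congr {r M : ℝ} {φ ψ : ℝ → ℝ → ℝ} (h : ∀ x y, |x| < r → |y| < r → φ x y = ψ x y)
    (hφ : PS r M φ) : PS r M ψ := by
  obtain ⟨a, h1, h2⟩ := hφ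
  exact ⟨a, h1, fun x y hx hy => h x y hx hy ▸ h2 x y hx hy⟩

theorem PS_sum {K : Type*} (S : Finset K) (r : ℝ) (hr : 0 < r) (M c : ℝ) (hc : 0 ≤ c) (φ : K → ℝ → ℝ → ℝ)
    (h : ∀ i ∈ S, PS r M (φ i)) : PS r (S.card * c * M) (fun x y => ∑ i ∈ S, c * φ i x y) := by
  classical
  choose! a h1 h2 using h
  refine ⟨fun j => ∑ i ∈ S, c * a i j, fun j => ?_, fun x y hx hy => ?_⟩
  · calc |∑ i ∈ S, c * a i j| * r ^ (j.1 + j.2) ≤ (∑ i ∈ S, |c * a i j|) * r ^ (j.1 + j.2) := by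
          gcongr; exact Finset.abs_sum_le_sum_abs _ _
      _ = ∑ i ∈ S, c * (|a i j| * r ^ (j.1 + j.2)) := by
          rw [Finset.sum_mul]
          refine Finset.sum_congr rfl fun i _ => ?_
          rw [abs_mul, abs_of_nonneg hc]; ring
      _ ≤ ∑ i ∈ S, c * M := Finset.sum_le_sum fun i hi => by
          have := h1 i hi j
          gcongr
      _ = _ := by rw [Finset.sum_const, nsmul_eq_mul]; ring
  · have := hasSum_sum (fun i hi => (h2 i hi x y hx hy).mul_left c)
    refine this.congr_fun ?_ |> id
    intro j
    simp only [Finset.sum_mul]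
    refine Finset.sum_congr rfl fun i _ => by ring

theorem PS_limit {r M : ℝ} (hr : 0 < r) (φ : ℕ → ℝ → ℝ → ℝ) (ψ : ℝ → ℝ → ℝ)
    (h : ∀ t, PS r M (φ t))
    (hl : ∀ x y, |x| < r → |y| < r → Tendsto (fun t => φ t x y) atTop (𝓝 (ψ x y))) : PS r M ψ := by
  choose a h1 h2 using h
  let 𝒰 : Ultrafilter ℕ := Ultrafilter.of atTop
  have h𝒰 : (𝒰 : Filter ℕ) ≤ atTop := Ultrafilter.of_le atTop
  have hb : ∀ t j, |a t j| ≤ M / r ^ (j.1 + j.2) := fun t j => by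
    rw [le_div_iff₀ (by positivity)]; exact h1 t j
  have hlim : ∀ j, ∃ b : ℝ, |b| ≤ M / r ^ (j.1 + j.2) ∧ Tendsto (fun t => a t j) 𝒰 (𝓝 b) := by
    intro j
    obtain ⟨b, hb1, hb2⟩ := (isCompact_Icc (a := -(M / r ^ (j.1 + j.2))) (b := M / r ^ (j.1 + j.2))).ultrafilter_le_nhds
      (𝒰.map (fun t => a t j)) (by
        rw [le_principal_iff]
        refine Filter.mem_map.mpr (Filter.univ_mem' fun t => ?_)
        exact Set.mem_Icc.mpr (abs_le.mp (hb t j)))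
    exact ⟨b, abs_le.mpr (Set.mem_Icc.mp hb1), hb2⟩
  choose b hb1 hb2 using hlim
  have hb3 : ∀ j : ℕ × ℕ, |b j| * r ^ (j.1 + j.2) ≤ M := fun j => by
    have := hb1 j
    rwa [le_div_iff₀ (by positivity)] at this
  refine ⟨b, hb3, fun x y hx hy => ?_⟩
  have hs := geo_summable r M x y hr hx hy
  have hsum : Summable (fun j : ℕ × ℕ => b j * x ^ j.1 * y ^ j.2) :=
    Summable.of_norm_bounded hs (fun j => term_le r M x y hr _ _ _ (hb3 j))
  have ht := tendsto_tsum_of_dominated_convergence (𝓕 := (𝒰 : Filter ℕ))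
    (f := fun t (j : ℕ × ℕ) => a t j * x ^ j.1 * y ^ j.2) (g := fun j => b j * x ^ j.1 * y ^ j.2) hs
    (fun j => ((hb2 j).mul_const _).mul_const _)
    (Filter.univ_mem' fun t j => term_le r M x y hr _ _ _ (h1 t j))
  have he : (fun t => ∑' j : ℕ × ℕ, a t j * x ^ j.1 * y ^ j.2) = fun t => φ t x y :=
    funext fun t => (h2 t x y hx hy).tsum_eq
  rw [he] at ht
  have := tendsto_nhds_unique ht ((hl x y hx hy).mono_left h𝒰)
  rw [← this]
  exact hsum.hasSum

theorem int_y {r M : ℝ} (hr : 0 < r) (a : ℕ × ℕ → ℝ) (ha : ∀ j, |a j| * r ^ (j.1 + j.2) ≤ M)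
    (φ : ℝ → ℝ → ℝ)
    (hφ : ∀ x y, |x| < r → |y| < r → HasSum (fun j : ℕ × ℕ => a j * x ^ j.1 * y ^ j.2) (φ x y))
    (x y : ℝ) (hx : |x| < r) (hy : |y| < r) :
    HasSum (fun j : ℕ × ℕ => a j / (j.2 + 1) * x ^ j.1 * y ^ (j.2 + 1)) (∫ s in (0 : ℝ)..y, φ x s) := by
  let f : ℕ × ℕ → C(ℝ, ℝ) := fun j => ⟨fun s => a j * x ^ j.1 * s ^ j.2, by fun_prop⟩
  have hle : ∀ s ∈ Set.uIcc 0 y, |s| ≤ |y| := by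
    intro s hs
    have := Set.abs_sub_left_of_mem_uIcc hs
    simpa using this
  have h0 : 0 ≤ M := (by positivity : 0 ≤ |a (0, 0)| * r ^ (0 + 0)).trans (ha (0, 0))
  have h1 := intervalIntegral.hasSum_intervalIntegral_of_summable_norm (a := 0) (b := y) (f := f) (by
    refine Summable.of_nonneg_of_le (fun _ => norm_nonneg _) (fun j => ?_) (geo_summable r M x y hr hx hy)
    rw [ContinuousMap.norm_le _ (by positivity)]
    rintro ⟨s, hs⟩
    refine (term_le r M x s hr _ _ _ (ha j)).trans ?_
    have := hle s hs
    gcongr)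
  have h2 : ∫ s in (0 : ℝ)..y, ∑' j, f j s = ∫ s in (0 : ℝ)..y, φ x s := by
    refine intervalIntegral.integral_congr fun s hs => ?_
    exact (hφ x s hx ((hle s hs).trans_lt hy)).tsum_eq
  rw [h2] at h1
  refine h1.congr_fun fun j => ?_
  change _ = ∫ s in (0 : ℝ)..y, a j * x ^ j.1 * s ^ j.2
  rw [intervalIntegral.integral_const_mul, integral_pow]
  simp
  ring

theorem PS_of_deriv {r M : ℝ} (hr : 0 < r) (p φ₁ φ₂ : ℝ → ℝ → ℝ) (h₁ : PS r M φ₁) (h₂ : PS r M φ₂)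
    (hd₁ : ∀ x, |x| < r → HasDerivAt (fun x => p x 0) (φ₁ x 0) x)
    (hd₂ : ∀ x y, |x| < r → |y| < r → HasDerivAt (fun y => p x y) (φ₂ x y) y)
    (hc₁ : Continuous (fun x => φ₁ x 0)) (hc₂ : ∀ x, Continuous (fun y => φ₂ x y)) :
    PS r (M * r) (fun x y => p x y - p 0 0) := by
  obtain ⟨a, ha1, ha2⟩ := h₁
  obtain ⟨b, hb1, hb2⟩ := h₂
  have h0 : 0 ≤ M := (by positivity : 0 ≤ |a (0, 0)| * r ^ (0 + 0)).trans (ha1 (0, 0))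
  let c1 : ℕ × ℕ → ℝ := fun j => match j with
    | (j + 1, 0) => a (j, 0) / (j + 1)
    | _ => 0
  let c2 : ℕ × ℕ → ℝ := fun j => match j with
    | (j, k + 1) => b (j, k) / (k + 1)
    | _ => 0
  have hle : ∀ y s : ℝ, s ∈ Set.uIcc 0 y → |s| ≤ |y| := by
    intro y s hs
    have := Set.abs_sub_left_of_mem_uIcc hs
    simpa using this
  have hbd : ∀ (A : ℝ) (k n : ℕ), |A| * r ^ n ≤ M → |A / (k + 1)| * r ^ (n + 1) ≤ M * r := by
    intro A k n h
    rw [abs_div, pow_succ]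
    have h2 : |A| / |(k : ℝ) + 1| ≤ |A| := by
      apply div_le_self (abs_nonneg _)
      rw [abs_of_nonneg (by positivity)]
      linarith [(Nat.cast_nonneg k : (0 : ℝ) ≤ k)]
    calc |A| / |(k : ℝ) + 1| * (r ^ n * r) ≤ |A| * (r ^ n * r) := by gcongr
      _ = (|A| * r ^ n) * r := by ring
      _ ≤ M * r := by gcongr
  refine ⟨fun j => c1 j + c2 j, ?_, fun x y hx hy => ?_⟩
  · rintro ⟨j, k⟩
    rcases k with _ | k
    · rcases j with _ | j
      · simp only [c1, c2, add_zero, abs_zero, zero_mul]; positivity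
      · simp only [c1, c2, add_zero]
        have := hbd _ j _ (ha1 (j, 0))
        simpa using this
    · have : c1 (j, k + 1) = 0 := by cases j <;> rfl
      simp only [this, c2, zero_add]
      have := hbd _ k _ (hb1 (j, k))
      simpa [add_assoc] using this
  · have e2 : HasSum (fun j : ℕ × ℕ => c2 j * x ^ j.1 * y ^ j.2) (p x y - p x 0) := by
      have h1 := int_y hr b hb1 φ₂ hb2 x y hx hy
      rw [intervalIntegral.integral_eq_sub_of_hasDerivAt (f := fun y => p x y)
        (fun s hs => hd₂ x s hx ((hle y s hs).trans_lt hy))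
        ((hc₂ x).intervalIntegrable _ _)] at h1
      have hinj : Function.Injective (fun j : ℕ × ℕ => (j.1, j.2 + 1)) := by
        rintro ⟨a, b⟩ ⟨c, d⟩ h
        simp only [Prod.mk.injEq, add_left_inj] at h
        exact Prod.ext h.1 h.2
      refine (hinj.hasSum_iff ?_).mp h1
      rintro ⟨j, k⟩ hj
      rcases k with _ | k
      · simp [c2]
      · exact absurd ⟨(j, k), rfl⟩ hj
    have e1 : HasSum (fun j : ℕ × ℕ => c1 j * x ^ j.1 * y ^ j.2) (p x 0 - p 0 0) := by
      have h1 := int_y hr (fun j => a j.swap) (fun j => by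
        have := ha1 j.swap
        rwa [Prod.fst_swap, Prod.snd_swap, add_comm] at this) (fun x y => φ₁ y x)
        (fun x y hx hy => by
          have := (Equiv.prodComm ℕ ℕ).hasSum_iff.mpr (ha2 y x hy hx)
          refine this.congr_fun fun j => ?_
          simp only [Function.comp, Equiv.prodComm_apply, Prod.fst_swap, Prod.snd_swap]; ring) 0 x (by simpa using hr) hx
      rw [intervalIntegral.integral_eq_sub_of_hasDerivAt (f := fun x => p x 0)
        (fun s hs => hd₁ s ((hle x s hs).trans_lt hx))
        (hc₁.intervalIntegrable _ _)] at h1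
      have hinj : Function.Injective (fun j : ℕ × ℕ => (j.2 + 1, j.1)) := by
        rintro ⟨a, b⟩ ⟨c, d⟩ h
        simp only [Prod.mk.injEq, add_left_inj] at h
        exact Prod.ext h.2 h.1
      refine (hinj.hasSum_iff ?_).mp (h1.congr_fun ?_)
      · rintro ⟨j, k⟩ hj
        rcases j with _ | j
        · simp [c1]
        · exact absurd ⟨(k, j), rfl⟩ hj
      · rintro ⟨k, j⟩
        rcases k with _ | k
        · simp [c1]
        · simp [c1]
    have := e1.add e2
    rw [show p x 0 - p 0 0 + (p x y - p x 0) = p x y - p 0 0 by ring] at this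
    refine this.congr_fun fun j => ?_
    ring

end PSec
end IsingA
end

section
open Filter Topology

namespace IsingA

section Ana
set_option linter.unusedSectionVars false

/-- coefficient multilinear maps -/
noncomputable def pser (a : ℕ × ℕ → ℝ) : FormalMultilinearSeries ℝ (ℝ × ℝ) ℝ := fun n =>
  ∑ j ∈ Finset.HasAntidiagonal.antidiagonal n, a j •
    (ContinuousMultilinearMap.mkPiAlgebra ℝ (Fin n) ℝ).compContinuousLinearMap
      (fun i : Fin n => if i.val < j.1 then ContinuousLinearMap.fst ℝ ℝ ℝ else ContinuousLinearMap.snd ℝ ℝ ℝ)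

theorem pser_norm (a : ℕ × ℕ → ℝ) (r M : ℝ) (hr : 0 < r) (ha : ∀ j, |a j| * r ^ (j.1 + j.2) ≤ M)
    (n : ℕ) : ‖pser a n‖ * (r / 2) ^ n ≤ M := by
  have h0 : 0 ≤ M := (by positivity : 0 ≤ |a (0, 0)| * r ^ (0 + 0)).trans (ha (0, 0))
  have h1 : ‖pser a n‖ ≤ ∑ j ∈ Finset.HasAntidiagonal.antidiagonal n, M / r ^ n := by
    refine (norm_sum_le _ _).trans (Finset.sum_le_sum fun j hj => ?_)
    rw [norm_smul]
    have hj' := Finset.HasAntidiagonal.mem_antidiagonal.mp hj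
    have h2 : ‖(ContinuousMultilinearMap.mkPiAlgebra ℝ (Fin n) ℝ).compContinuousLinearMap
      (fun i : Fin n => if i.val < j.1 then ContinuousLinearMap.fst ℝ ℝ ℝ else ContinuousLinearMap.snd ℝ ℝ ℝ)‖ ≤ 1 := by
      refine ContinuousMultilinearMap.opNorm_le_bound zero_le_one fun m => ?_
      simp only [ContinuousMultilinearMap.compContinuousLinearMap_apply, ContinuousMultilinearMap.mkPiAlgebra_apply]
      rw [norm_prod, one_mul]
      refine Finset.prod_le_prod (fun _ _ => norm_nonneg _) fun i _ => ?_
      split_ifs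
      · exact norm_fst_le (m i)
      · exact norm_snd_le (m i)
    have h3 : ‖a j‖ ≤ M / r ^ n := by
      rw [le_div_iff₀ (by positivity), ← hj']; exact ha j
    calc _ ≤ ‖a j‖ * 1 := by gcongr
      _ ≤ _ := by rw [mul_one]; exact h3
  rw [Finset.sum_const, Finset.Nat.card_antidiagonal, nsmul_eq_mul] at h1
  have h4 : ((n + 1 : ℕ) : ℝ) ≤ 2 ^ n := by exact_mod_cast Nat.lt_two_pow_self
  calc ‖pser a n‖ * (r / 2) ^ n ≤ (((n + 1 : ℕ) : ℝ) * (M / r ^ n)) * (r / 2) ^ n := by gcongr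
    _ ≤ (2 ^ n * (M / r ^ n)) * (r / 2) ^ n := by gcongr
    _ = M := by rw [div_pow]; field_simp

theorem pser_apply (a : ℕ × ℕ → ℝ) (n : ℕ) (y : ℝ × ℝ) :
    pser a n (fun _ => y) = ∑ j ∈ Finset.HasAntidiagonal.antidiagonal n, a j * y.1 ^ j.1 * y.2 ^ j.2 := by
  unfold pser
  rw [sum_apply]
  refine Finset.sum_congr rfl fun j hj => ?_
  have hj' := Finset.HasAntidiagonal.mem_antidiagonal.mp hj
  simp only [ContinuousMultilinearMap.smul_apply, ContinuousMultilinearMap.compContinuousLinearMap_apply,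
    ContinuousMultilinearMap.mkPiAlgebra_apply, smul_eq_mul, mul_assoc]
  congr 1
  have h : ∀ i : Fin n, ((if i.val < j.1 then ContinuousLinearMap.fst ℝ ℝ ℝ else ContinuousLinearMap.snd ℝ ℝ ℝ) : ℝ × ℝ →L[ℝ] ℝ) y
      = if i.val < j.1 then y.1 else y.2 := by
    intro i; split_ifs <;> rfl
  simp_rw [h]
  rw [Fin.prod_univ_eq_prod_range (fun i => if i < j.1 then y.1 else y.2) n, ← hj', Finset.prod_range_add]
  congr 1
  · rw [Finset.prod_congr rfl (g := fun _ => y.1) (fun i hi => if_pos (Finset.mem_range.mp hi))]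
    simp
  · rw [Finset.prod_congr rfl (g := fun _ => y.2) (fun i hi => if_neg (by omega))]
    simp

theorem PS_analytic {r M : ℝ} (hr : 0 < r) (φ : ℝ → ℝ → ℝ) (h : PS r M φ) :
    AnalyticOnNhd ℝ (fun z : ℝ × ℝ => φ z.1 z.2) (Metric.ball 0 (r / 2)) := by
  obtain ⟨a, ha, hs⟩ := h
  have hF : HasFPowerSeriesOnBall (fun z : ℝ × ℝ => φ z.1 z.2) (pser a) 0 (ENNReal.ofReal (r / 2)) := by
    refine ⟨?_, by simpa using hr, ?_⟩
    · refine FormalMultilinearSeries.le_radius_of_bound (r := Real.toNNReal (r / 2)) _ M fun n => ?_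
      rw [Real.coe_toNNReal _ (by positivity)]
      exact pser_norm a r M hr ha n
    · intro y hy
      rw [Metric.eball_ofReal, mem_ball_zero_iff] at hy
      have h1 : |y.1| < r := (norm_fst_le y).trans_lt (by linarith)
      have h2 : |y.2| < r := (norm_snd_le y).trans_lt (by linarith)
      have h3 := hs _ _ h1 h2
      rw [zero_add]
      have h4 := Finset.HasAntidiagonal.sigmaAntidiagonalEquivProd.hasSum_iff.mpr h3
      have h5 := h4.sigma (g := fun n => pser a n (fun _ => y)) (fun n => by
        rw [pser_apply, ← Finset.sum_coe_sort (Finset.HasAntidiagonal.antidiagonal n)]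
        exact hasSum_fintype _)
      exact h5
  intro z hz
  refine hF.analyticAt_of_mem ?_
  rwa [Metric.eball_ofReal]

/-- first partial derivative -/
noncomputable def D1 (φ : ℂ × ℂ → ℂ) (z : ℂ × ℂ) : ℂ := fderiv ℂ φ z (1, 0)

theorem D1_ana {φ : ℂ × ℂ → ℂ} {S : Set (ℂ × ℂ)} (h : AnalyticOnNhd ℂ φ S) : AnalyticOnNhd ℂ (D1 φ) S :=
  (ContinuousLinearMap.apply ℂ ℂ ((1, 0) : ℂ × ℂ)).comp_analyticOnNhd h.fderiv

theorem D1_iter_ana {φ : ℂ × ℂ → ℂ} {S : Set (ℂ × ℂ)} (h : AnalyticOnNhd ℂ φ S) (j : ℕ) :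
    AnalyticOnNhd ℂ (D1^[j] φ) S := by
  induction j with
  | zero => exact h
  | succ j ih => rw [Function.iterate_succ_apply']; exact D1_ana ih

theorem D1_slice {φ : ℂ × ℂ → ℂ} {S : Set (ℂ × ℂ)} (hS : IsOpen S) (h : AnalyticOnNhd ℂ φ S) (j : ℕ) :
    ∀ z w : ℂ, (z, w) ∈ S → iteratedDeriv j (fun z => φ (z, w)) z = D1^[j] φ (z, w) := by
  induction j with
  | zero => intro z w _; simp
  | succ j ih =>
    intro z w hz
    rw [iteratedDeriv_succ, Function.iterate_succ_apply']
    have hev : iteratedDeriv j (fun z => φ (z, w)) =ᶠ[𝓝 z] fun z => D1^[j] φ (z, w) := by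
      have : ∀ᶠ z' in 𝓝 z, (z', w) ∈ S :=
        (Continuous.prodMk continuous_id continuous_const).continuousAt.eventually (hS.mem_nhds hz)
      filter_upwards [this] with z' hz'
      exact ih z' w hz'
    rw [hev.deriv_eq]
    have hd := ((D1_iter_ana h j) (z, w) hz).differentiableAt.hasFDerivAt
    have hg : HasDerivAt (fun z : ℂ => (z, w)) ((1, 0) : ℂ × ℂ) z :=
      (hasDerivAt_id z).prodMk (hasDerivAt_const z w)
    exact (hd.comp_hasDerivAt z hg).deriv

theorem cauchy2 {R r M : ℝ} (hr : 0 < r) (hrR : r < R) (φ : ℂ × ℂ → ℂ)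
    (hφ : AnalyticOnNhd ℂ φ (Metric.ball 0 R)) (hb : ∀ z ∈ Metric.ball (0 : ℂ × ℂ) R, ‖φ z‖ ≤ M) :
    PS r M (fun x y => (φ (x, y)).re) := by
  have hmem : ∀ z w : ℂ, ‖z‖ < R → ‖w‖ < R → (z, w) ∈ Metric.ball (0 : ℂ × ℂ) R := by
    intro z w hz hw
    rw [mem_ball_zero_iff, Prod.norm_def]; exact max_lt hz hw
  have hR : 0 < R := hr.trans hrR
  have hM : 0 ≤ M := (norm_nonneg _).trans (hb _ (hmem 0 0 (by simpa) (by simpa)))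
  -- generic one-variable facts
  have key : ∀ (f : ℂ → ℂ) (B : ℝ), DifferentiableOn ℂ f (Metric.ball 0 R) →
      (∀ z ∈ Metric.ball (0 : ℂ) R, ‖f z‖ ≤ B) → ∀ n, ‖iteratedDeriv n f 0‖ ≤ n.factorial * B / r ^ n := by
    intro f B hf hB n
    refine Complex.norm_iteratedDeriv_le_of_forall_mem_sphere_norm_le n hr ?_ ?_
    · refine (hf.mono ?_).diffContOnCl
      rw [closure_ball _ hr.ne']
      exact Metric.closedBall_subset_ball hrR
    · intro z hz
      exact hB z (Metric.sphere_subset_closedBall.trans (Metric.closedBall_subset_ball hrR) hz)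
  have hsl1 : ∀ w : ℂ, ‖w‖ < R → DifferentiableOn ℂ (fun z => φ (z, w)) (Metric.ball 0 R) := by
    intro w hw z hz
    have := (hφ (z, w) (hmem z w (mem_ball_zero_iff.mp hz) hw)).differentiableAt
    exact (this.comp z (f := fun z => (z, w)) (by fun_prop)).differentiableWithinAt
  let c : ℕ → ℂ → ℂ := fun j w => ((j.factorial : ℂ))⁻¹ * D1^[j] φ (0, w)
  have hc : ∀ j, DifferentiableOn ℂ (c j) (Metric.ball 0 R) := by
    intro j w hw
    have := (D1_iter_ana hφ j (0, w) (hmem 0 w (by simpa) (mem_ball_zero_iff.mp hw))).differentiableAt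
    exact ((this.comp w (f := fun w => ((0 : ℂ), w)) (by fun_prop)).const_mul _).differentiableWithinAt
  have hcb : ∀ j, ∀ w ∈ Metric.ball (0 : ℂ) R, ‖c j w‖ ≤ M / r ^ j := by
    intro j w hw
    have hw' := mem_ball_zero_iff.mp hw
    have := key _ M (hsl1 w hw') (fun z hz => hb _ (hmem z w (mem_ball_zero_iff.mp hz) hw')) j
    rw [D1_slice Metric.isOpen_ball hφ j 0 w (hmem 0 w (by simpa) hw')] at this
    simp only [c, norm_mul, norm_inv, Complex.norm_natCast]
    have hf : (0 : ℝ) < j.factorial := by positivity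
    rw [inv_mul_le_iff₀ hf]
    calc _ ≤ _ := this
      _ = _ := by ring
  let a : ℕ × ℕ → ℂ := fun j => ((j.2.factorial : ℂ))⁻¹ * iteratedDeriv j.2 (c j.1) 0
  have ha : ∀ j, ‖a j‖ * r ^ (j.1 + j.2) ≤ M := by
    intro j
    have := key (c j.1) _ (hc j.1) (hcb j.1) j.2
    have hf : (0 : ℝ) < j.2.factorial := by positivity
    simp only [a, norm_mul, norm_inv, Complex.norm_natCast]
    calc (j.2.factorial : ℝ)⁻¹ * ‖iteratedDeriv j.2 (c j.1) 0‖ * r ^ (j.1 + j.2)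
        ≤ (j.2.factorial : ℝ)⁻¹ * (j.2.factorial * (M / r ^ j.1) / r ^ j.2) * r ^ (j.1 + j.2) := by gcongr
      _ = M := by rw [pow_add]; field_simp
  refine ⟨fun j => (a j).re, fun j => ?_, fun x y hx hy => ?_⟩
  · refine le_trans ?_ (ha j)
    gcongr
    exact Complex.abs_re_le_norm _
  · have hx' : ‖(x : ℂ)‖ < R := by rw [Complex.norm_real]; exact lt_trans hx hrR
    have hy' : ‖(y : ℂ)‖ < R := by rw [Complex.norm_real]; exact lt_trans hy hrR
    have e1 : HasSum (fun j => c j y * (x : ℂ) ^ j) (φ (x, y)) := by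
      have := Complex.hasSum_taylorSeries_on_ball (hsl1 y hy') (mem_ball_zero_iff.mpr hx')
      refine this.congr_fun fun j => ?_
      rw [D1_slice Metric.isOpen_ball hφ j 0 y (hmem 0 y (by simpa) hy')]
      simp only [c, smul_eq_mul, sub_zero]; ring
    have e2 : ∀ j, HasSum (fun k => a (j, k) * (x : ℂ) ^ j * (y : ℂ) ^ k) (c j y * (x : ℂ) ^ j) := by
      intro j
      have := (Complex.hasSum_taylorSeries_on_ball (hc j) (mem_ball_zero_iff.mpr hy')).mul_right ((x : ℂ) ^ j)
      refine this.congr_fun fun k => ?_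
      simp only [a, smul_eq_mul, sub_zero]; ring
    have hsum : Summable (fun j : ℕ × ℕ => a j * (x : ℂ) ^ j.1 * (y : ℂ) ^ j.2) := by
      refine Summable.of_norm_bounded (geo_summable r M x y hr hx hy) fun j => ?_
      have := term_le r M x y hr ‖a j‖ j.1 j.2 (by rw [abs_norm]; exact ha j)
      rw [norm_mul, norm_mul, norm_pow, norm_pow, Complex.norm_real, Complex.norm_real]
      rw [abs_mul, abs_mul, abs_pow, abs_pow, abs_norm] at this
      exact this
    have e3 := hsum.hasSum.prod_fiberwise e2
    have e4 := hsum.hasSum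
    rw [e3.unique e1] at e4
    have e5 := Complex.hasSum_re e4
    refine e5.congr_fun fun j => ?_
    rw [mul_assoc, mul_assoc, ← Complex.ofReal_pow, ← Complex.ofReal_pow, ← Complex.ofReal_mul, Complex.re_mul_ofReal]

end Ana
end IsingA
end

section
open MeasureTheory Filter Topology
open IsingP

namespace IsingA

section Conn
set_option linter.unusedSectionVars false

/-- complex heat-bath probability -/
noncomputable def sgC (D : ℕ) (b h : ℂ) (k : ℕ) : ℂ :=
  1 / (1 + Complex.exp (-(2 * (b * (2 * k - D) + h))))

theorem sgC_real (D : ℕ) (β h : ℝ) (k : ℕ) : sgC D β h k = ((sg D β h k : ℝ) : ℂ) := by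
  unfold sgC sg; push_cast; rfl

theorem den_ne (D : ℕ) (β h : ℝ) (k : ℕ) :
    1 + Complex.exp (-(2 * ((β : ℂ) * (2 * k - D) + h))) ≠ 0 := by
  have : (1 + Complex.exp (-(2 * ((β : ℂ) * (2 * k - D) + h)))) =
      ((1 + Real.exp (-(2 * (β * (2 * k - D) + h))) : ℝ) : ℂ) := by push_cast; rfl
  rw [this, Complex.ofReal_ne_zero]
  positivity

theorem sgC_ana (D : ℕ) (b0 h0 : ℂ) (k : ℕ) (z : ℂ × ℂ)
    (hz : 1 + Complex.exp (-(2 * ((b0 + z.1) * (2 * k - D) + (h0 + z.2)))) ≠ 0) :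
    AnalyticAt ℂ (fun z : ℂ × ℂ => sgC D (b0 + z.1) (h0 + z.2) k) z := by
  unfold sgC
  refine AnalyticAt.div analyticAt_const ?_ hz
  have h1 : AnalyticAt ℂ (fun z : ℂ × ℂ => z.1) z := analyticAt_fst
  have h2 : AnalyticAt ℂ (fun z : ℂ × ℂ => z.2) z := analyticAt_snd
  exact analyticAt_const.add (((analyticAt_const.mul (((analyticAt_const.add h1).mul
    analyticAt_const).add (analyticAt_const.add h2))).neg).cexp)

theorem exists_R (D : ℕ) (β h e : ℝ) (he : 0 < e) : ∃ R : ℝ, 0 < R ∧ ∀ z ∈ Metric.ball (0 : ℂ × ℂ) R,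
    (∀ k ≤ D, AnalyticAt ℂ (fun z : ℂ × ℂ => sgC D (β + z.1) (h + z.2) k) z) ∧
    ∑ θ, ‖wt D (sgC D (β + z.1) (h + z.2)) θ - ((wt D (sg D β h) θ : ℝ) : ℂ)‖ ≤ e := by
  have hcont : ∀ k, ContinuousAt (fun z : ℂ × ℂ => sgC D (β + z.1) (h + z.2) k) 0 := by
    intro k
    refine (sgC_ana D β h k 0 ?_).continuousAt
    simpa using den_ne D β h k
  have hcum : ∀ k, ContinuousAt (fun z : ℂ × ℂ => cum D (sgC D (β + z.1) (h + z.2)) k) 0 := by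
    intro k
    rcases k with _ | k
    · exact continuousAt_const
    · simp only [cum]
      split_ifs
      · exact hcont k
      · exact continuousAt_const
  have hcumR : ∀ k, cum D (sgC D β h) k = ((cum D (sg D β h) k : ℝ) : ℂ) := by
    intro k
    rcases k with _ | k
    · simp [cum]
    · simp only [cum]
      split_ifs
      · exact sgC_real _ _ _ _
      · simp
  have hwt : ∀ θ, wt D (sgC D β h) θ = ((wt D (sg D β h) θ : ℝ) : ℂ) := by
    intro θ; unfold wt; rw [hcumR, hcumR]; push_cast; rfl
  have h1 : ContinuousAt (fun z : ℂ × ℂ =>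
      ∑ θ, ‖wt D (sgC D (β + z.1) (h + z.2)) θ - ((wt D (sg D β h) θ : ℝ) : ℂ)‖) 0 := by
    refine tendsto_finsetSum _ fun θ _ => ?_
    refine Filter.Tendsto.norm (Filter.Tendsto.sub_const ?_ _)
    exact (hcum _).sub (hcum _)
  have h2 : ∀ᶠ z in 𝓝 (0 : ℂ × ℂ),
      ∑ θ, ‖wt D (sgC D (β + z.1) (h + z.2)) θ - ((wt D (sg D β h) θ : ℝ) : ℂ)‖ < e := by
    refine h1.eventually_lt_const ?_
    simp [hwt, he]
  have h3 : ∀ᶠ z in 𝓝 (0 : ℂ × ℂ), ∀ k ∈ Finset.range (D + 1),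
      AnalyticAt ℂ (fun z : ℂ × ℂ => sgC D (β + z.1) (h + z.2) k) z := by
    rw [Filter.eventually_all_finset]
    intro k _
    refine (sgC_ana D β h k 0 ?_).eventually_analyticAt
    simpa using den_ne D β h k
  obtain ⟨R, hR, hR'⟩ := Metric.eventually_nhds_iff_ball.mp (h2.and h3)
  exact ⟨R, hR, fun z hz => ⟨fun k hk => (hR' z hz).2 k (by simp; omega), (hR' z hz).1.le⟩⟩

variable {V κ : Type*} [DecidableEq V] [Fintype κ] (nb : V → κ → V)

theorem Tw_ana (P : ℂ × ℂ → ℕ → ℂ) (S : Set (ℂ × ℂ))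
    (hP : ∀ k ≤ Fintype.card κ, AnalyticOnNhd ℂ (fun z => P z k) S) (w : List V)
    (G : ℂ × ℂ → (V → Bool) → ℂ) (hG : ∀ η, AnalyticOnNhd ℂ (fun z => G z η) S) :
    ∀ η, AnalyticOnNhd ℂ (fun z => Tw nb (P z) w (G z) η) S := by
  induction w with
  | nil => exact hG
  | cons x w ih =>
    intro η
    simp only [Tw_cons, ks]
    have h1 := hP _ (cnt_le nb η x)
    exact (h1.mul (ih _)).add ((analyticOnNhd_const.sub h1).mul (ih _))

theorem Tw_iter_ana (P : ℂ × ℂ → ℕ → ℂ) (S : Set (ℂ × ℂ))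
    (hP : ∀ k ≤ Fintype.card κ, AnalyticOnNhd ℂ (fun z => P z k) S) (w : List V)
    (f : (V → Bool) → ℂ) (t : ℕ) :
    ∀ η, AnalyticOnNhd ℂ (fun z => (Tw nb (P z) w)^[t] f η) S := by
  induction t with
  | zero => intro η; exact analyticOnNhd_const
  | succ t ih =>
    intro η
    simp only [Function.iterate_succ_apply']
    exact Tw_ana nb P S hP w _ ih η

theorem Tw_cast (p : ℕ → ℝ) (w : List V) (f : (V → Bool) → ℝ) :
    Tw nb (fun k => (p k : ℂ)) w (fun η => (f η : ℂ)) = fun η => ((Tw nb p w f η : ℝ) : ℂ) := by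
  induction w with
  | nil => rfl
  | cons x w ih =>
    rw [Tw_cons, ih]
    funext η
    simp only [Tw_cons, ks]
    push_cast; rfl

theorem Tw_iter_cast (p : ℕ → ℝ) (w : List V) (f : (V → Bool) → ℝ) (t : ℕ) :
    (Tw nb (fun k => (p k : ℂ)) w)^[t] (fun η => (f η : ℂ)) =
      fun η => (((Tw nb p w)^[t] f η : ℝ) : ℂ) := by
  induction t with
  | zero => rfl
  | succ t ih => simp only [Function.iterate_succ_apply']; rw [ih, Tw_cast]

/-- torus expectation -/
noncomputable def mean (d n : ℕ) [NeZero n] (β h : ℝ) (f : ((Fin d → ZMod n) → Bool) → ℝ) : ℝ :=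
  (∑ η, Real.exp (tE d n β h η) * f η) / ∑ η, Real.exp (tE d n β h η)

theorem mean_lim {d n : ℕ} [NeZero n] (hn : 2 ≤ n) (β h : ℝ) (w : List (Fin d → ZMod n))
    (hw : ∀ x, x ∈ w) (f : ((Fin d → ZMod n) → Bool) → ℝ) (hf : ∀ η, |f η| ≤ 1) (η) :
    Tendsto (fun t => (Tw nbr (sg (Fintype.card (Fin d × Bool)) β h) w)^[t] f η) atTop
      (𝓝 (mean d n β h f)) := by
  obtain ⟨δ, hδ, hδ1, hb⟩ := sg_bound (Fintype.card (Fin d × Bool)) β h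
  have hc := (revW_torus (d := d) hn β h).conv δ hδ.le hb (fun k _ => (sg_lt_one _ _ _ _).le) w hw
    (fun η η' v hv => absurd ⟨v, rfl⟩ hv) f (-1) 1 (fun η => abs_le.mp (hf η))
  simp only [List.map_id] at hc
  rw [tendsto_iff_dist_tendsto_zero]
  have h1 : Tendsto (fun t : ℕ => (1 - δ ^ w.length) ^ t * ((1 : ℝ) - -1)) atTop (𝓝 0) := by
    rw [← zero_mul ((1 : ℝ) - -1)]
    refine Tendsto.mul_const _ (tendsto_pow_atTop_nhds_zero_of_lt_one ?_ ?_)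
    · linarith [pow_le_one₀ (n := w.length) hδ.le hδ1]
    · linarith [pow_pos hδ w.length]
  exact squeeze_zero (fun _ => dist_nonneg) (fun t => hc t η) h1

theorem PS_mean {d : ℕ} (β h : ℝ) (hβ : 0 ≤ β) (μ : Measure (Config d)) (hG : IsGibbs d β h μ)
    (hWM : WeakMixing d μ) : ∃ L : ℕ, 2 ≤ L ∧ ∃ r : ℝ, 0 < r ∧ ∀ (M : ℕ), 0 < M →
    ∀ [NeZero (L * M)], ∀ (x y : Fin d → ZMod (L * M)) (f : ((Fin d → ZMod (L * M)) → Bool) → ℝ),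
      DependsOn f {x, y} → (∀ η, |f η| ≤ 1) →
      PS r 4 (fun a b => mean d (L * M) (β + a) (h + b) f) := by
  obtain ⟨L, hL, e, he, hw⟩ := word_bound β h hβ μ hG hWM
  set D := Fintype.card (Fin d × Bool) with hD
  obtain ⟨R, hR, hRz⟩ := exists_R D β h e he
  refine ⟨L, hL, R / 2, by positivity, fun M hM _ x y f hf hf1 => ?_⟩
  obtain ⟨w, hwx, hwb⟩ := hw M hM
  have hn : 2 ≤ L * M := hL.trans (Nat.le_mul_of_pos_right L hM)
  let η0 : (Fin d → ZMod (L * M)) → Bool := fun _ => true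
  refine PS_limit (by positivity)
    (fun t a b => (Tw nbr (sg D (β + a) (h + b)) w)^[t] f η0) _ (fun t => ?_)
    (fun a b _ _ => mean_lim hn _ _ w hwx f hf1 η0)
  have h1 := cauchy2 (R := R) (r := R / 2) (M := 4) (by positivity) (by linarith)
    (fun z => (Tw nbr (sgC D (β + z.1) (h + z.2)) w)^[t] (fun η => (f η : ℂ)) η0)
    (Tw_iter_ana nbr (fun z => sgC D (β + z.1) (h + z.2)) _ (fun k hk z hz => (hRz z hz).1 k hk) w _ t η0)
    (fun z hz => hwb _ (hRz z hz).2 x y _ (fun a b hab => by rw [hf hab])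
      (fun η => by rw [Complex.norm_real]; exact hf1 η) t η0)
  refine PS_congr (fun a b _ _ => ?_) h1
  have : sgC D ((β : ℂ) + (a : ℂ)) ((h : ℂ) + (b : ℂ)) = fun k => ((sg D (β + a) (h + b) k : ℝ) : ℂ) := by
    funext k
    rw [← sgC_real]; push_cast; rfl
  simp only [this]
  rw [Tw_iter_cast, Complex.ofReal_re]

end Conn
end IsingA
end

section
open MeasureTheory Filter Topology
open IsingP

namespace IsingA

section Press
set_option linter.unusedSectionVars false
variable {d n : ℕ} [NeZero n]

/-- partition function -/
noncomputable def ZZ (d n : ℕ) [NeZero n] (β h : ℝ) : ℝ := ∑ η, Real.exp (tE d n β h η)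

/-- finite volume pressure -/
noncomputable def pr (d n : ℕ) [NeZero n] (β h : ℝ) : ℝ := ((n : ℝ) ^ d)⁻¹ * Real.log (ZZ d n β h)

theorem ZZ_pos (β h : ℝ) : 0 < ZZ d n β h := Finset.sum_pos (fun _ _ => Real.exp_pos _) Finset.univ_nonempty

/-- bond observable -/
noncomputable def fb (q : (Fin d → ZMod n) × Fin d) (σ : (Fin d → ZMod n) → Bool) : ℝ :=
  spin (σ q.1) * spin (σ (fun l => q.1 l + if l = q.2 then 1 else 0))

/-- site observable -/
noncomputable def fs (i : Fin d → ZMod n) (σ : (Fin d → ZMod n) → Bool) : ℝ := spin (σ i)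

theorem tE_eq (β h : ℝ) (σ : (Fin d → ZMod n) → Bool) :
    tE d n β h σ = β * ∑ q, fb q σ + h * ∑ i, fs i σ := by
  unfold tE fb fs
  rw [Fintype.sum_prod_type]

theorem abs_spin (b : Bool) : |spin b| = 1 := by cases b <;> simp [spin]

theorem fb_le (q : (Fin d → ZMod n) × Fin d) (σ) : |fb q σ| ≤ 1 := by
  unfold fb; rw [abs_mul, abs_spin, abs_spin]; norm_num
theorem fs_le (i : Fin d → ZMod n) (σ) : |fs i σ| ≤ 1 := by
  unfold fs; rw [abs_spin]

theorem fb_dep (q : (Fin d → ZMod n) × Fin d) :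
    DependsOn (fb q) {q.1, (fun l => q.1 l + if l = q.2 then 1 else 0)} := by
  intro a b hab
  unfold fb
  rw [hab _ (by simp), hab (fun l => q.1 l + if l = q.2 then 1 else 0) (by simp)]

theorem fs_dep (i : Fin d → ZMod n) : DependsOn (fs i) {i, i} := by
  intro a b hab
  unfold fs
  rw [hab _ (by simp)]

theorem mean_cont (f : ((Fin d → ZMod n) → Bool) → ℝ) :
    Continuous (fun z : ℝ × ℝ => mean d n z.1 z.2 f) := by
  unfold mean
  refine Continuous.div ?_ ?_ (fun z => (ZZ_pos z.1 z.2).ne')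
  · simp only [tE_eq]; fun_prop
  · simp only [tE_eq]; fun_prop

theorem pr_deriv (A B : ℝ → ℝ) (u v x : ℝ) (hA : HasDerivAt A u x) (hB : HasDerivAt B v x) :
    HasDerivAt (fun x => pr d n (A x) (B x))
      (u * ∑ q, ((n : ℝ) ^ d)⁻¹ * mean d n (A x) (B x) (fb q) +
        v * ∑ i, ((n : ℝ) ^ d)⁻¹ * mean d n (A x) (B x) (fs i)) x := by
  unfold pr
  have h1 : HasDerivAt (fun x => ZZ d n (A x) (B x))
      (∑ η, Real.exp (tE d n (A x) (B x) η) * (u * ∑ q, fb q η + v * ∑ i, fs i η)) x := by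
    unfold ZZ
    refine HasDerivAt.fun_sum fun η _ => ?_
    simp only [tE_eq]
    exact ((hA.mul_const _).add (hB.mul_const _)).exp
  have h2 := (h1.log (ZZ_pos _ _).ne').const_mul ((n : ℝ) ^ d)⁻¹
  refine h2.congr_deriv (Eq.symm ?_)
  unfold mean
  rw [← Finset.mul_sum, ← Finset.mul_sum, ← Finset.sum_div, ← Finset.sum_div, Finset.sum_comm,
    Finset.sum_comm (f := fun i η => Real.exp (tE d n (A x) (B x) η) * fs i η)]
  simp_rw [← Finset.mul_sum]
  change u * (_ * ((∑ η, Real.exp (tE d n (A x) (B x) η) * ∑ q, fb q η) / ZZ d n (A x) (B x))) +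
    v * (_ * ((∑ η, Real.exp (tE d n (A x) (B x) η) * ∑ q, fs q η) / ZZ d n (A x) (B x))) = _
  have h3 : ∑ η, Real.exp (tE d n (A x) (B x) η) * (u * ∑ q, fb q η + v * ∑ i, fs i η) =
      u * (∑ η, Real.exp (tE d n (A x) (B x) η) * ∑ q, fb q η) +
      v * (∑ η, Real.exp (tE d n (A x) (B x) η) * ∑ q, fs q η) := by
    rw [Finset.mul_sum, Finset.mul_sum, ← Finset.sum_add_distrib]
    refine Finset.sum_congr rfl fun η _ => by ring
  rw [h3]
  ring

theorem PS_mono {r M M' : ℝ} {φ : ℝ → ℝ → ℝ} (h : M ≤ M') (hφ : PS r M φ) : PS r M' φ := by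
  obtain ⟨a, h1, h2⟩ := hφ
  exact ⟨a, fun j => (h1 j).trans h, h2⟩

theorem PS_pr {d : ℕ} (hd : 1 ≤ d) (β h : ℝ) (hβ : 0 ≤ β) (μ : Measure (Config d)) (hG : IsGibbs d β h μ)
    (hWM : WeakMixing d μ) : ∃ L : ℕ, 2 ≤ L ∧ ∃ r : ℝ, 0 < r ∧ ∃ C : ℝ, ∀ (M : ℕ), 0 < M →
    ∀ [NeZero (L * M)], PS r C (fun a b => pr d (L * M) (β + a) (h + b) - pr d (L * M) β h) := by
  obtain ⟨L, hL, r, hr, hm⟩ := PS_mean β h hβ μ hG hWM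
  refine ⟨L, hL, r, hr, 4 * d * r, fun M hM _ => ?_⟩
  have hn0 : (0 : ℝ) < ((L * M : ℕ) : ℝ) ^ d := by
    have : (0 : ℝ) < ((L * M : ℕ) : ℝ) := by exact_mod_cast (Nat.mul_pos (by omega) hM)
    positivity
  set c : ℝ := (((L * M : ℕ) : ℝ) ^ d)⁻¹ with hc
  have hd' : (1 : ℝ) ≤ d := by exact_mod_cast hd
  have h1 : PS r (4 * d) (fun a b => ∑ q, c * mean d (L * M) (β + a) (h + b) (fb q)) := by
    refine PS_mono (le_of_eq ?_) (PS_sum Finset.univ r hr 4 c (by positivity)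
      (fun q a b => mean d (L * M) (β + a) (h + b) (fb q)) (fun q _ => hm M hM _ _ _ (fb_dep q) (fb_le q)))
    rw [Finset.card_univ, Fintype.card_prod, Fintype.card_fun, ZMod.card, Fintype.card_fin, hc]
    push_cast at hn0 ⊢
    field_simp
  have h2 : PS r (4 * d) (fun a b => ∑ i, c * mean d (L * M) (β + a) (h + b) (fs i)) := by
    refine PS_mono ?_ (PS_sum Finset.univ r hr 4 c (by positivity)
      (fun q a b => mean d (L * M) (β + a) (h + b) (fs q)) (fun q _ => hm M hM _ _ _ (fs_dep q) (fs_le q)))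
    rw [Finset.card_univ, Fintype.card_fun, ZMod.card, Fintype.card_fin, hc]
    push_cast at hn0 ⊢
    rw [mul_inv_cancel₀ hn0.ne']
    linarith
  have h3 := PS_of_deriv hr (fun a b => pr d (L * M) (β + a) (h + b)) _ _ h1 h2
    (fun x _ => by
      have := pr_deriv (d := d) (n := L * M) (fun x => β + x) (fun _ => h + 0) 1 0 x
        ((hasDerivAt_id x).const_add β) (hasDerivAt_const x _)
      simpa only [one_mul, zero_mul, add_zero] using this)
    (fun x y _ _ => by
      have := pr_deriv (d := d) (n := L * M) (fun _ => β + x) (fun y => h + y) 0 1 y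
        (hasDerivAt_const y _) ((hasDerivAt_id y).const_add h)
      simpa only [one_mul, zero_mul, zero_add] using this)
    (by
      refine continuous_finsetSum _ fun q _ => continuous_const.mul ?_
      exact (mean_cont (fb q)).comp (f := fun x : ℝ => (β + x, h + 0)) (by fun_prop))
    (fun x => by
      refine continuous_finsetSum _ fun q _ => continuous_const.mul ?_
      exact (mean_cont (fs q)).comp (f := fun y : ℝ => (β + x, h + y)) (by fun_prop))
  simpa only [add_zero] using h3

end Press
end IsingA
end

section
open MeasureTheory Filter Topology
open IsingP

namespace IsingA

section Thermo
set_option linter.unusedSectionVars false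

theorem sum_diff {X X' : Type*} [Fintype X] [Fintype X'] [DecidableEq X] (ψ : X' → X)
    (hψ : Function.Injective ψ) (f : X → ℝ) (f' : X' → ℝ) (hf : ∀ x, |f x| ≤ 1) (hf' : ∀ x, |f' x| ≤ 1)
    (bad : Finset X') (hb : ∀ x, x ∉ bad → f (ψ x) = f' x) :
    |∑ x, f x - ∑ x, f' x| ≤ ((Fintype.card X : ℝ) - Fintype.card X') + 2 * bad.card := by
  classical
  have h1 : ∑ x, f x = ∑ x', f (ψ x') + ∑ x ∈ (Finset.univ.image ψ)ᶜ, f x := by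
    rw [← Finset.sum_image (s := Finset.univ) (g := ψ) (f := f) (fun a _ b _ h => hψ h), Finset.sum_add_sum_compl]
  have hc : (((Finset.univ.image ψ)ᶜ.card : ℕ) : ℝ) = (Fintype.card X : ℝ) - Fintype.card X' := by
    rw [Finset.card_compl, Finset.card_image_of_injective _ hψ, Finset.card_univ,
      Nat.cast_sub (Fintype.card_le_of_injective ψ hψ)]
  have h2 : |∑ x ∈ (Finset.univ.image ψ)ᶜ, f x| ≤ (Fintype.card X : ℝ) - Fintype.card X' := by
    rw [← hc]
    refine (Finset.abs_sum_le_sum_abs _ _).trans ?_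
    refine (Finset.sum_le_sum fun x _ => hf x).trans ?_
    simp
  have h3 : |∑ x', (f (ψ x') - f' x')| ≤ 2 * bad.card := by
    refine (Finset.abs_sum_le_sum_abs _ _).trans ?_
    rw [← Finset.sum_subset (Finset.subset_univ bad) (fun x _ hx => by rw [hb x hx]; simp)]
    have : ∀ x ∈ bad, |f (ψ x) - f' x| ≤ 2 := fun x _ => by
      have := abs_sub (f (ψ x)) (f' x)
      linarith [hf (ψ x), hf' x]
    refine (Finset.sum_le_sum this).trans ?_
    simp [mul_comm]
  rw [h1]
  have : ∑ x', f (ψ x') + ∑ x ∈ (Finset.univ.image ψ)ᶜ, f x - ∑ x, f' x =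
    ∑ x', (f (ψ x') - f' x') + ∑ x ∈ (Finset.univ.image ψ)ᶜ, f x := by
    rw [Finset.sum_sub_distrib]; ring
  rw [this]
  refine (abs_add_le _ _).trans ?_
  linarith

theorem block_sum {A O X : Type*} [Fintype A] [Fintype O] [Fintype X] [DecidableEq A] [DecidableEq O]
    [DecidableEq X] (J : A × O → X) (hJ : Function.Injective J) (g : (O → Bool) → ℝ) :
    ∑ σ : X → Bool, ∏ a, g (fun o => σ (J (a, o))) =
      2 ^ (Fintype.card X - Fintype.card A * Fintype.card O) * (∑ τ, g τ) ^ Fintype.card A := by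
  classical
  let e0 : (A × O) ⊕ ↥((Set.range J)ᶜ) ≃ X :=
    ((Equiv.ofInjective J hJ).sumCongr (Equiv.refl _)).trans (Equiv.Set.sumCompl (Set.range J))
  have he0 : ∀ x, e0 (Sum.inl x) = J x := fun x => by simp [e0]
  let E : ((A → O → Bool) × (↥((Set.range J)ᶜ) → Bool)) ≃ (X → Bool) :=
    (((Equiv.curry A O Bool).symm.prodCongr (Equiv.refl _)).trans
      (Equiv.sumArrowEquivProdArrow _ _ _).symm).trans (Equiv.arrowCongr e0 (Equiv.refl _))
  have hE : ∀ τ ρ a o, E (τ, ρ) (J (a, o)) = τ a o := by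
    intro τ ρ a o
    rw [← he0]
    simp [E]
  rw [← E.sum_comp, Fintype.sum_prod_type]
  simp_rw [hE]
  have hcard : Fintype.card ↥((Set.range J)ᶜ) = Fintype.card X - Fintype.card A * Fintype.card O := by
    have := Fintype.card_congr e0
    rw [Fintype.card_sum, Fintype.card_prod] at this
    omega
  have h1 : (∑ τ, g τ) ^ Fintype.card A = ∑ τ : A → O → Bool, ∏ a, g (τ a) := by
    rw [← Finset.card_univ, ← Finset.prod_const, Finset.prod_univ_sum, Fintype.piFinset_univ]
  rw [h1]
  simp only [Finset.sum_const, Finset.card_univ, Fintype.card_fun, Fintype.card_bool, hcard, nsmul_eq_mul]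
  rw [Finset.mul_sum]
  push_cast
  rfl

theorem log_diff {S : Type*} [Fintype S] [Nonempty S] (f g : S → ℝ) (K : ℝ) (h : ∀ s, |f s - g s| ≤ K) :
    |Real.log (∑ s, Real.exp (f s)) - Real.log (∑ s, Real.exp (g s))| ≤ K := by
  have key : ∀ f g : S → ℝ, (∀ s, |f s - g s| ≤ K) →
      Real.log (∑ s, Real.exp (f s)) ≤ K + Real.log (∑ s, Real.exp (g s)) := by
    intro f g h
    have hp : ∀ f : S → ℝ, 0 < ∑ s, Real.exp (f s) := fun f =>
      Finset.sum_pos (fun _ _ => Real.exp_pos _) Finset.univ_nonempty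
    rw [← Real.log_exp K, ← Real.log_mul (Real.exp_pos _).ne' (hp g).ne']
    refine Real.log_le_log (hp f) ?_
    rw [Finset.mul_sum]
    refine Finset.sum_le_sum fun s _ => ?_
    rw [← Real.exp_add]
    gcongr
    linarith [(abs_le.mp (h s)).2]
  rw [abs_le]
  have h1 := key f g h
  have h2 := key g f (fun s => by rw [abs_sub_comm]; exact h s)
  constructor <;> linarith

variable {d : ℕ}

/-- block embedding -/
def Jb (m n q : ℕ) (x : (Fin d → Fin q) × (Fin d → ZMod m)) : Fin d → ZMod n :=
  fun k => (((x.1 k).val * m + (x.2 k).val : ℕ) : ZMod n)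

theorem Jb_inj (m n q : ℕ) [NeZero m] [NeZero n] (hq : q * m ≤ n) :
    Function.Injective (Jb (d := d) m n q) := by
  have hm : 0 < m := Nat.pos_of_ne_zero (NeZero.ne m)
  have hlt : ∀ (a : Fin q) (o : ZMod m), a.val * m + o.val < n := by
    intro a o
    have h1 := ZMod.val_lt o
    have h2 : (a.val + 1) * m ≤ q * m := Nat.mul_le_mul_right _ a.isLt
    rw [add_mul] at h2
    omega
  rintro ⟨a, o⟩ ⟨a', o'⟩ h
  have h1 : ∀ k, (a k).val * m + (o k).val = (a' k).val * m + (o' k).val := by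
    intro k
    have := congrArg ZMod.val (congrFun h k)
    simp only [Jb] at this
    rwa [ZMod.val_cast_of_lt (hlt _ _), ZMod.val_cast_of_lt (hlt _ _)] at this
  have h2 : a = a' := by
    ext k
    have := congrArg (· / m) (h1 k)
    simp only [mul_comm _ m, Nat.mul_add_div hm, Nat.div_eq_of_lt (ZMod.val_lt (o k)),
      Nat.div_eq_of_lt (ZMod.val_lt (o' k)), add_zero] at this
    exact this
  subst h2
  have h3 : o = o' := by
    ext k
    exact ZMod.val_injective m (by have := h1 k; omega)
  rw [h3]

theorem Jb_good (m n q : ℕ) [NeZero m] [NeZero n] (a : Fin d → Fin q) (o : Fin d → ZMod m) (k : Fin d)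
    (hk : o k ≠ -1) :
    Jb m n q (a, fun l => o l + if l = k then 1 else 0) = fun l => Jb m n q (a, o) l + if l = k then 1 else 0 := by
  ext l
  by_cases hl : l = k
  · subst hl
    simp only [Jb, if_true]
    have hv : (o l + 1).val = (o l).val + 1 := by
      have h1 := ZMod.val_lt (o l)
      have hne : (o l).val + 1 ≠ m := by
        intro h
        apply hk
        have : (((o l).val + 1 : ℕ) : ZMod m) = 0 := by rw [h]; simp
        rw [Nat.cast_add, ZMod.natCast_val, ZMod.cast_id, Nat.cast_one] at this
        exact eq_neg_of_add_eq_zero_left this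
      have h2 : 1 < m := by omega
      have : Fact (1 < m) := ⟨h2⟩
      rw [ZMod.val_add_of_lt, ZMod.val_one]
      rw [ZMod.val_one]; omega
    rw [hv]
    push_cast; ring
  · simp [Jb, hl]

theorem bad_card (m : ℕ) [NeZero m] (k : Fin d) (c : ZMod m) :
    (Finset.univ.filter (fun o : Fin d → ZMod m => o k = c)).card * m = m ^ d := by
  have h := Fintype.card_filter_piFinset_const_eq_of_mem (Finset.univ : Finset (ZMod m)) k (Finset.mem_univ c)
  rw [Fintype.piFinset_univ] at h
  rw [h, Finset.card_univ, ZMod.card, Fintype.card_fin]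
  have : 0 < d := Fin.pos k
  rw [← pow_succ]
  congr 1; omega

theorem bad_card2 (m q : ℕ) [NeZero m] (c : ZMod m) :
    (Finset.univ.filter (fun x : ((Fin d → Fin q) × (Fin d → ZMod m)) × Fin d => x.1.2 x.2 = c)).card * m
      = q ^ d * m ^ d * d := by
  rw [Finset.card_filter, Fintype.sum_prod_type_right]
  simp_rw [Fintype.sum_prod_type]
  simp_rw [← Finset.card_filter]
  simp only [Finset.sum_const, Finset.card_univ, Fintype.card_fun, Fintype.card_fin, smul_eq_mul]
  rw [Finset.sum_mul]
  simp_rw [mul_assoc, bad_card]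
  simp only [Finset.sum_const, Finset.card_univ, Fintype.card_fin, smul_eq_mul]
  ring

theorem energy_diff (m n q : ℕ) [NeZero m] [NeZero n] (hq : q * m ≤ n) (β h : ℝ)
    (σ : (Fin d → ZMod n) → Bool) :
    |tE d n β h σ - ∑ a : Fin d → Fin q, tE d m β h (fun o => σ (Jb m n q (a, o)))| ≤
      |β| * ((((n : ℝ) ^ d - q ^ d * m ^ d) * d) + 2 * (q ^ d * m ^ d * d / m)) +
      |h| * ((n : ℝ) ^ d - q ^ d * m ^ d) := by
  have hm : (0 : ℝ) < m := by exact_mod_cast Nat.pos_of_ne_zero (NeZero.ne m)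
  have hJ := Jb_inj (d := d) m n q hq
  have h1 : ∑ a : Fin d → Fin q, tE d m β h (fun o => σ (Jb m n q (a, o))) =
      β * (∑ x : ((Fin d → Fin q) × (Fin d → ZMod m)) × Fin d,
        fb (x.1.2, x.2) (fun o => σ (Jb m n q (x.1.1, o)))) +
      h * ∑ x : (Fin d → Fin q) × (Fin d → ZMod m), fs x.2 (fun o => σ (Jb m n q (x.1, o))) := by
    simp only [tE_eq, Finset.sum_add_distrib, Fintype.sum_prod_type, Finset.mul_sum]
  have h2 := sum_diff (fun x : ((Fin d → Fin q) × (Fin d → ZMod m)) × Fin d => (Jb m n q x.1, x.2))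
    (fun x y hxy => by
      simp only [Prod.mk.injEq] at hxy
      exact Prod.ext (hJ hxy.1) hxy.2)
    (fun y => fb y σ) (fun x => fb (x.1.2, x.2) (fun o => σ (Jb m n q (x.1.1, o))))
    (fun _ => fb_le _ _) (fun _ => fb_le _ _)
    (Finset.univ.filter (fun x => x.1.2 x.2 = -1)) (by
      rintro ⟨⟨a, o⟩, k⟩ hx
      simp only [Finset.mem_filter, Finset.mem_univ, true_and] at hx
      simp only [fb]
      rw [Jb_good m n q a o k hx])
  have h3 := sum_diff (Jb (d := d) m n q) hJ
    (fun y => fs y σ) (fun x => fs x.2 (fun o => σ (Jb m n q (x.1, o))))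
    (fun _ => fs_le _ _) (fun _ => fs_le _ _) ∅ (fun x _ => rfl)
  have h4 : (((Finset.univ.filter (fun x : ((Fin d → Fin q) × (Fin d → ZMod m)) × Fin d => x.1.2 x.2 = -1)).card : ℕ) : ℝ) =
      q ^ d * m ^ d * d / m := by
    rw [eq_div_iff hm.ne']
    exact_mod_cast bad_card2 m q (-1)
  rw [h4] at h2
  simp only [Fintype.card_prod, Fintype.card_fun, ZMod.card, Fintype.card_fin, Finset.card_empty, Nat.cast_mul,
    Nat.cast_pow, Nat.cast_zero, mul_zero, add_zero] at h2 h3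
  rw [h1, tE_eq]
  rw [show ∀ a b c e : ℝ, β * a + h * b - (β * c + h * e) = β * (a - c) + h * (b - e) from
    fun a b c e => by ring]
  refine (abs_add_le _ _).trans ?_
  rw [abs_mul, abs_mul]
  refine add_le_add ?_ ?_
  · refine mul_le_mul_of_nonneg_left (h2.trans (le_of_eq ?_)) (abs_nonneg _)
    ring
  · exact mul_le_mul_of_nonneg_left h3 (abs_nonneg _)

theorem pr_block (m n : ℕ) [NeZero m] [NeZero n] (β h ρ : ℝ)
    (hρ : ρ = (((n / m : ℕ) : ℝ) * m / n) ^ d) :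
    |pr d n β h - ((1 - ρ) * Real.log 2 + ρ * pr d m β h)| ≤
      (1 - ρ) * (|β| * d + |h|) + ρ * (|β| * (2 * d / m)) := by
  set q := n / m with hq
  have hqm : q * m ≤ n := Nat.div_mul_le_self n m
  have hm : (0 : ℝ) < m := by exact_mod_cast Nat.pos_of_ne_zero (NeZero.ne m)
  have hn : (0 : ℝ) < n := by exact_mod_cast Nat.pos_of_ne_zero (NeZero.ne n)
  have h1 := log_diff (fun σ => tE d n β h σ)
    (fun σ => ∑ a : Fin d → Fin q, tE d m β h (fun o => σ (Jb m n q (a, o)))) _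
    (energy_diff m n q hqm β h)
  simp only [Real.exp_sum] at h1
  rw [block_sum (Jb (d := d) m n q) (Jb_inj m n q hqm) (fun τ => Real.exp (tE d m β h τ))] at h1
  change |Real.log (ZZ d n β h) - Real.log (_ * (ZZ d m β h) ^ _)| ≤ _ at h1
  have hle : q ^ d * m ^ d ≤ n ^ d := by
    rw [← mul_pow]; exact Nat.pow_le_pow_left hqm d
  rw [Real.log_mul (by positivity) (pow_pos (ZZ_pos β h) _).ne', Real.log_pow, Real.log_pow] at h1
  simp only [Fintype.card_fun, ZMod.card, Fintype.card_fin] at h1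
  rw [Nat.cast_sub hle] at h1
  push_cast at h1
  have hnd : (0 : ℝ) < (n : ℝ) ^ d := by positivity
  have hmd : (0 : ℝ) < (m : ℝ) ^ d := by positivity
  have hρ' : (q : ℝ) ^ d * m ^ d = ρ * n ^ d := by
    rw [hρ, div_pow, mul_pow]; field_simp
  have hρ2 : (q : ℝ) ^ d = ρ * n ^ d / m ^ d := by
    rw [eq_div_iff hmd.ne', hρ']
  rw [hρ', hρ2] at h1
  have h2 := mul_le_mul_of_nonneg_left h1 (inv_nonneg.mpr hnd.le)
  rw [← abs_of_pos (inv_pos.mpr hnd), ← abs_mul, abs_of_pos (inv_pos.mpr hnd)] at h2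
  unfold pr
  refine le_trans (le_of_eq ?_) (h2.trans (le_of_eq ?_))
  · congr 1
    field_simp
    try ring
  · field_simp
    try ring

theorem rho_lim (m : ℕ) (hm : 0 < m) :
    Tendsto (fun n : ℕ => ((((n / m : ℕ) : ℝ)) * m / n) ^ d) atTop (𝓝 1) := by
  have h1 : Tendsto (fun n : ℕ => (((n / m : ℕ) : ℝ)) * m / n) atTop (𝓝 1) := by
    have h2 : Tendsto (fun n : ℕ => 1 - (m : ℝ) / n) atTop (𝓝 (1 - 0)) :=
      tendsto_const_nhds.sub (tendsto_const_div_atTop_nhds_zero_nat (m : ℝ))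
    rw [sub_zero] at h2
    refine tendsto_of_tendsto_of_tendsto_of_le_of_le' h2 tendsto_const_nhds ?_ ?_
    · filter_upwards [eventually_gt_atTop 0] with n hn
      have hn' : (0 : ℝ) < n := by exact_mod_cast hn
      rw [le_div_iff₀ hn', sub_mul, div_mul_cancel₀ _ hn'.ne', one_mul]
      have : n ≤ n / m * m + m := by
        have h3 := Nat.div_add_mod n m
        have h4 := Nat.mod_lt n hm
        rw [mul_comm] at h3
        omega
      have h5 : (n : ℝ) ≤ ((n / m : ℕ) : ℝ) * m + m := by exact_mod_cast this
      linarith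
    · filter_upwards [eventually_gt_atTop 0] with n hn
      have hn' : (0 : ℝ) < n := by exact_mod_cast hn
      rw [div_le_one hn']
      exact_mod_cast Nat.div_mul_le_self n m
  simpa using h1.pow d

theorem thermo (β h : ℝ) : ∃ l : ℝ, ∀ (u : ℕ → ℕ) (hu : ∀ k, NeZero (u k)), Tendsto u atTop atTop →
    Tendsto (fun k => pr d (u k) β h) atTop (𝓝 l) := by
  -- pointwise comparison
  have key : ∀ ε > 0, ∃ c : ℝ, ∃ n0 : ℕ, ∀ n ≥ n0, ∀ [NeZero n], |pr d n β h - c| < ε := by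
    intro ε hε
    obtain ⟨m, hm0, hm⟩ : ∃ m : ℕ, 0 < m ∧ |β| * (2 * d / m) < ε / 2 := by
      have : Tendsto (fun m : ℕ => |β| * ((2 * d : ℝ) / m)) atTop (𝓝 (|β| * 0)) :=
        (tendsto_const_div_atTop_nhds_zero_nat _).const_mul _
      rw [mul_zero] at this
      obtain ⟨m, h1, h2⟩ := ((this.eventually_lt_const (half_pos hε)).and (eventually_gt_atTop 0)).exists
      exact ⟨m, h2, h1⟩
    have : NeZero m := ⟨hm0.ne'⟩
    set B : ℝ := Real.log 2 + |pr d m β h| + (|β| * d + |h|) with hB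
    have hB0 : 0 ≤ B := by have := Real.log_nonneg (one_le_two); positivity
    have h1 : Tendsto (fun n : ℕ => (1 - ((((n / m : ℕ) : ℝ)) * m / n) ^ d) * B) atTop (𝓝 ((1 - 1) * B)) :=
      ((tendsto_const_nhds.sub (rho_lim m hm0))).mul_const _
    rw [sub_self, zero_mul] at h1
    obtain ⟨n0, hn0⟩ := eventually_atTop.mp (h1.eventually_lt_const (half_pos hε))
    refine ⟨pr d m β h, n0, fun n hn _ => ?_⟩
    have h2 := hn0 n hn
    set ρ : ℝ := ((((n / m : ℕ) : ℝ)) * m / n) ^ d with hρ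
    have h3 := pr_block m n β h ρ hρ
    have hn' : (0 : ℝ) < n := by exact_mod_cast Nat.pos_of_ne_zero (NeZero.ne n)
    have hρ0 : 0 ≤ ρ := by positivity
    have hρ1 : ρ ≤ 1 := by
      refine pow_le_one₀ (by positivity) ?_
      rw [div_le_one hn']
      exact_mod_cast Nat.div_mul_le_self n m
    have h4 : |(1 - ρ) * Real.log 2 - (1 - ρ) * pr d m β h| ≤ (1 - ρ) * (Real.log 2 + |pr d m β h|) := by
      rw [← mul_sub, abs_mul, abs_of_nonneg (by linarith : 0 ≤ 1 - ρ)]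
      refine mul_le_mul_of_nonneg_left ?_ (by linarith)
      refine (abs_sub _ _).trans ?_
      rw [abs_of_nonneg (Real.log_nonneg one_le_two)]
    have h5 : ρ * (|β| * (2 * d / m)) ≤ |β| * (2 * d / m) := mul_le_of_le_one_left (by positivity) hρ1
    calc |pr d n β h - pr d m β h| = |(pr d n β h - ((1 - ρ) * Real.log 2 + ρ * pr d m β h)) +
        ((1 - ρ) * Real.log 2 - (1 - ρ) * pr d m β h)| := by congr 1; ring
      _ ≤ _ := abs_add_le _ _
      _ ≤ ((1 - ρ) * (|β| * d + |h|) + ρ * (|β| * (2 * d / m))) + (1 - ρ) * (Real.log 2 + |pr d m β h|) := add_le_add h3 h4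
      _ < ε := by
        have : (1 - ρ) * (|β| * d + |h|) + (1 - ρ) * (Real.log 2 + |pr d m β h|) = (1 - ρ) * B := by rw [hB]; ring
        linarith
  have hcau : CauchySeq (fun k : ℕ => pr d (k + 1) β h) := by
    refine Metric.cauchySeq_iff'.mpr fun ε hε => ?_
    obtain ⟨c, n0, hc⟩ := key (ε / 2) (half_pos hε)
    refine ⟨n0, fun n hn => ?_⟩
    have h1 := hc (n + 1) (by omega)
    have h2 := hc (n0 + 1) (by omega)
    rw [Real.dist_eq]
    rw [abs_lt] at h1 h2 ⊢
    constructor <;> linarith [h1.1, h1.2, h2.1, h2.2]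
  obtain ⟨l, hl⟩ := cauchySeq_tendsto_of_complete hcau
  refine ⟨l, fun u hu hut => ?_⟩
  refine Metric.tendsto_atTop.mpr fun ε hε => ?_
  obtain ⟨N, hN⟩ := Metric.tendsto_atTop.mp hl ε hε
  obtain ⟨K, hK⟩ := eventually_atTop.mp (hut.eventually_ge_atTop (N + 1))
  refine ⟨K, fun k hk => ?_⟩
  have h1 := hK k hk
  have h2 := hN (u k - 1) (by omega)
  have h3 : u k - 1 + 1 = u k := by omega
  have h4 : ∀ (a b : ℕ) (hab : a = b) [NeZero a] [NeZero b], pr d a β h = pr d b β h := by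
    intro a b hab _ _
    subst hab; rfl
  rw [h4 _ _ h3] at h2
  exact h2

end Thermo
end IsingA
end

section
namespace IsingA

section Final

theorem torusZ_eq (d : ℕ) (β h : ℝ) (N : ℕ) [NeZero (2 * N)] :
    IsingP.torusZ d β h N = ZZ d (2 * N) β h := by
  have hN : 0 < N := by
    have := NeZero.ne (2 * N)
    omega
  unfold IsingP.torusZ
  rw [dif_pos hN]
  rfl

theorem final (d : ℕ) (hd : 1 ≤ d) (β₀ h₀ : ℝ) (hβ₀ : 0 ≤ β₀)
    (μ : MeasureTheory.Measure (IsingP.Config d))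
    (hGibbs : IsingP.IsGibbs d β₀ h₀ μ) (hWM : IsingP.WeakMixing d μ) :
    ∃ U : Set (ℝ × ℝ), IsOpen U ∧ (β₀, h₀) ∈ U ∧
      ∃ F : ℝ × ℝ → ℝ, AnalyticOnNhd ℝ F U ∧
        ∀ p ∈ U, Filter.Tendsto
          (fun N : ℕ => ((2 * N : ℝ) ^ d)⁻¹ * Real.log (IsingP.torusZ d p.1 p.2 N))
          Filter.atTop (nhds (F p)) := by
  obtain ⟨L, hL, r, hr, C, hPS⟩ := PS_pr hd β₀ h₀ hβ₀ μ hGibbs hWM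
  choose l hl using fun β h => thermo (d := d) β h
  have hne : ∀ t : ℕ, NeZero (L * (t + 1)) := fun t => ⟨(Nat.mul_pos (by omega) (by omega)).ne'⟩
  have htop : Filter.Tendsto (fun t : ℕ => L * (t + 1)) Filter.atTop Filter.atTop := by
    refine Filter.tendsto_atTop_mono (fun t => ?_) Filter.tendsto_id
    simp only [id]
    nlinarith
  have h1 : PS r C (fun a b => l (β₀ + a) (h₀ + b) - l β₀ h₀) := by
    refine PS_limit hr (fun t a b => pr d (L * (t + 1)) (β₀ + a) (h₀ + b) - pr d (L * (t + 1)) β₀ h₀) _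
      (fun t => hPS (t + 1) (by omega)) (fun a b _ _ => ?_)
    exact (hl _ _ _ hne htop).sub (hl _ _ _ hne htop)
  have h2 := PS_analytic hr _ h1
  refine ⟨Metric.ball (β₀, h₀) (r / 2), Metric.isOpen_ball, Metric.mem_ball_self (by positivity),
    fun p => l p.1 p.2, ?_, fun p _ => ?_⟩
  · intro p hp
    have hp' : p - (β₀, h₀) ∈ Metric.ball (0 : ℝ × ℝ) (r / 2) := by
      rw [mem_ball_zero_iff, ← dist_eq_norm]; exact hp
    have h3 : AnalyticAt ℝ (fun p : ℝ × ℝ => p - (β₀, h₀)) p := analyticAt_id.sub analyticAt_const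
    have h4 := (AnalyticAt.comp' (f := fun p : ℝ × ℝ => p - (β₀, h₀)) (x := p) (h2 _ hp') h3).add (analyticAt_const (v := l β₀ h₀))
    refine h4.congr (Filter.Eventually.of_forall fun z => ?_)
    simp
  · have hne2 : ∀ t : ℕ, NeZero (2 * (t + 1)) := fun t => ⟨by omega⟩
    have h5 := hl p.1 p.2 (fun t => 2 * (t + 1)) hne2
      (Filter.tendsto_atTop_mono (fun t => by simp only [id]; omega) Filter.tendsto_id)
    rw [← Filter.tendsto_add_atTop_iff_nat 1]
    refine h5.congr fun t => ?_
    rw [torusZ_eq]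
    unfold pr
    push_cast
    rfl

end Final
end IsingA
end

/-- if some Gibbs measure at `(β₀,h₀)` is weak mixing, then the pressure is
real-analytic in both variables near `(β₀,h₀)`. -/
theorem pressure_analytic_of_weakMixing (d : ℕ) (hd : 1 ≤ d) (β₀ h₀ : ℝ) (hβ₀ : 0 ≤ β₀)
    (μ : MeasureTheory.Measure (IsingP.Config d))
    (hGibbs : IsingP.IsGibbs d β₀ h₀ μ) (hWM : IsingP.WeakMixing d μ) :
    ∃ U : Set (ℝ × ℝ), IsOpen U ∧ (β₀, h₀) ∈ U ∧
      ∃ F : ℝ × ℝ → ℝ, AnalyticOnNhd ℝ F U ∧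
        ∀ p ∈ U, Filter.Tendsto
          (fun N : ℕ => ((2 * N : ℝ) ^ d)⁻¹ * Real.log (IsingP.torusZ d p.1 p.2 N))
          Filter.atTop (nhds (F p)) := by
  exact IsingA.final d hd β₀ h₀ hβ₀ μ hGibbs hWM
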